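/- Let M_1, …, M_n ⊆ B(H) be ternary masa-bimodules and U_1, …, U_n ⊆ B(K) weak* closed subspaces such that for every non-empty subset E = {i_1, …, i_m} of {1, …, n}, the weak* closure U_E of U_{i_1} + ⋯ + U_{i_m} is completely hyperreflexive. Then the weak* closed span W of M_1 ⊗ U_1 + ⋯ + M_n ⊗ U_n in B(H⊗K) is completely hyperreflexive. -/

import Mathlib

open scoped InnerProductSpace Pointwise

noncomputable section

namespace SchurHyper

/-- `B H` is the algebra of bounded linear operators on `H`. -/
abbrev B (H : Type*) [NormedAddCommGroup H] [InnerProductSpace ℂ H] : Type _ := H →L[ℂ] H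

variable (H : Type*) [NormedAddCommGroup H] [InnerProductSpace ℂ H]

/-- A linear functional on `B H` is *normal* (weak* continuous) if it arises from
the duality with the trace class, i.e. it is of the form
`T ↦ ∑ₙ ⟪yₙ, T xₙ⟫` for square-summable sequences `(xₙ)`, `(yₙ)`
(recall that the inner product is conjugate-linear in its first slot). -/
def IsNormalFunctional (ω : B H →ₗ[ℂ] ℂ) : Prop :=
  ∃ x y : ℕ → H, Summable (fun n => ‖x n‖ ^ 2) ∧ Summable (fun n => ‖y n‖ ^ 2) ∧
    ∀ T : B H, ω T = ∑' n, ⟪y n, T (x n)⟫_ℂ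

/-- The weak* topology on `B H`: the topology induced by the normal functionals. -/
def weakStarTopology : TopologicalSpace (B H) :=
  TopologicalSpace.induced
    (fun (T : B H) (ω : {ω : B H →ₗ[ℂ] ℂ // IsNormalFunctional H ω}) => ω.1 T)
    inferInstance

/-- A set of operators is weak* closed if it is closed in the weak* topology. -/
def WStarClosed (X : Set (B H)) : Prop := @IsClosed _ (weakStarTopology H) X

/-- The weak* closure of a set of operators. -/
def wStarClosure (X : Set (B H)) : Set (B H) := @closure _ (weakStarTopology H) X

/-- A map on `B H` is weak* continuous if it is continuous with respect to the
weak* topology on both sides. -/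
def WStarContinuous (Φ : B H →L[ℂ] B H) : Prop :=
  @Continuous _ _ (weakStarTopology H) (weakStarTopology H) Φ

variable {H}
variable [CompleteSpace H]

/-- A maximal abelian selfadjoint subalgebra of `B H`: an abelian selfadjoint
subalgebra which contains every operator commuting with it (equivalently, it
coincides with its own commutant). -/
def IsMasa (D : StarSubalgebra ℂ (B H)) : Prop :=
  (∀ A ∈ D, ∀ C ∈ D, A * C = C * A) ∧
  (∀ T : B H, (∀ A ∈ D, T * A = A * T) → T ∈ D)

/-- A Schur multiplier: a weak* continuous `D`-bimodule map on `B H`. -/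
def IsSchurMultiplier (D : StarSubalgebra ℂ (B H)) (Φ : B H →L[ℂ] B H) : Prop :=
  WStarContinuous H Φ ∧ ∀ A ∈ D, ∀ C ∈ D, ∀ T : B H, Φ (A * T * C) = A * Φ T * C

/-- A Schur idempotent: an idempotent Schur multiplier. -/
def IsSchurIdempotent (D : StarSubalgebra ℂ (B H)) (Φ : B H →L[ℂ] B H) : Prop :=
  IsSchurMultiplier D Φ ∧ Φ.comp Φ = Φ

/-- A subspace `X ⊆ B H` is a `D`-bimodule if `D X D ⊆ X`. -/
def IsBimodule (D : StarSubalgebra ℂ (B H)) (X : Submodule ℂ (B H)) : Prop :=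
  ∀ A ∈ D, ∀ C ∈ D, ∀ T ∈ X, A * T * C ∈ X

/-- The Arveson distance `α(T, X)`. -/
def arveson (T : B H) (X : Set (B H)) : ℝ :=
  ⨆ ξ : {ξ : H // ‖ξ‖ = 1}, ⨅ S : X, ‖T ξ.1 - S.1 ξ.1‖

/-- The set of hyperreflexivity constants of `X`. -/
def hyperSet (X : Set (B H)) : Set ℝ :=
  {k | 0 < k ∧ ∀ T : B H, Metric.infDist T X ≤ k * arveson T X}

/-- A subspace is hyperreflexive if `d(T, X) ≤ k ⬝ α(T, X)` for some `k > 0`. -/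
def Hyperreflexive (X : Set (B H)) : Prop := (hyperSet X).Nonempty

/-- The hyperreflexivity constant `k(X)`: the least constant that works. -/
def hyperConst (X : Set (B H)) : ℝ := sInf (hyperSet X)

/-- The set of constants `λ` witnessing that a Schur idempotent lies in `𝔉H`. -/
def lamSet (Φ : B H →L[ℂ] B H) : Set ℝ :=
  {l | 0 < l ∧ ∀ T : B H, ‖T - Φ T‖ ≤ l * arveson T (Set.range Φ)}

/-- The class `𝔉H` of Schur idempotents `Φ` such that
`‖T - Φ T‖ ≤ λ ⬝ α(T, ran Φ)` for some `λ > 0` and all `T`. -/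
def MemFH (D : StarSubalgebra ℂ (B H)) (Φ : B H →L[ℂ] B H) : Prop :=
  IsSchurIdempotent D Φ ∧ (lamSet Φ).Nonempty

/-- The constant `λ(Φ)`: the least constant witnessing membership of `𝔉H`. -/
def lam (Φ : B H →L[ℂ] B H) : ℝ := sInf (lamSet Φ)

/-- A ternary masa-bimodule condition: `S T* R ∈ M` whenever `S, T, R ∈ M`. -/
def IsTernary (M : Submodule ℂ (B H)) : Prop :=
  ∀ S ∈ M, ∀ T ∈ M, ∀ R ∈ M, S * star T * R ∈ M

end SchurHyper

open SchurHyper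

/-- `t : H →ₗ K →ₗ HK` realises `HK` as the Hilbert-space tensor product `H ⊗ K`:
inner products of elementary tensors multiply, and elementary tensors are total. -/
def IsElemTensor {H K HK : Type*} [NormedAddCommGroup H] [InnerProductSpace ℂ H]
    [NormedAddCommGroup K] [InnerProductSpace ℂ K]
    [NormedAddCommGroup HK] [InnerProductSpace ℂ HK]
    (t : H →ₗ[ℂ] K →ₗ[ℂ] HK) : Prop :=
  (∀ (x₁ x₂ : H) (y₁ y₂ : K), ⟪t x₁ y₁, t x₂ y₂⟫_ℂ = ⟪x₁, x₂⟫_ℂ * ⟪y₁, y₂⟫_ℂ) ∧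
  Dense ((Submodule.span ℂ {z : HK | ∃ x y, z = t x y} : Submodule ℂ HK) : Set HK)

/-- `τ` sends a pair of operators `A ∈ B(H)`, `C ∈ B(K)` to the tensor product
operator `A ⊗ C ∈ B(H ⊗ K)`, characterised by its action on elementary tensors. -/
def IsOpTensor {H K HK : Type*} [NormedAddCommGroup H] [InnerProductSpace ℂ H]
    [NormedAddCommGroup K] [InnerProductSpace ℂ K]
    [NormedAddCommGroup HK] [InnerProductSpace ℂ HK]
    (t : H →ₗ[ℂ] K →ₗ[ℂ] HK) (τ : B H →ₗ[ℂ] B K →ₗ[ℂ] B HK) : Prop :=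
  ∀ (A : B H) (C : B K) (x : H) (y : K), τ A C (t x y) = t (A x) (C y)

/-- The linear span of the elementary tensors `a ⊗ c` with `a ∈ X`, `c ∈ Y`. -/
def tensorSpan {H K HK : Type*} [NormedAddCommGroup H] [InnerProductSpace ℂ H]
    [NormedAddCommGroup K] [InnerProductSpace ℂ K]
    [NormedAddCommGroup HK] [InnerProductSpace ℂ HK]
    (τ : B H →ₗ[ℂ] B K →ₗ[ℂ] B HK) (X : Set (B H)) (Y : Set (B K)) : Set (B HK) :=
  (Submodule.span ℂ {z : B HK | ∃ a ∈ X, ∃ c ∈ Y, z = τ a c} : Submodule ℂ (B HK))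

/-- A separable infinite-dimensional Hilbert space, namely `ℓ²`. -/
abbrev ell2 : Type := lp (fun _ : ℕ => ℂ) 2

/-- A weak* closed subspace `X ⊆ B(E)` is completely hyperreflexive if the weak*
closed span of `X ⊗ B(ℓ²)` is hyperreflexive (in any realisation of the Hilbert
space tensor product `E ⊗ ℓ²`). -/
def CompletelyHyperreflexive {E : Type*} [NormedAddCommGroup E] [InnerProductSpace ℂ E]
    (X : Set (B E)) : Prop :=
  ∀ (W : Type*) [NormedAddCommGroup W] [InnerProductSpace ℂ W] [CompleteSpace W],
    ∀ (t : E →ₗ[ℂ] ell2 →ₗ[ℂ] W) (τ : B E →ₗ[ℂ] B ell2 →ₗ[ℂ] B W),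
    IsElemTensor t → IsOpTensor t τ →
    Hyperreflexive (wStarClosure W (tensorSpan τ X Set.univ))

namespace SchurHyper

open Filter Topology

section Normal

theorem summable_norm_mul_norm {E F ι : Type*} [NormedAddCommGroup E] [NormedAddCommGroup F]
    {x : ι → E} {y : ι → F}
    (hx : Summable fun i => ‖x i‖ ^ 2) (hy : Summable fun i => ‖y i‖ ^ 2) :
    Summable fun i => ‖y i‖ * ‖x i‖ := by
  refine Summable.of_nonneg_of_le (fun i => by positivity) (fun i => ?_) (hx.add hy)
  nlinarith [sq_nonneg (‖x i‖ - ‖y i‖), sq_nonneg ‖x i‖, sq_nonneg ‖y i‖]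

variable {E F : Type*} [NormedAddCommGroup E] [InnerProductSpace ℂ E]
  [NormedAddCommGroup F] [InnerProductSpace ℂ F]

theorem norm_inner_apply_le (T : E →L[ℂ] F) (x : E) (y : F) :
    ‖⟪y, T x⟫_ℂ‖ ≤ ‖T‖ * (‖y‖ * ‖x‖) := by
  calc ‖⟪y, T x⟫_ℂ‖ ≤ ‖y‖ * ‖T x‖ := norm_inner_le_norm _ _
    _ ≤ ‖y‖ * (‖T‖ * ‖x‖) := by gcongr; exact T.le_opNorm x
    _ = _ := by ring

theorem summable_inner_apply {ι : Type*} {x : ι → E} {y : ι → F}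
    (hx : Summable fun i => ‖x i‖ ^ 2) (hy : Summable fun i => ‖y i‖ ^ 2) (T : E →L[ℂ] F) :
    Summable fun i => ⟪y i, T (x i)⟫_ℂ :=
  Summable.of_norm_bounded ((summable_norm_mul_norm hx hy).mul_left ‖T‖)
    fun _ => norm_inner_apply_le _ _ _

/-- A normal functional may be given by families indexed by any countable type. -/
theorem IsNormalFunctional.of_countable {ι : Type*} [Countable ι] {ω : B E →ₗ[ℂ] ℂ}
    (x y : ι → E) (hx : Summable fun i => ‖x i‖ ^ 2) (hy : Summable fun i => ‖y i‖ ^ 2)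
    (h : ∀ T : B E, ω T = ∑' i, ⟪y i, T (x i)⟫_ℂ) : IsNormalFunctional E ω := by
  obtain ⟨f, hf⟩ := exists_injective_nat ι
  have key : ∀ z : ι → E, (fun n => ‖Function.extend f z 0 n‖ ^ 2)
      = Function.extend f (fun i => ‖z i‖ ^ 2) 0 := by
    intro z
    ext n
    by_cases hn : ∃ i, f i = n
    · obtain ⟨i, rfl⟩ := hn
      simp [hf.extend_apply]
    · simp [Function.extend_apply' _ _ _ hn]
  refine ⟨Function.extend f x 0, Function.extend f y 0, ?_, ?_, fun T => ?_⟩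
  · rw [key]; exact (summable_extend_zero hf).2 hx
  · rw [key]; exact (summable_extend_zero hf).2 hy
  · have : (fun n => ⟪Function.extend f y 0 n, T (Function.extend f x 0 n)⟫_ℂ)
        = Function.extend f (fun i => ⟪y i, T (x i)⟫_ℂ) 0 := by
      ext n
      by_cases hn : ∃ i, f i = n
      · obtain ⟨i, rfl⟩ := hn
        simp [hf.extend_apply]
      · simp [Function.extend_apply' _ _ _ hn]
    rw [h, this, tsum_extend_zero hf]

theorem IsNormalFunctional.zero : IsNormalFunctional E 0 :=
  ⟨0, 0, by simp, by simp, by simp⟩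

theorem IsNormalFunctional.smul {ω : B E →ₗ[ℂ] ℂ} (h : IsNormalFunctional E ω) (c : ℂ) :
    IsNormalFunctional E (c • ω) := by
  obtain ⟨x, y, hx, hy, h⟩ := h
  refine ⟨fun n => c • x n, y, ?_, hy, fun T => ?_⟩
  · simpa [norm_smul, mul_pow] using hx.mul_left (‖c‖ ^ 2)
  · simp [h, tsum_mul_left]

theorem IsNormalFunctional.add {ω ω' : B E →ₗ[ℂ] ℂ} (h : IsNormalFunctional E ω)
    (h' : IsNormalFunctional E ω') : IsNormalFunctional E (ω + ω') := by
  obtain ⟨x, y, hx, hy, h⟩ := h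
  obtain ⟨x', y', hx', hy', h'⟩ := h'
  refine .of_countable (ι := ℕ ⊕ ℕ) (Sum.elim x x') (Sum.elim y y') ?_ ?_ fun T => ?_
  · exact (HasSum.sum (f := fun i => ‖Sum.elim x x' i‖ ^ 2) hx.hasSum hx'.hasSum).summable
  · exact (HasSum.sum (f := fun i => ‖Sum.elim y y' i‖ ^ 2) hy.hasSum hy'.hasSum).summable
  · rw [LinearMap.add_apply, h, h']
    have h1 := (summable_inner_apply hx hy T).hasSum
    have h2 := (summable_inner_apply hx' hy' T).hasSum
    exact (HasSum.sum (f := fun i => ⟪Sum.elim y y' i, T (Sum.elim x x' i)⟫_ℂ) h1 h2).tsum_eq.symm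

theorem IsNormalFunctional.sum {ι : Type*} (s : Finset ι) {ω : ι → B E →ₗ[ℂ] ℂ}
    (h : ∀ i ∈ s, IsNormalFunctional E (ω i)) : IsNormalFunctional E (∑ i ∈ s, ω i) := by
  classical
  induction s using Finset.induction_on with
  | empty => simpa using IsNormalFunctional.zero
  | insert i s hi ih =>
    rw [Finset.sum_insert hi]
    exact (h i (by simp)).add (ih fun j hj => h j (by simp [hj]))

/-- The vector functional `T ↦ ⟪y, T x⟫`. -/
def vectorFunctional (x y : E) : B E →ₗ[ℂ] ℂ where
  toFun T := ⟪y, T x⟫_ℂ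
  map_add' := by simp
  map_smul' := by simp

@[simp] theorem vectorFunctional_apply (x y : E) (T : B E) :
    vectorFunctional x y T = ⟪y, T x⟫_ℂ := rfl

theorem isNormalFunctional_vectorFunctional (x y : E) :
    IsNormalFunctional E (vectorFunctional x y) :=
  .of_countable (ι := Unit) (fun _ => x) (fun _ => y) (hasSum_fintype _).summable
    (hasSum_fintype _).summable (by simp)

/-- The linear map `S ↦ L S R`. -/
def sandwich (L : E →L[ℂ] F) (R : F →L[ℂ] E) : B E →ₗ[ℂ] B F where
  toFun S := L ∘L S ∘L R
  map_add' := by intros; ext; simp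
  map_smul' := by intros; ext; simp

@[simp] theorem sandwich_apply (L : E →L[ℂ] F) (R : F →L[ℂ] E) (S : B E) (x : F) :
    sandwich L R S x = L (S (R x)) := rfl

theorem IsNormalFunctional.comp_sandwich [CompleteSpace E] [CompleteSpace F]
    {ω : B F →ₗ[ℂ] ℂ} (h : IsNormalFunctional F ω) (L : E →L[ℂ] F) (R : F →L[ℂ] E) :
    IsNormalFunctional E (ω ∘ₗ sandwich L R) := by
  obtain ⟨x, y, hx, hy, h⟩ := h
  have key : ∀ (A : F →L[ℂ] E) (z : ℕ → F), Summable (fun n => ‖z n‖ ^ 2) →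
      Summable fun n => ‖A (z n)‖ ^ 2 := by
    intro A z hz
    refine Summable.of_nonneg_of_le (fun n => by positivity) (fun n => ?_) (hz.mul_left (‖A‖ ^ 2))
    rw [← mul_pow]
    gcongr
    exact A.le_opNorm _
  refine ⟨fun n => R (x n), fun n => L.adjoint (y n), key _ _ hx, key _ _ hy, fun T => ?_⟩
  simp [h, ContinuousLinearMap.adjoint_inner_left]

/-- A normal functional respects limits of bounded weakly convergent nets. -/
theorem IsNormalFunctional.tendsto {ι : Type*} {𝓕 : Filter ι} {ω : B E →ₗ[ℂ] ℂ}
    (h : IsNormalFunctional E ω) {f : ι → B E} {A : B E} {C : ℝ} (hC : ∀ i, ‖f i‖ ≤ C)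
    (hf : ∀ x y, Tendsto (fun i => ⟪y, f i x⟫_ℂ) 𝓕 (𝓝 ⟪y, A x⟫_ℂ)) :
    Tendsto (fun i => ω (f i)) 𝓕 (𝓝 (ω A)) := by
  obtain ⟨x, y, hx, hy, h⟩ := h
  simp only [h]
  refine tendsto_tsum_of_dominated_convergence ((summable_norm_mul_norm hx hy).mul_left C)
    (fun n => hf _ _) (Eventually.of_forall fun i n => ?_)
  refine (norm_inner_apply_le _ _ _).trans ?_
  gcongr
  exact hC i

variable (Y : Submodule ℂ (B E))

/-- The weak* closure of a subspace, as a bipolar. -/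
def wsc : Submodule ℂ (B E) where
  carrier := {T | ∀ ω : B E →ₗ[ℂ] ℂ, IsNormalFunctional E ω → (∀ S ∈ Y, ω S = 0) → ω T = 0}
  add_mem' := by
    intro a b ha hb ω hω h
    rw [map_add, ha ω hω h, hb ω hω h, add_zero]
  zero_mem' := by simp
  smul_mem' := by
    intro c a ha ω hω h
    rw [map_smul, ha ω hω h, smul_zero]

variable {Y}

theorem le_wsc : Y ≤ wsc Y := fun _ hT _ _ h => h _ hT

theorem wsc_le_wsc_of_le {Z : Submodule ℂ (B E)} (h : Y ≤ wsc Z) : wsc Y ≤ wsc Z :=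
  fun _ hT ω hω hZ => hT ω hω fun _ hS => h hS ω hω hZ

theorem wsc_idem : wsc (wsc Y) = wsc Y := le_antisymm (wsc_le_wsc_of_le le_rfl) le_wsc

theorem wsc_mono {Z : Submodule ℂ (B E)} (h : Y ≤ Z) : wsc Y ≤ wsc Z :=
  wsc_le_wsc_of_le (h.trans le_wsc)

/-- Linear maps which pull normal functionals back to normal functionals respect closures. -/
theorem map_mem_wsc {Z : Submodule ℂ (B F)} (φ : B E →ₗ[ℂ] B F)
    (hφ : ∀ ω : B F →ₗ[ℂ] ℂ, IsNormalFunctional F ω → IsNormalFunctional E (ω ∘ₗ φ))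
    (h : ∀ S ∈ Y, φ S ∈ wsc Z) {T : B E} (hT : T ∈ wsc Y) : φ T ∈ wsc Z :=
  fun ω hω hZ => hT (ω ∘ₗ φ) (hφ ω hω) fun S hS => h S hS ω hω hZ

theorem mem_wsc_of_tendsto {ι : Type*} {𝓕 : Filter ι} [𝓕.NeBot] {f : ι → B E} {A : B E} {C : ℝ}
    (hC : ∀ i, ‖f i‖ ≤ C) (hf : ∀ x y, Tendsto (fun i => ⟪y, f i x⟫_ℂ) 𝓕 (𝓝 ⟪y, A x⟫_ℂ))
    (h : ∀ i, f i ∈ wsc Y) : A ∈ wsc Y := by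
  intro ω hω hY
  have h1 := hω.tendsto hC hf
  simp only [fun i => h i ω hω hY] at h1
  exact tendsto_nhds_unique h1 tendsto_const_nhds

theorem coe_wsc : (wsc Y : Set (B E)) = wStarClosure E (Y : Set (B E)) := by
  classical
  let Ω := {ω : B E →ₗ[ℂ] ℂ // IsNormalFunctional E ω}
  let Λ : B E → Ω → ℂ := fun T ω => ω.1 T
  have hcl : ∀ T, T ∈ wStarClosure E (Y : Set (B E)) ↔ Λ T ∈ closure (Λ '' (Y : Set (B E))) := by
    intro T
    exact closure_induced
  ext T
  rw [hcl]
  constructor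
  · intro hT
    rw [mem_closure_iff_nhds]
    intro s hs
    rw [nhds_pi, Filter.mem_pi'] at hs
    obtain ⟨I, U, hU, hIU⟩ := hs
    let φ : B E →ₗ[ℂ] (I → ℂ) := LinearMap.pi fun i => i.1.1
    have hmem : φ T ∈ Y.map φ := by
      by_contra hn
      obtain ⟨g, hg, hgY⟩ := Submodule.exists_le_ker_of_notMem hn
      let ω : B E →ₗ[ℂ] ℂ := ∑ i : I, g (Pi.single i 1) • i.1.1
      have hω : ∀ S, ω S = g (φ S) := by
        intro S
        rw [LinearMap.pi_apply_eq_sum_univ g (φ S)]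
        simp [ω, φ, mul_comm, LinearMap.sum_apply]
        refine Finset.sum_congr rfl fun i _ => ?_
        congr 3
        ext j
        simp [Pi.single_apply, eq_comm]
      apply hg
      rw [← hω]
      refine hT ω (IsNormalFunctional.sum _ fun i _ => i.1.2.smul _) fun S hS => ?_
      rw [hω]
      exact hgY (Submodule.mem_map_of_mem hS)
    obtain ⟨S, hS, hST⟩ := hmem
    refine ⟨Λ S, hIU fun i hi => ?_, S, hS, rfl⟩
    have : Λ S i = Λ T i := congrFun hST ⟨i, hi⟩
    rw [this]
    exact mem_of_mem_nhds (hU i)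
  · intro hT ω hω hY
    have hcont : IsClosed {g : Ω → ℂ | g ⟨ω, hω⟩ = 0} :=
      isClosed_eq (continuous_apply _) continuous_const
    have : closure (Λ '' (Y : Set (B E))) ⊆ {g : Ω → ℂ | g ⟨ω, hω⟩ = 0} := by
      refine closure_minimal ?_ hcont
      rintro _ ⟨S, hS, rfl⟩
      exact hY S hS
    exact this hT

theorem wsc_eq_of_wStarClosed (h : WStarClosed E (Y : Set (B E))) : wsc Y = Y := by
  apply SetLike.coe_injective
  rw [coe_wsc]
  exact @IsClosed.closure_eq _ (weakStarTopology E) _ h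

/-- Bounded families of operators have weak limits along ultrafilters. -/
theorem exists_weak_limit [CompleteSpace E] {ι : Type*} (𝔲 : Ultrafilter ι) {f : ι → B E} {C : ℝ}
    (hC : ∀ i, ‖f i‖ ≤ C) : ∃ A : B E, ‖A‖ ≤ C ∧
      ∀ x y, Tendsto (fun i => ⟪y, f i x⟫_ℂ) 𝔲 (𝓝 ⟪y, A x⟫_ℂ) := by
  have hC0 : 0 ≤ C := by
    obtain ⟨i⟩ := Filter.nonempty_of_neBot (𝔲 : Filter ι)
    exact (norm_nonneg _).trans (hC i)
  have hb : ∀ i x y, ‖⟪y, f i x⟫_ℂ‖ ≤ C * ‖y‖ * ‖x‖ := by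
    intro i x y
    refine (norm_inner_apply_le _ _ _).trans ?_
    rw [mul_assoc]
    gcongr
    exact hC i
  have hl : ∀ x y, ∃ z : ℂ, ‖z‖ ≤ C * ‖y‖ * ‖x‖ ∧ Tendsto (fun i => ⟪y, f i x⟫_ℂ) 𝔲 (𝓝 z) := by
    intro x y
    have hK : IsCompact (Metric.closedBall (0 : ℂ) (C * ‖y‖ * ‖x‖)) := isCompact_closedBall _ _
    obtain ⟨z, hz, hz'⟩ := hK.ultrafilter_le_nhds (𝔲.map fun i => ⟪y, f i x⟫_ℂ) (by
      simp only [Ultrafilter.coe_map, Filter.le_principal_iff, Filter.mem_map]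
      refine Filter.univ_mem' fun i => ?_
      simpa using hb i x y)
    exact ⟨z, by simpa using hz, hz'⟩
  choose z hz hzt using hl
  let b : E →L⋆[ℂ] E →L[ℂ] ℂ := LinearMap.mkContinuous₂
    { toFun := fun y =>
        { toFun := fun x => z x y
          map_add' := fun x x' => by
            refine tendsto_nhds_unique (hzt (x + x') y) ?_
            simpa [inner_add_right] using (hzt x y).add (hzt x' y)
          map_smul' := fun c x => by
            refine tendsto_nhds_unique (hzt (c • x) y) ?_
            simpa [inner_smul_right] using (hzt x y).const_mul c }
      map_add' := fun y y' => by
        ext x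
        refine tendsto_nhds_unique (hzt x (y + y')) ?_
        simpa [inner_add_left] using (hzt x y).add (hzt x y')
      map_smul' := fun c y => by
        ext x
        refine tendsto_nhds_unique (hzt x (c • y)) ?_
        simpa [inner_smul_left, mul_comm] using (hzt x y).const_mul (starRingEnd ℂ c) }
    C (fun y x => hz x y)
  have hbz : ∀ x y, b y x = z x y := fun x y => rfl
  let A := (InnerProductSpace.continuousLinearMapOfBilin b).adjoint
  have hA : ∀ x y, ⟪y, A x⟫_ℂ = z x y := by
    intro x y
    rw [ContinuousLinearMap.adjoint_inner_right,
      InnerProductSpace.continuousLinearMapOfBilin_apply, hbz]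
  refine ⟨A, ?_, fun x y => by rw [hA]; exact hzt x y⟩
  refine A.opNorm_le_bound hC0 fun x => ?_
  by_cases h0 : ‖A x‖ = 0
  · rw [h0]; positivity
  · have h1 := hz x (A x)
    rw [← hA, inner_self_eq_norm_sq_to_K] at h1
    have h2 : ‖A x‖ ^ 2 ≤ C * ‖A x‖ * ‖x‖ := by simpa using h1
    have h3 : 0 < ‖A x‖ := lt_of_le_of_ne (norm_nonneg _) (Ne.symm h0)
    nlinarith

theorem norm_le_of_inner_le {C : ℝ} (hC : 0 ≤ C) {A : E →L[ℂ] F}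
    (h : ∀ x y, ‖⟪y, A x⟫_ℂ‖ ≤ C * ‖x‖ * ‖y‖) : ‖A‖ ≤ C := by
  refine A.opNorm_le_bound hC fun x => ?_
  by_cases h0 : ‖A x‖ = 0
  · rw [h0]; positivity
  · have h1 := h x (A x)
    rw [inner_self_eq_norm_sq_to_K] at h1
    have h2 : ‖A x‖ ^ 2 ≤ C * ‖x‖ * ‖A x‖ := by simpa using h1
    have h3 : 0 < ‖A x‖ := lt_of_le_of_ne (norm_nonneg _) (Ne.symm h0)
    nlinarith

end Normal

section Tensor

variable {A C G : Type*} [NormedAddCommGroup A] [InnerProductSpace ℂ A]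
  [NormedAddCommGroup C] [InnerProductSpace ℂ C] [NormedAddCommGroup G] [InnerProductSpace ℂ G]
  {t : A →ₗ[ℂ] C →ₗ[ℂ] G} {τ : B A →ₗ[ℂ] B C →ₗ[ℂ] B G}

theorem IsElemTensor.flip (ht : IsElemTensor t) : IsElemTensor t.flip := by
  refine ⟨fun x₁ x₂ y₁ y₂ => by simp [ht.1, mul_comm], ?_⟩
  convert ht.2 using 3
  ext z
  exact exists_comm

theorem IsOpTensor.flip (hτ : IsOpTensor t τ) : IsOpTensor t.flip τ.flip :=
  fun a c x y => hτ c a y x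

theorem IsElemTensor.norm_apply (ht : IsElemTensor t) (a : A) (c : C) :
    ‖t a c‖ = ‖a‖ * ‖c‖ := by
  have h := ht.1 a a c c
  simp only [inner_self_eq_norm_sq_to_K] at h
  have h2 : ‖t a c‖ ^ 2 = (‖a‖ * ‖c‖) ^ 2 := by
    rw [mul_pow]
    exact_mod_cast h
  exact (pow_left_inj₀ (norm_nonneg _) (by positivity) two_ne_zero).1 h2

/-- The operator `a ↦ a ⊗ c`. -/
def IsElemTensor.ins (ht : IsElemTensor t) (c : C) : A →L[ℂ] G :=
  (t.flip c).mkContinuous ‖c‖ fun a => by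
    rw [LinearMap.flip_apply, ht.norm_apply, mul_comm]

@[simp] theorem IsElemTensor.ins_apply (ht : IsElemTensor t) (c : C) (a : A) :
    ht.ins c a = t a c := rfl

theorem IsElemTensor.ext_clm (ht : IsElemTensor t) {X : Type*} [NormedAddCommGroup X]
    [NormedSpace ℂ X] {f g : G →L[ℂ] X} (h : ∀ a c, f (t a c) = g (t a c)) : f = g := by
  refine ContinuousLinearMap.ext_on ht.2 ?_
  rintro _ ⟨a, c, rfl⟩
  exact h a c

theorem IsElemTensor.ext_left (ht : IsElemTensor t) {x y : G}
    (h : ∀ a c, ⟪t a c, x⟫_ℂ = ⟪t a c, y⟫_ℂ) : x = y := by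
  have h1 : innerSL ℂ x = innerSL ℂ y := ht.ext_clm fun a c => by
    have := congrArg (starRingEnd ℂ) (h a c)
    simpa using this
  exact ext_inner_right ℂ fun v => by simpa using congrArg (· v) h1

theorem IsElemTensor.ext_inner (ht : IsElemTensor t) {f g : B G}
    (h : ∀ a c a' c', ⟪t a' c', f (t a c)⟫_ℂ = ⟪t a' c', g (t a c)⟫_ℂ) : f = g :=
  ht.ext_clm fun a c => ht.ext_left fun a' c' => h a c a' c'

theorem IsOpTensor.mul (hτ : IsOpTensor t τ) (ht : IsElemTensor t) (a a' : B A) (c c' : B C) :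
    τ a c * τ a' c' = τ (a * a') (c * c') :=
  ht.ext_clm fun x y => by
    simp [hτ _ _ _ _]

theorem IsOpTensor.one (hτ : IsOpTensor t τ) (ht : IsElemTensor t) : τ 1 1 = 1 :=
  ht.ext_clm fun x y => by simp [hτ _ _ _ _]

theorem IsOpTensor.star [CompleteSpace A] [CompleteSpace C] [CompleteSpace G]
    (hτ : IsOpTensor t τ) (ht : IsElemTensor t) (a : B A) (c : B C) :
    star (τ a c) = τ (star a) (star c) :=
  ht.ext_inner fun x y x' y' => by
    rw [ContinuousLinearMap.star_eq_adjoint, ContinuousLinearMap.adjoint_inner_right, hτ, hτ,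
      ht.1, ht.1, ContinuousLinearMap.star_eq_adjoint, ContinuousLinearMap.star_eq_adjoint,
      ContinuousLinearMap.adjoint_inner_right, ContinuousLinearMap.adjoint_inner_right]

/-- The ampliation `a ↦ a ⊗ 1`. -/
def IsOpTensor.amp [CompleteSpace A] [CompleteSpace C] [CompleteSpace G]
    (hτ : IsOpTensor t τ) (ht : IsElemTensor t) : B A →⋆ₐ[ℂ] B G where
  toFun a := τ a 1
  map_one' := hτ.one ht
  map_mul' a b := by rw [hτ.mul ht, one_mul]
  map_zero' := by simp
  map_add' := by simp
  commutes' r := by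
    rw [Algebra.algebraMap_eq_smul_one, Algebra.algebraMap_eq_smul_one, map_smul,
      LinearMap.smul_apply, hτ.one ht]
  map_star' a := by rw [hτ.star ht, star_one]

theorem IsOpTensor.amp_apply [CompleteSpace A] [CompleteSpace C] [CompleteSpace G]
    (hτ : IsOpTensor t τ) (ht : IsElemTensor t) (a : B A) : hτ.amp ht a = τ a 1 := rfl

@[simp] theorem IsOpTensor.amp_tensor [CompleteSpace A] [CompleteSpace C] [CompleteSpace G]
    (hτ : IsOpTensor t τ) (ht : IsElemTensor t) (a : B A) (x : A) (y : C) :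
    hτ.amp ht a (t x y) = t (a x) y := hτ a 1 x y

theorem IsOpTensor.norm_le [CompleteSpace A] [CompleteSpace C] [CompleteSpace G]
    (hτ : IsOpTensor t τ) (ht : IsElemTensor t) (a : B A) (c : B C) :
    ‖τ a c‖ ≤ ‖a‖ * ‖c‖ := by
  have h : τ a c = hτ.amp ht a * hτ.flip.amp ht.flip c := by
    rw [hτ.amp_apply, hτ.flip.amp_apply, LinearMap.flip_apply, hτ.mul ht, mul_one, one_mul]
  rw [h]
  refine (norm_mul_le _ _).trans ?_
  gcongr <;> exact NonUnitalStarAlgHom.norm_apply_le _ _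

/-- Diagonal ampliation on `ℓ²`-sums. -/
def lpMap {ι : Type*} (a : B A) : B (lp (fun _ : ι => A) 2) :=
  lp.mapCLM 2 (fun _ => a) (norm_nonneg a) fun _ => le_rfl

@[simp] theorem lpMap_apply {ι : Type*} (a : B A) (x : lp (fun _ : ι => A) 2) (i : ι) :
    lpMap a x i = a (x i) := rfl

variable {ι : Type*}

/-- The isometry `a ↦ a ⊗ c` for a unit vector `c`. -/
def IsElemTensor.insIsometry (ht : IsElemTensor t) {c : C} (hc : ‖c‖ = 1) : A →ₗᵢ[ℂ] G where
  toLinearMap := t.flip c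
  norm_map' a := by simp [ht.norm_apply, hc]

theorem IsElemTensor.insIsometry_apply (ht : IsElemTensor t) {c : C} (hc : ‖c‖ = 1) (a : A) :
    ht.insIsometry hc a = t a c := rfl

theorem IsElemTensor.isHilbertSum [CompleteSpace A] [CompleteSpace G] (ht : IsElemTensor t)
    (b : HilbertBasis ι ℂ C) :
    IsHilbertSum ℂ (fun _ : ι => A) fun i : ι => ht.insIsometry (b.orthonormal.1 i) := by
  refine IsHilbertSum.mk (fun i j hij a a' => ?_) ?_
  · simp [ht.insIsometry_apply, ht.1, b.orthonormal.2 hij]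
  · set V := (⨆ i, LinearMap.range (ht.insIsometry (b.orthonormal.1 i)).toLinearMap) with hV
    have hV' : ∀ a i, t a (b i) ∈ V := fun a i =>
      Submodule.mem_iSup_of_mem i ⟨a, rfl⟩
    have key : ∀ a c, t a c ∈ V.topologicalClosure := by
      intro a c
      have hc : c ∈ (Submodule.span ℂ (Set.range b)).topologicalClosure := by
        rw [b.dense_span]; trivial
      have hcl : IsClosed {c | t a c ∈ V.topologicalClosure} :=
        V.isClosed_topologicalClosure.preimage (ht.flip.ins a).continuous
      refine closure_minimal (s := (Submodule.span ℂ (Set.range b) : Set C)) ?_ hcl hc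
      intro c hc
      have : Submodule.span ℂ (Set.range b) ≤ V.topologicalClosure.comap (t a) := by
        rw [Submodule.span_le]
        rintro _ ⟨i, rfl⟩
        exact V.le_topologicalClosure (hV' a i)
      exact this hc
    intro x _
    refine closure_minimal
      (s := ((Submodule.span ℂ {z : G | ∃ x y, z = t x y} : Submodule ℂ G) : Set G))
      ?_ V.isClosed_topologicalClosure (ht.2 x)
    rw [SetLike.coe_subset_coe, Submodule.span_le]
    rintro _ ⟨a, c, rfl⟩
    exact key a c

/-- The identification of `A ⊗ C` with an `ℓ²`-sum of copies of `A` along a basis of `C`. -/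
def IsElemTensor.decomp [CompleteSpace A] [CompleteSpace G] (ht : IsElemTensor t)
    (b : HilbertBasis ι ℂ C) : G ≃ₗᵢ[ℂ] lp (fun _ : ι => A) 2 :=
  (ht.isHilbertSum b).linearIsometryEquiv

theorem IsElemTensor.inner_decomp_apply [CompleteSpace A] [CompleteSpace G]
    (ht : IsElemTensor t) (b : HilbertBasis ι ℂ C) (x : G) (i : ι) (a : A) :
    ⟪a, ht.decomp b x i⟫_ℂ = ⟪t a (b i), x⟫_ℂ := by
  classical
  refine (lp.inner_single_left (𝕜 := ℂ) i a (ht.decomp b x)).symm.trans ?_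
  rw [← (ht.decomp b).symm.inner_map_map, LinearIsometryEquiv.symm_apply_apply]
  unfold IsElemTensor.decomp
  rw [IsHilbertSum.linearIsometryEquiv_symm_apply_single]
  rfl

theorem IsElemTensor.decomp_apply [CompleteSpace A] [CompleteSpace G]
    (ht : IsElemTensor t) (b : HilbertBasis ι ℂ C) (x : G) (i : ι) :
    ht.decomp b x i = (ht.ins (b i)).adjoint x :=
  ext_inner_left ℂ fun a => by
    rw [ht.inner_decomp_apply, ContinuousLinearMap.adjoint_inner_right, ht.ins_apply]

theorem IsElemTensor.hasSum_inner [CompleteSpace A] [CompleteSpace G] (ht : IsElemTensor t)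
    (b : HilbertBasis ι ℂ C) (x y : G) :
    HasSum (fun i => ⟪(ht.ins (b i)).adjoint y, (ht.ins (b i)).adjoint x⟫_ℂ) ⟪y, x⟫_ℂ := by
  have := lp.hasSum_inner (𝕜 := ℂ) (ht.decomp b y) (ht.decomp b x)
  simpa only [ht.decomp_apply, LinearIsometryEquiv.inner_map_map] using this

theorem IsElemTensor.hasSum_norm_sq [CompleteSpace A] [CompleteSpace G] (ht : IsElemTensor t)
    (b : HilbertBasis ι ℂ C) (x : G) :
    HasSum (fun i => ‖(ht.ins (b i)).adjoint x‖ ^ 2) (‖x‖ ^ 2) := by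
  have := ht.hasSum_inner b x x
  simp only [inner_self_eq_norm_sq_to_K] at this
  exact_mod_cast this

/-- Conjugating the diagonal ampliation with `decomp` gives `a ⊗ 1`. -/
theorem IsElemTensor.exists_amp [CompleteSpace A] [CompleteSpace C] [CompleteSpace G]
    (ht : IsElemTensor t) :
    ∃ φ : B A →ₗ[ℂ] B G, ∀ a x y, φ a (t x y) = t (a x) y := by
  obtain ⟨w, b, -⟩ := exists_hilbertBasis ℂ C
  refine ⟨{ toFun := fun a => (ht.decomp b).symm.toContinuousLinearEquiv.toContinuousLinearMap ∘L
              lpMap a ∘L (ht.decomp b).toContinuousLinearEquiv.toContinuousLinearMap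
            map_add' := fun a a' => by
              ext x
              apply (ht.decomp b).injective
              simp only [ContinuousLinearMap.comp_apply, add_apply, map_add]
              simp
              ext i; simp
            map_smul' := fun r a => by
              ext x
              apply (ht.decomp b).injective
              simp
              ext i; simp }, fun a x y => ?_⟩
  apply (ht.decomp b).injective
  ext i
  have key : ∀ x y, ht.decomp b (t x y) i = ⟪b i, y⟫_ℂ • x := fun x y => by
    refine ext_inner_left ℂ fun a => ?_
    rw [ht.inner_decomp_apply, ht.1, inner_smul_right, mul_comm]
  simp [key]

theorem IsElemTensor.exists_opTensor [CompleteSpace A] [CompleteSpace C] [CompleteSpace G]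
    (ht : IsElemTensor t) : ∃ τ : B A →ₗ[ℂ] B C →ₗ[ℂ] B G, IsOpTensor t τ := by
  obtain ⟨φ, hφ⟩ := ht.exists_amp
  obtain ⟨ψ, hψ⟩ := ht.flip.exists_amp
  refine ⟨LinearMap.mk₂ ℂ (fun a c => φ a * ψ c) (by simp [add_mul]) (by simp)
    (by simp [mul_add]) (by simp), fun a c x y => ?_⟩
  have := hψ c y x
  simp only [LinearMap.flip_apply] at this
  simp [this, hφ]

theorem _root_.HilbertBasis.countable [TopologicalSpace.SeparableSpace C]
    (b : HilbertBasis ι ℂ C) : Countable ι := by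
  refine Pairwise.countable_of_isOpen_disjoint (s := fun i => Metric.ball (b i) (1 / 2)) ?_
    (fun i => Metric.isOpen_ball) fun i => ⟨b i, by simp⟩
  intro i j hij
  refine Metric.ball_disjoint_ball ?_
  have h : ‖b i - b j‖ ^ 2 = 2 := by
    rw [@norm_sub_sq ℂ, b.orthonormal.1 i, b.orthonormal.1 j, b.orthonormal.2 hij]
    norm_num
  rw [dist_eq_norm]
  nlinarith [norm_nonneg (b i - b j)]

theorem IsElemTensor.adjoint_ins_comp [CompleteSpace A] [CompleteSpace C] [CompleteSpace G]
    (ht : IsElemTensor t) (hτ : IsOpTensor t τ) (T : B A) (c : C) :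
    (ht.ins c).adjoint ∘L τ T 1 = T ∘L (ht.ins c).adjoint := by
  ext x
  refine ext_inner_left ℂ fun a => ?_
  rw [ContinuousLinearMap.comp_apply, ContinuousLinearMap.comp_apply,
    ContinuousLinearMap.adjoint_inner_right, ← ContinuousLinearMap.adjoint_inner_left T,
    ContinuousLinearMap.adjoint_inner_right, ← ContinuousLinearMap.adjoint_inner_left (τ T 1),
    ← ContinuousLinearMap.star_eq_adjoint, ← ContinuousLinearMap.star_eq_adjoint, hτ.star ht,
    star_one, ht.ins_apply, ht.ins_apply, hτ, one_apply_eq_self]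

theorem IsElemTensor.summable_norm_sq_slice [CompleteSpace A] [CompleteSpace G]
    (ht : IsElemTensor t) (b : HilbertBasis ι ℂ C) {z : ℕ → G}
    (hz : Summable fun n => ‖z n‖ ^ 2) :
    Summable fun p : ℕ × ι => ‖(ht.ins (b p.2)).adjoint (z p.1)‖ ^ 2 := by
  rw [summable_prod_of_nonneg fun p => by positivity]
  refine ⟨fun n => (ht.hasSum_norm_sq b (z n)).summable, ?_⟩
  simpa only [(ht.hasSum_norm_sq b _).tsum_eq] using hz

/-- Slicing a normal functional in the first tensor factor. -/
theorem IsNormalFunctional.comp_left [CompleteSpace A] [CompleteSpace C] [CompleteSpace G]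
    [TopologicalSpace.SeparableSpace C] (ht : IsElemTensor t) (hτ : IsOpTensor t τ)
    {ω : B G →ₗ[ℂ] ℂ} (hω : IsNormalFunctional G ω) (c : B C) :
    IsNormalFunctional A (ω ∘ₗ τ.flip c) := by
  obtain ⟨x, y, hx, hy, h⟩ := hω
  obtain ⟨w, b, -⟩ := exists_hilbertBasis ℂ C
  have := b.countable
  have hx' : Summable fun n => ‖τ 1 c (x n)‖ ^ 2 := by
    refine Summable.of_nonneg_of_le (fun n => by positivity) (fun n => ?_)
      (hx.mul_left (‖τ 1 c‖ ^ 2))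
    rw [← mul_pow]
    gcongr
    exact (τ 1 c).le_opNorm _
  have hsx := ht.summable_norm_sq_slice b hx'
  have hsy := ht.summable_norm_sq_slice b hy
  refine .of_countable (ι := ℕ × w) (fun p => (ht.ins (b p.2)).adjoint (τ 1 c (x p.1)))
    (fun p => (ht.ins (b p.2)).adjoint (y p.1)) hsx hsy fun T => ?_
  rw [(summable_inner_apply hsx hsy T).tsum_prod, LinearMap.comp_apply, h]
  refine tsum_congr fun n => ?_
  have h1 : τ.flip c T = τ T 1 * τ 1 c := by
    rw [LinearMap.flip_apply, hτ.mul ht, mul_one, one_mul]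
  rw [h1]
  refine (ht.hasSum_inner b (τ T 1 (τ 1 c (x n))) (y n)).tsum_eq.symm.trans
    (tsum_congr fun i => ?_)
  have h3 := DFunLike.congr_fun (ht.adjoint_ins_comp hτ T (b i)) (τ 1 c (x n))
  simp only [ContinuousLinearMap.comp_apply] at h3
  rw [h3]

end Tensor

section Standard

variable {K : Type*} [NormedAddCommGroup K] [InnerProductSpace ℂ K]

variable (K) in
/-- The standard realisation of `K ⊗ ℓ²` as an `ℓ²`-sum of copies of `K`. -/
def stdTensor : K →ₗ[ℂ] ell2 →ₗ[ℂ] lp (fun _ : ℕ => K) 2 :=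
  LinearMap.mk₂ ℂ
    (fun k l => ⟨fun m => l m • k, by
      refine memℓp_gen ?_
      have h := (lp.memℓp l).summable (by norm_num)
      simpa [norm_smul, mul_pow] using h.mul_right (‖k‖ ^ 2)⟩)
    (fun _ _ _ => by ext; simp; rfl) (fun _ _ _ => by ext; simp [smul_smul, mul_comm])
    (fun _ _ _ => by ext; simp [add_smul]; rfl) (fun _ _ _ => by ext; simp [smul_smul])

@[simp] theorem stdTensor_apply (k : K) (l : ell2) (m : ℕ) : stdTensor K k l m = l m • k := rfl

theorem isElemTensor_stdTensor : IsElemTensor (stdTensor K) := by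
  refine ⟨fun x₁ x₂ y₁ y₂ => ?_, fun x => ?_⟩
  · rw [lp.inner_eq_tsum, lp.inner_eq_tsum, ← tsum_mul_left]
    refine tsum_congr fun m => ?_
    simp [inner_smul_left, inner_smul_right]
    ring
  · refine mem_closure_of_tendsto (lp.hasSum_single (by simp) x)
      (Eventually.of_forall fun s => ?_)
    refine Submodule.sum_mem _ fun m _ => Submodule.subset_span
      ⟨x m, lp.single 2 m (1 : ℂ), ?_⟩
    ext j
    by_cases h : j = m
    · subst h; simp
    · simp [h]

theorem IsElemTensor.trans {A C G G' : Type*} [NormedAddCommGroup A] [InnerProductSpace ℂ A]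
    [NormedAddCommGroup C] [InnerProductSpace ℂ C] [NormedAddCommGroup G] [InnerProductSpace ℂ G]
    [NormedAddCommGroup G'] [InnerProductSpace ℂ G'] {t : A →ₗ[ℂ] C →ₗ[ℂ] G}
    (ht : IsElemTensor t) (V : G ≃ₗᵢ[ℂ] G') :
    IsElemTensor (t.compr₂ V.toLinearEquiv.toLinearMap) := by
  refine ⟨fun x₁ x₂ y₁ y₂ => ?_, fun z => ?_⟩
  · simp [ht.1]
  · have h1 : V (V.symm z) ∈ closure (V '' ((Submodule.span ℂ {z : G | ∃ x y, z = t x y} :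
        Submodule ℂ G) : Set G)) :=
      image_closure_subset_closure_image V.continuous ⟨_, ht.2 _, rfl⟩
    rw [V.apply_symm_apply] at h1
    refine closure_mono ?_ h1
    rintro _ ⟨z, hz, rfl⟩
    have : (Submodule.span ℂ {z : G | ∃ x y, z = t x y}) ≤ (Submodule.span ℂ {z : G' | ∃ x y,
        z = t.compr₂ V.toLinearEquiv.toLinearMap x y}).comap V.toLinearEquiv.toLinearMap := by
      rw [Submodule.span_le]
      rintro _ ⟨x, y, rfl⟩
      exact Submodule.subset_span ⟨x, y, rfl⟩
    exact this hz

/-- The standard basis of `ℓ²`. -/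
def stdBasis : HilbertBasis ℕ ℂ ell2 := ⟨LinearIsometryEquiv.refl ℂ _⟩

instance : TopologicalSpace.SeparableSpace ell2 := by
  obtain ⟨s, hs, hs'⟩ : TopologicalSpace.IsSeparable (Set.univ : Set ell2) := by
    have h := (TopologicalSpace.IsSeparable.span (R := ℂ)
      (Set.countable_range stdBasis).isSeparable).closure
    rwa [← Submodule.topologicalClosure_coe, stdBasis.dense_span] at h
  exact ⟨s, hs, fun x => hs' trivial⟩

end Standard

section Cfc

variable {𝒜 : Type*} [CStarAlgebra 𝒜]

theorem cfc_intertwine {a b m : 𝒜} (ha : IsSelfAdjoint a) (hb : IsSelfAdjoint b)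
    (h : a * m = m * b) {f : ℝ → ℝ} (hf : Continuous f) : cfc f a * m = m * cfc f b := by
  have : ContinuousFunctionalCalculus ℝ (𝒜 × 𝒜) IsSelfAdjoint :=
    (IsSelfAdjoint.instContinuousFunctionalCalculus :
      @ContinuousFunctionalCalculus ℝ (𝒜 × 𝒜) IsSelfAdjoint _ _ _ _ _ _ _ _ Algebra.complexToReal)
  have hab : IsSelfAdjoint (a, b) := Prod.ext ha hb
  have key : (cfc f (a, b)).1 * m = m * (cfc f (a, b)).2 := by
    rw [cfc_apply f (a, b) hab hf.continuousOn]
    generalize (⟨_, hf.continuousOn.domRestrict⟩ : C(spectrum ℝ (a, b), ℝ)) = g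
    induction g using ContinuousMap.induction_on_of_compact with
    | const r =>
      have : (ContinuousMap.const (spectrum ℝ (a, b)) r) =
          algebraMap ℝ C(spectrum ℝ (a, b), ℝ) r := rfl
      rw [this, AlgHomClass.commutes]
      exact Algebra.commutes r m
    | id => rw [cfcHom_id hab]; exact h
    | star_id => rw [map_star, cfcHom_id hab, hab.star_eq]; exact h
    | add f g hf hg => simp only [map_add, Prod.fst_add, Prod.snd_add, add_mul, mul_add, hf, hg]
    | mul f g hf hg =>
      simp only [map_mul, Prod.fst_mul, Prod.snd_mul]
      rw [mul_assoc, hg, ← mul_assoc, hf, mul_assoc]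
    | frequently f hf =>
      have hcl : IsClosed {g : C(spectrum ℝ (a, b), ℝ) |
          (cfcHom hab g).1 * m = m * (cfcHom hab g).2} := by
        have hc : Continuous (cfcHom hab : C(spectrum ℝ (a, b), ℝ) →⋆ₐ[ℝ] 𝒜 × 𝒜) :=
          cfcHom_continuous hab
        exact isClosed_eq ((continuous_fst.comp hc).mul continuous_const)
          (continuous_const.mul (continuous_snd.comp hc))
      exact hcl.closure_subset (mem_closure_iff_frequently.2 hf)
  rwa [cfc_map_prod (S := ℂ) f a b hf.continuousOn hab ha hb] at key

end Cfc

section RangeProj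

variable {H : Type*} [NormedAddCommGroup H] [InnerProductSpace ℂ H] [CompleteSpace H]

/-- The projection onto the closure of a subspace. -/
def closureProj (X : Submodule ℂ H) : B H :=
  haveI : CompleteSpace X.topologicalClosure := X.isClosed_topologicalClosure.completeSpace_coe
  X.topologicalClosure.starProjection

variable {X Y : Submodule ℂ H}

theorem isStarProjection_closureProj : IsStarProjection (closureProj X) :=
  haveI : CompleteSpace X.topologicalClosure := X.isClosed_topologicalClosure.completeSpace_coe
  isStarProjection_starProjection

theorem closureProj_mem (x : H) : closureProj X x ∈ X.topologicalClosure :=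
  haveI : CompleteSpace X.topologicalClosure := X.isClosed_topologicalClosure.completeSpace_coe
  Submodule.starProjection_apply_mem _ x

theorem closureProj_eq_self {x : H} (hx : x ∈ X) : closureProj X x = x :=
  haveI : CompleteSpace X.topologicalClosure := X.isClosed_topologicalClosure.completeSpace_coe
  Submodule.starProjection_eq_self_iff.2 (X.le_topologicalClosure hx)

/-- Operators which agree on a subspace agree after composing with its projection. -/
theorem mul_closureProj_congr {S T : B H} (h : ∀ x ∈ X, S x = T x) :
    S * closureProj X = T * closureProj X := by
  ext x
  have hcl : IsClosed {x | S x = T x} := isClosed_eq S.continuous T.continuous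
  exact closure_minimal (s := (X : Set H)) h hcl (closureProj_mem x)

theorem mul_closureProj_eq {S : B H} (h : ∀ x ∈ X, S x ∈ Y) (h' : ∀ y ∈ Y, star S y ∈ X) :
    S * closureProj X = closureProj Y * S := by
  have h1 : closureProj Y * S * closureProj X = S * closureProj X :=
    mul_closureProj_congr fun x hx => closureProj_eq_self (h x hx)
  have h2 : closureProj X * star S * closureProj Y = star S * closureProj Y :=
    mul_closureProj_congr fun x hx => closureProj_eq_self (h' x hx)
  have h3 := congrArg star h2
  simp only [star_mul, star_star, isStarProjection_closureProj.isSelfAdjoint.star_eq] at h3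
  rw [← h1, mul_assoc, h3]

/-- The range projection of an operator. -/
def rangeProj (A : B H) : B H := closureProj (LinearMap.range A.toLinearMap)

theorem isStarProjection_rangeProj (A : B H) : IsStarProjection (rangeProj A) :=
  isStarProjection_closureProj

theorem rangeProj_mul (A : B H) : rangeProj A * A = A := by
  ext x
  exact closureProj_eq_self ⟨x, rfl⟩

theorem mul_rangeProj {A : B H} (hA : IsSelfAdjoint A) : A * rangeProj A = A := by
  have := congrArg star (rangeProj_mul A)
  rwa [star_mul, hA.star_eq, (isStarProjection_rangeProj A).isSelfAdjoint.star_eq] at this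

theorem mul_rangeProj_congr {A S T : B H} (h : S * A = T * A) :
    S * rangeProj A = T * rangeProj A := by
  refine mul_closureProj_congr ?_
  rintro _ ⟨x, rfl⟩
  exact DFunLike.congr_fun h x

theorem rangeProj_intertwine {A C m : B H} (hA : IsSelfAdjoint A) (hC : IsSelfAdjoint C)
    (h : A * m = m * C) : rangeProj A * m = m * rangeProj C := by
  refine (mul_closureProj_eq ?_ ?_).symm
  · rintro _ ⟨x, rfl⟩
    exact ⟨m x, DFunLike.congr_fun h x⟩
  · have h' := congrArg star h
    rw [star_mul, star_mul, hA.star_eq, hC.star_eq] at h'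
    rintro _ ⟨x, rfl⟩
    exact ⟨star m x, (DFunLike.congr_fun h' x).symm⟩

/-- The function `x ↦ (x - l)⁺`. -/
def ramp (l x : ℝ) : ℝ := max (x - l) 0

@[fun_prop] theorem continuous_ramp (l : ℝ) : Continuous (ramp l) := by
  unfold ramp; fun_prop

/-- The spectral projection of `a` for the interval `(l, ∞)`. -/
def specProj (a : B H) (l : ℝ) : B H := rangeProj (cfc (ramp l) a)

theorem specProj_intertwine {a b m : B H} (ha : IsSelfAdjoint a) (hb : IsSelfAdjoint b)
    (h : a * m = m * b) (l : ℝ) : specProj a l * m = m * specProj b l :=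
  rangeProj_intertwine (cfc_predicate _ _) (cfc_predicate _ _)
    (cfc_intertwine ha hb h (continuous_ramp l))

theorem cfc_ramp_sub_le {a : B H} (ha : IsSelfAdjoint a) {l d : ℝ} (hd : 0 < d) :
    cfc (ramp l) a - cfc (ramp (l + d)) a ≤ d • specProj a l := by
  set P := specProj a l
  have hP : IsStarProjection P := isStarProjection_rangeProj _
  have hPs : star P = P := hP.isSelfAdjoint.star_eq
  have hPi : P * P = P := hP.isIdempotentElem
  set g : B H := cfc (fun x => ramp l x - ramp (l + d) x) a with hg
  have hgs : star g = g := (cfc_predicate (R := ℝ) _ a : IsSelfAdjoint g).star_eq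
  have e1 : cfc (ramp l) a - cfc (ramp (l + d)) a = g := by
    rw [hg, cfc_sub _ _ a]
  have hgP : g * P = g := by
    have : g = cfc (fun x => d / max (ramp l x) d) a * cfc (ramp l) a := by
      rw [← cfc_mul _ _ a ?_ ?_]
      · refine cfc_congr fun x _ => ?_
        simp only [ramp]
        rcases le_total (x - l) 0 with h1 | h1
        · rw [max_eq_right h1, max_eq_right (by linarith)]; simp
        rw [max_eq_left h1]
        rcases le_total (x - l) d with h2 | h2
        · rw [max_eq_right h2, max_eq_right (by linarith)]; field_simp; simp
        · have : x - l ≠ 0 := by linarith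
          rw [max_eq_left h2, max_eq_left (by linarith)]; field_simp; ring
      · refine Continuous.continuousOn (Continuous.div continuous_const (by fun_prop) fun x => ?_)
        exact (lt_of_lt_of_le hd (le_max_right _ _)).ne'
      · exact (continuous_ramp l).continuousOn
    have hr : cfc (ramp l) a * P = cfc (ramp l) a := mul_rangeProj (cfc_predicate _ _)
    rw [this, mul_assoc, hr]
  have hPg : P * g = g := by
    have := congrArg star hgP
    rwa [star_mul, hgs, hPs] at this
  have hle : g ≤ algebraMap ℝ (B H) d := by
    refine cfc_le_algebraMap _ _ _ fun x _ => ?_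
    simp only [ramp]
    rcases le_total (x - l) 0 with h1 | h1
    · rw [max_eq_right h1, max_eq_right (by linarith)]; linarith
    · rw [max_eq_left h1]
      linarith [le_max_left (x - (l + d)) 0]
  have h := star_left_conjugate_le_conjugate hle P
  rw [hPs, hPg, hgP, Algebra.algebraMap_eq_smul_one, mul_smul_comm, mul_one, smul_mul_assoc,
    hPi] at h
  rwa [e1]

theorem le_cfc_ramp_sub {a : B H} (ha : IsSelfAdjoint a) {l d : ℝ} (hd : 0 < d) :
    d • specProj a (l + d) ≤ cfc (ramp l) a - cfc (ramp (l + d)) a := by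
  set P := specProj a (l + d) with hPd
  have hP : IsStarProjection P := isStarProjection_rangeProj _
  have hPs : star P = P := hP.isSelfAdjoint.star_eq
  have hPi : P * P = P := hP.isIdempotentElem
  set g : B H := cfc (fun x => ramp l x - ramp (l + d) x) a with hg
  have hgs : star g = g := (cfc_predicate (R := ℝ) _ a : IsSelfAdjoint g).star_eq
  have e1 : cfc (ramp l) a - cfc (ramp (l + d)) a = g := by
    rw [hg, cfc_sub _ _ a]
  have hgP : g * P = d • P := by
    have : g * cfc (ramp (l + d)) a = (algebraMap ℝ (B H) d) * cfc (ramp (l + d)) a := by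
      rw [hg, ← cfc_mul _ _ a, ← cfc_const d a, ← cfc_mul _ _ a]
      refine cfc_congr fun x _ => ?_
      simp only [ramp]
      rcases le_total (x - (l + d)) 0 with h1 | h1
      · rw [max_eq_right h1]; simp
      · rw [max_eq_left h1, max_eq_left (by linarith)]; ring
    have h := mul_rangeProj_congr this
    rwa [Algebra.algebraMap_eq_smul_one, smul_mul_assoc, one_mul] at h
  have hPg : P * g = d • P := by
    have := congrArg star hgP
    rwa [star_mul, hgs, star_smul, hPs, star_trivial] at this
  have hnn : 0 ≤ g := by
    refine cfc_nonneg fun x _ => ?_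
    simp only [ramp]
    have : max (x - (l + d)) 0 ≤ max (x - l) 0 := max_le_max (by linarith) le_rfl
    linarith
  have h := star_left_conjugate_nonneg hnn (1 - P)
  have e2 : star (1 - P) * g * (1 - P) = g - d • P := by
    rw [star_sub, star_one, hPs, sub_mul, one_mul, hPg, mul_sub, mul_one, sub_mul, hgP,
      smul_mul_assoc, hPi]
    abel
  rw [e2] at h
  rw [e1]
  exact sub_nonneg.1 h

/-- Self-adjoint operators are approximated by sums of their spectral projections, with
coefficients depending only on a bound for the norm. -/
theorem norm_sub_spectral_sum_le {a : B H} (ha : IsSelfAdjoint a) {C d : ℝ} (hd : 0 < d) {n : ℕ}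
    (hC : ‖a‖ ≤ C) (hn : 2 * C ≤ n * d) :
    ‖a + C • (1 : B H) - d • ∑ k ∈ Finset.range n, specProj a (-C + d * (k + 1))‖ ≤ d := by
  rcases subsingleton_or_nontrivial H with hH | hH
  · rw [Subsingleton.elim (a + _ - _) (0 : B H), norm_zero]
    exact hd.le
  have htel : cfc (ramp (-C)) a - cfc (ramp (-C + d * n)) a
      = ∑ k ∈ Finset.range n, (cfc (ramp (-C + d * k)) a - cfc (ramp (-C + d * (k + 1))) a) := by
    have := Finset.sum_range_sub' (fun k : ℕ => cfc (ramp (-C + d * k)) a) n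
    push_cast at this
    rw [this]; simp
  have hsp : ∀ x ∈ spectrum ℝ a, |x| ≤ C := fun x hx =>
    (spectrum.norm_le_norm_of_mem hx).trans hC
  have h0 : cfc (ramp (-C)) a = a + C • (1 : B H) := by
    have : cfc (fun x : ℝ => x + C) a = a + C • (1 : B H) := by
      rw [cfc_add_const C (fun x => x) a, cfc_id' ℝ a, Algebra.algebraMap_eq_smul_one]
    rw [← this]
    refine cfc_congr fun x hx => ?_
    have := abs_le.1 (hsp x hx)
    simp only [ramp]
    rw [max_eq_left (by linarith)]; ring
  have hn0 : cfc (ramp (-C + d * n)) a = 0 := by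
    rw [← cfc_zero (R := ℝ) (a := a)]
    refine cfc_congr fun x hx => ?_
    have := abs_le.1 (hsp x hx)
    simp only [ramp]
    rw [max_eq_right (by linarith)]; rfl
  rw [h0, hn0, sub_zero] at htel
  have hlow : d • ∑ k ∈ Finset.range n, specProj a (-C + d * (k + 1)) ≤ a + C • (1 : B H) := by
    rw [htel, Finset.smul_sum]
    refine Finset.sum_le_sum fun k _ => ?_
    have := le_cfc_ramp_sub ha (l := -C + d * k) hd
    rwa [show -C + d * k + d = -C + d * (k + 1) by ring] at this
  have hupp : a + C • (1 : B H) ≤ d • ∑ k ∈ Finset.range n, specProj a (-C + d * k) := by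
    rw [htel, Finset.smul_sum]
    refine Finset.sum_le_sum fun k _ => ?_
    have := cfc_ramp_sub_le ha (l := -C + d * k) hd
    rwa [show -C + d * k + d = -C + d * (k + 1) by ring] at this
  rw [CStarAlgebra.norm_le_iff_le_algebraMap _ hd.le (sub_nonneg.2 hlow)]
  have htel' : (∑ k ∈ Finset.range n, specProj a (-C + d * k))
      - ∑ k ∈ Finset.range n, specProj a (-C + d * (k + 1))
      = specProj a (-C) - specProj a (-C + d * n) := by
    have := Finset.sum_range_sub' (fun k : ℕ => specProj a (-C + d * k)) n
    push_cast at this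
    rw [← Finset.sum_sub_distrib, this]; simp
  calc a + C • (1 : B H) - d • ∑ k ∈ Finset.range n, specProj a (-C + d * (k + 1))
      ≤ d • (∑ k ∈ Finset.range n, specProj a (-C + d * k))
        - d • ∑ k ∈ Finset.range n, specProj a (-C + d * (k + 1)) := sub_le_sub_right hupp _
    _ = d • (specProj a (-C) - specProj a (-C + d * n)) := by rw [← smul_sub, htel']
    _ ≤ d • (1 : B H) := by
        refine smul_le_smul_of_nonneg_left ?_ hd.le
        exact (sub_le_self _ (isStarProjection_rangeProj _).nonneg).trans
          (isStarProjection_rangeProj _).le_one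
    _ = _ := (Algebra.algebraMap_eq_smul_one d).symm

/-- An operator which intertwines the spectral projections of two self-adjoint operators
intertwines the operators. -/
theorem intertwine_of_specProj {a b T : B H} (ha : IsSelfAdjoint a) (hb : IsSelfAdjoint b)
    (h : ∀ l, specProj a l * T = T * specProj b l) : a * T = T * b := by
  set C := max ‖a‖ ‖b‖ with hC
  have hC0 : 0 ≤ C := (norm_nonneg a).trans (le_max_left _ _)
  have key : ∀ d > 0, ‖a * T - T * b‖ ≤ d * (2 * ‖T‖) := by
    intro d hd
    obtain ⟨n, hn⟩ := exists_nat_ge (2 * C / d)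
    rw [div_le_iff₀ hd] at hn
    set Sa := d • ∑ k ∈ Finset.range n, specProj a (-C + d * (k + 1))
    set Sb := d • ∑ k ∈ Finset.range n, specProj b (-C + d * (k + 1))
    have h1 : ‖a + C • (1 : B H) - Sa‖ ≤ d := norm_sub_spectral_sum_le ha hd (le_max_left _ _) hn
    have h2 : ‖b + C • (1 : B H) - Sb‖ ≤ d := norm_sub_spectral_sum_le hb hd (le_max_right _ _) hn
    have h3 : Sa * T = T * Sb := by
      simp only [Sa, Sb, smul_mul_assoc, mul_smul_comm, Finset.sum_mul, Finset.mul_sum, h]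
    have e : a * T - T * b = (a + C • (1 : B H) - Sa) * T - T * (b + C • (1 : B H) - Sb) := by
      simp only [sub_mul, mul_sub, add_mul, mul_add, h3, smul_mul_assoc, mul_smul_comm, one_mul,
        mul_one]
      abel
    rw [e]
    calc _ ≤ ‖a + C • (1 : B H) - Sa‖ * ‖T‖ + ‖T‖ * ‖b + C • (1 : B H) - Sb‖ :=
          (norm_sub_le _ _).trans (add_le_add (norm_mul_le _ _) (norm_mul_le _ _))
      _ ≤ d * ‖T‖ + ‖T‖ * d := by gcongr
      _ = _ := by ring
  have : ‖a * T - T * b‖ ≤ 0 := by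
    have ht : Tendsto (fun d : ℝ => d * (2 * ‖T‖)) (𝓝[>] 0) (𝓝 0) := by
      have : Tendsto (fun d : ℝ => d * (2 * ‖T‖)) (𝓝 0) (𝓝 (0 * (2 * ‖T‖))) :=
        (continuous_id.mul continuous_const).tendsto 0
      rw [zero_mul] at this
      exact this.mono_left nhdsWithin_le_nhds
    exact ge_of_tendsto ht (eventually_nhdsWithin_of_forall fun d hd => key d hd)
  exact sub_eq_zero.1 (norm_le_zero_iff.1 this)

end RangeProj

section Slice

variable {A C G : Type*} [NormedAddCommGroup A] [InnerProductSpace ℂ A] [CompleteSpace A]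
  [NormedAddCommGroup C] [InnerProductSpace ℂ C]
  [NormedAddCommGroup G] [InnerProductSpace ℂ G] [CompleteSpace G]
  {t : A →ₗ[ℂ] C →ₗ[ℂ] G} {τ : B A →ₗ[ℂ] B C →ₗ[ℂ] B G}

/-- The `(c, c')` matrix entry of an operator on `A ⊗ C`, an operator on `A`. -/
def IsElemTensor.slice (ht : IsElemTensor t) (c c' : C) : B G →ₗ[ℂ] B A :=
  sandwich (ht.ins c).adjoint (ht.ins c')

theorem IsElemTensor.inner_slice (ht : IsElemTensor t) (c c' : C) (S : B G) (a a' : A) :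
    ⟪a', ht.slice c c' S a⟫_ℂ = ⟪t a' c, S (t a c')⟫_ℂ := by
  simp [slice, ContinuousLinearMap.adjoint_inner_right]

theorem IsElemTensor.ext_slice (ht : IsElemTensor t) {S T : B G}
    (h : ∀ c c', ht.slice c c' S = ht.slice c c' T) : S = T :=
  ht.ext_inner fun a c a' c' => by rw [← ht.inner_slice, ← ht.inner_slice, h]

theorem IsElemTensor.star_slice (ht : IsElemTensor t) (c c' : C) (S : B G) :
    star (ht.slice c c' S) = ht.slice c' c (star S) := by
  refine ContinuousLinearMap.ext fun a => ext_inner_left ℂ fun a' => ?_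
  rw [ht.inner_slice, ContinuousLinearMap.star_eq_adjoint, ContinuousLinearMap.star_eq_adjoint,
    ContinuousLinearMap.adjoint_inner_right, ContinuousLinearMap.adjoint_inner_right,
    ← inner_conj_symm, ht.inner_slice, inner_conj_symm]

theorem IsElemTensor.slice_tensor (ht : IsElemTensor t) (hτ : IsOpTensor t τ) (c c' : C) (a : B A)
    (u : B C) : ht.slice c c' (τ a u) = ⟪c, u c'⟫_ℂ • a := by
  refine ContinuousLinearMap.ext fun x => ext_inner_left ℂ fun x' => ?_
  rw [ht.inner_slice, hτ, ht.1, smul_apply, inner_smul_right, mul_comm]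

variable [CompleteSpace C]

theorem IsElemTensor.slice_amp_mul (ht : IsElemTensor t) (hτ : IsOpTensor t τ) (c c' : C) (a : B A)
    (S : B G) : ht.slice c c' (hτ.amp ht a * S) = a * ht.slice c c' S := by
  ext x
  exact DFunLike.congr_fun (ht.adjoint_ins_comp hτ a c) (S (t x c'))

theorem IsElemTensor.slice_mul_amp (ht : IsElemTensor t) (hτ : IsOpTensor t τ) (c c' : C) (a : B A)
    (S : B G) : ht.slice c c' (S * hτ.amp ht a) = ht.slice c c' S * a := by
  ext x
  simp [slice]

end Slice

section Reflexive

variable {H : Type*} [NormedAddCommGroup H] [InnerProductSpace ℂ H] [CompleteSpace H]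
  {D : StarSubalgebra ℂ (B H)} {M : Submodule ℂ (B H)}

/-- The pairs `(p, q)` of projections in `D` such that `q m = m p` for all `m ∈ M`. -/
def pairs (D : StarSubalgebra ℂ (B H)) (M : Submodule ℂ (B H)) : Set (B H × B H) :=
  {s | (IsStarProjection s.1 ∧ s.1 ∈ D) ∧ (IsStarProjection s.2 ∧ s.2 ∈ D) ∧
    ∀ m ∈ M, s.2 * m = m * s.1}

theorem specProj_mem (hD : IsMasa D) {a : B H} (ha : IsSelfAdjoint a) (haD : a ∈ D) (l : ℝ) :
    specProj a l ∈ D :=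
  hD.2 _ fun d hd => specProj_intertwine ha ha (hD.1 a haD d hd) l

theorem intertwine_of_pairs (hD : IsMasa D) {T : B H} (hT : ∀ s ∈ pairs D M, s.2 * T = T * s.1)
    {a b : B H} (ha : a ∈ D) (hb : b ∈ D) (h : ∀ m ∈ M, a * m = m * b)
    (h' : ∀ m ∈ M, star a * m = m * star b) : a * T = T * b := by
  have key : ∀ a ∈ D, ∀ b ∈ D, IsSelfAdjoint a → IsSelfAdjoint b → (∀ m ∈ M, a * m = m * b) →
      a * T = T * b := fun a haD b hbD ha hb h =>
    intertwine_of_specProj ha hb fun l => hT (specProj b l, specProj a l)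
      ⟨⟨isStarProjection_rangeProj _, specProj_mem hD hb hbD l⟩,
        ⟨isStarProjection_rangeProj _, specProj_mem hD ha haD l⟩,
        fun m hm => specProj_intertwine ha hb (h m hm) l⟩
  have h1 := key (a + star a) (add_mem ha (star_mem ha)) (b + star b) (add_mem hb (star_mem hb))
    (IsSelfAdjoint.add_star_self a) (IsSelfAdjoint.add_star_self b)
    fun m hm => by rw [add_mul, mul_add, h m hm, h' m hm]
  have sa : ∀ a : B H, IsSelfAdjoint (Complex.I • (a - star a)) := fun a => by
    rw [IsSelfAdjoint, star_smul, star_sub, star_star, Complex.star_def, Complex.conj_I, neg_smul,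
      ← smul_neg, neg_sub]
  have h2 := key (Complex.I • (a - star a)) (D.smul_mem (sub_mem ha (star_mem ha)) _)
    (Complex.I • (b - star b)) (D.smul_mem (sub_mem hb (star_mem hb)) _) (sa a) (sa b)
    fun m hm => by rw [smul_mul_assoc, mul_smul_comm, sub_mul, mul_sub, h m hm, h' m hm]
  rw [smul_mul_assoc, mul_smul_comm, (smul_right_injective _ Complex.I_ne_zero).eq_iff] at h2
  rw [add_mul, mul_add] at h1
  rw [sub_mul, mul_sub] at h2
  have h3 : (2 : ℂ) • (a * T) = (2 : ℂ) • (T * b) := by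
    rw [two_smul, two_smul]
    calc _ = (a * T + star a * T) + (a * T - star a * T) := by abel
      _ = _ := by rw [h1, h2]; abel
  exact smul_right_injective _ two_ne_zero h3

theorem amp_intertwine_of_pairs {C G : Type*} [NormedAddCommGroup C] [InnerProductSpace ℂ C]
    [CompleteSpace C] [NormedAddCommGroup G] [InnerProductSpace ℂ G] [CompleteSpace G]
    {t : H →ₗ[ℂ] C →ₗ[ℂ] G} {τ : B H →ₗ[ℂ] B C →ₗ[ℂ] B G} (ht : IsElemTensor t)
    (hτ : IsOpTensor t τ) (hD : IsMasa D) {T : B H} (hT : ∀ s ∈ pairs D M, s.2 * T = T * s.1)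
    {P Q : B G} (hP : star P = P) (hQ : star Q = Q)
    (hPD : ∀ d ∈ D, P * hτ.amp ht d = hτ.amp ht d * P)
    (hQD : ∀ d ∈ D, Q * hτ.amp ht d = hτ.amp ht d * Q)
    (h : ∀ m ∈ M, Q * hτ.amp ht m = hτ.amp ht m * P) :
    Q * hτ.amp ht T = hτ.amp ht T * P := by
  have hmem : ∀ R : B G, (∀ d ∈ D, R * hτ.amp ht d = hτ.amp ht d * R) → ∀ c c',
      ht.slice c c' R ∈ D := fun R hR c c' => hD.2 _ fun d hd => by
    rw [← ht.slice_mul_amp hτ, ← ht.slice_amp_mul hτ, hR d hd]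
  have hint : ∀ c c', ∀ m ∈ M, ht.slice c c' Q * m = m * ht.slice c c' P := fun c c' m hm => by
    rw [← ht.slice_mul_amp hτ, ← ht.slice_amp_mul hτ, h m hm]
  refine ht.ext_slice fun c c' => ?_
  rw [ht.slice_mul_amp hτ, ht.slice_amp_mul hτ]
  refine intertwine_of_pairs hD hT (hmem Q hQD c c') (hmem P hPD c c') (hint c c') ?_
  rw [ht.star_slice, ht.star_slice, hP, hQ]
  exact hint c' c

/-- A weak* closed ternary masa-bimodule consists of all operators intertwining the pairs of
projections intertwined by its elements. -/
theorem mem_of_pairs (hD : IsMasa D) (hbim : IsBimodule D M) (hter : IsTernary M)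
    (hcl : wsc M = M) {T : B H} (hT : ∀ s ∈ pairs D M, s.2 * T = T * s.1) : T ∈ M := by
  rw [← hcl]
  rintro ω ⟨x, y, hx, hy, hω⟩ hker
  have ht := isElemTensor_stdTensor (K := H)
  obtain ⟨τ, hτ⟩ := ht.exists_opTensor
  have hlp : ∀ z : ℕ → H, Summable (fun n => ‖z n‖ ^ 2) →
      ∃ zh, ∀ n, (ht.ins (stdBasis n)).adjoint zh = z n := fun z hz =>
    ⟨(ht.decomp stdBasis).symm ⟨z, memℓp_gen (by simpa using hz)⟩, fun n => by
      rw [← ht.decomp_apply, LinearIsometryEquiv.apply_symm_apply]⟩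
  obtain ⟨xh, hxh⟩ := hlp x hx
  obtain ⟨yh, hyh⟩ := hlp y hy
  set ρ := hτ.amp ht
  have hωρ : ∀ S, ω S = ⟪yh, ρ S xh⟫_ℂ := fun S => by
    rw [hω, ← (ht.hasSum_inner stdBasis (ρ S xh) yh).tsum_eq]
    refine tsum_congr fun n => ?_
    have := DFunLike.congr_fun (ht.adjoint_ins_comp hτ S (stdBasis n)) xh
    rw [hyh, show (ht.ins (stdBasis n)).adjoint (ρ S xh) = S (x n) by
      rw [← hxh]; exact this]
  let N : Submodule ℂ (B H) :=
    { carrier := {b | ∀ m ∈ M, m * b ∈ M ∧ m * star b ∈ M}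
      add_mem' := fun ha hb m hm => by
        rw [mul_add, star_add, mul_add]
        exact ⟨add_mem (ha m hm).1 (hb m hm).1, add_mem (ha m hm).2 (hb m hm).2⟩
      zero_mem' := fun m _ => by simp
      smul_mem' := fun c b hb m hm => by
        rw [mul_smul_comm, star_smul, mul_smul_comm]
        exact ⟨M.smul_mem _ (hb m hm).1, M.smul_mem _ (hb m hm).2⟩ }
  have hN1 : (1 : B H) ∈ N := fun m hm => by simpa using hm
  have hND : ∀ d ∈ D, ∀ b ∈ N, d * b ∈ N := fun d hd b hb m hm => by
    have h1 : ∀ d ∈ D, ∀ m ∈ M, m * d ∈ M := fun d hd m hm => by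
      simpa using hbim 1 (one_mem _) d hd m hm
    refine ⟨?_, ?_⟩
    · rw [← mul_assoc]; exact (hb _ (h1 d hd m hm)).1
    · rw [star_mul, ← mul_assoc]; exact h1 _ (star_mem hd) _ (hb m hm).2
  have hDM : ∀ d ∈ D, ∀ m ∈ M, d * m ∈ M := fun d hd m hm => by
    simpa using hbim d hd 1 (one_mem _) m hm
  let ev : B H →ₗ[ℂ] lp (fun _ : ℕ => H) 2 :=
    { toFun := fun b => ρ b xh
      map_add' := by simp
      map_smul' := by simp }
  have hint : ∀ m ∈ M, ρ m * closureProj (N.map ev) = closureProj (M.map ev) * ρ m := by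
    intro m hm
    refine mul_closureProj_eq ?_ ?_
    · rintro _ ⟨b, hb, rfl⟩
      exact ⟨m * b, (hb m hm).1, by simp [ev]⟩
    · rintro _ ⟨m', hm', rfl⟩
      refine ⟨star m * m', fun m₁ hm₁ => ⟨?_, ?_⟩, by simp [ev, ← map_star]⟩
      · rw [← mul_assoc]; exact hter _ hm₁ _ hm _ hm'
      · rw [star_mul, star_star, ← mul_assoc]; exact hter _ hm₁ _ hm' _ hm
  have hcomm : ∀ Y : Submodule ℂ (B H), (∀ d ∈ D, ∀ b ∈ Y, d * b ∈ Y) → ∀ d ∈ D,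
      closureProj (Y.map ev) * ρ d = ρ d * closureProj (Y.map ev) := by
    intro Y hY d hd
    symm
    refine mul_closureProj_eq ?_ ?_
    · rintro _ ⟨b, hb, rfl⟩
      exact ⟨d * b, hY d hd b hb, by simp [ev]⟩
    · rintro _ ⟨b, hb, rfl⟩
      exact ⟨star d * b, hY _ (star_mem hd) b hb, by simp [ev, ← map_star]⟩
  have hTT := amp_intertwine_of_pairs ht hτ hD hT
    isStarProjection_closureProj.isSelfAdjoint.star_eq
    isStarProjection_closureProj.isSelfAdjoint.star_eq (hcomm N hND) (hcomm M hDM)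
    fun m hm => (hint m hm).symm
  have hx0 : closureProj (N.map ev) xh = xh := closureProj_eq_self ⟨1, hN1, by simp [ev]⟩
  have h1 : ρ T xh = closureProj (M.map ev) (ρ T xh) := by
    have := DFunLike.congr_fun hTT xh
    simp only [mul_apply_eq_comp] at this
    rw [hx0] at this
    exact this.symm
  have hcl' : IsClosed {z | ⟪yh, z⟫_ℂ = 0} :=
    isClosed_eq (by fun_prop) continuous_const
  have h2 := closure_minimal (s := ((M.map ev : Submodule ℂ _) : Set _)) ?_ hcl'
    (closureProj_mem (X := M.map ev) (ρ T xh))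
  · rw [hωρ, h1]; exact h2
  · rintro _ ⟨m, hm, rfl⟩
    exact (hωρ m).symm.trans (hker m hm)

end Reflexive

section Part

variable {H : Type*} [NormedAddCommGroup H] [InnerProductSpace ℂ H] [CompleteSpace H]

/-- A finite partition of the identity into pairs of projections intertwined by `M`. -/
structure Part (D : StarSubalgebra ℂ (B H)) (M : Submodule ℂ (B H)) where
  /-- The index set. -/
  ι : Type
  fintype : Fintype ι
  /-- The right projections. -/
  p : ι → B H
  /-- The left projections. -/
  q : ι → B H
  mem : ∀ k, (p k, q k) ∈ pairs D M
  sum_p : ∑ k, p k = 1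
  sum_q : ∑ k, q k = 1
  p_mul : ∀ k l, k ≠ l → p k * p l = 0
  q_mul : ∀ k l, k ≠ l → q k * q l = 0

attribute [instance] Part.fintype

variable {D : StarSubalgebra ℂ (B H)} {M : Submodule ℂ (B H)}

/-- Every member of the partition is either below or orthogonal to the pair `s`. -/
def Part.Compat (𝒬 : Part D M) (s : B H × B H) : Prop :=
  ∀ k, (s.1 * 𝒬.p k = 𝒬.p k ∧ s.2 * 𝒬.q k = 𝒬.q k) ∨ (s.1 * 𝒬.p k = 0 ∧ s.2 * 𝒬.q k = 0)

theorem pairs_mul (hD : IsMasa D) {s s' : B H × B H} (h : s ∈ pairs D M) (h' : s' ∈ pairs D M) :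
    (s.1 * s'.1, s.2 * s'.2) ∈ pairs D M :=
  ⟨⟨h.1.1.mul h'.1.1 (hD.1 _ h.1.2 _ h'.1.2), mul_mem h.1.2 h'.1.2⟩,
    ⟨h.2.1.1.mul h'.2.1.1 (hD.1 _ h.2.1.2 _ h'.2.1.2), mul_mem h.2.1.2 h'.2.1.2⟩,
    fun m hm => by
      dsimp only
      rw [hD.1 _ h.2.1.2 _ h'.2.1.2, mul_assoc, h.2.2 m hm, ← mul_assoc, h'.2.2 m hm, mul_assoc,
        hD.1 _ h.1.2 _ h'.1.2]⟩

theorem pairs_compl {s : B H × B H} (h : s ∈ pairs D M) : (1 - s.1, 1 - s.2) ∈ pairs D M :=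
  ⟨⟨h.1.1.one_sub, sub_mem (one_mem _) h.1.2⟩,
    ⟨h.2.1.1.one_sub, sub_mem (one_mem _) h.2.1.2⟩,
    fun m hm => by simp [sub_mul, mul_sub, h.2.2 m hm]⟩

theorem pairs_one : ((1 : B H), (1 : B H)) ∈ pairs D M :=
  ⟨⟨.one _, one_mem _⟩, ⟨.one _, one_mem _⟩, fun m _ => by simp⟩

/-- The refinement of a partition by a pair of projections. -/
def Part.refine (hD : IsMasa D) (𝒬 : Part D M) {s : B H × B H} (hs : s ∈ pairs D M) :
    Part D M where
  ι := 𝒬.ι × Bool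
  fintype := inferInstance
  p k := (if k.2 then s.1 else 1 - s.1) * 𝒬.p k.1
  q k := (if k.2 then s.2 else 1 - s.2) * 𝒬.q k.1
  mem k := by
    rcases k with ⟨k, _ | _⟩
    · exact pairs_mul hD (pairs_compl hs) (𝒬.mem k)
    · exact pairs_mul hD hs (𝒬.mem k)
  sum_p := by
    rw [Fintype.sum_prod_type]
    refine Eq.trans (Finset.sum_congr rfl fun k _ => ?_) 𝒬.sum_p
    simp [sub_mul]
  sum_q := by
    rw [Fintype.sum_prod_type]
    refine Eq.trans (Finset.sum_congr rfl fun k _ => ?_) 𝒬.sum_q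
    simp [sub_mul]
  p_mul := by
    have hi := hs.1.1.isIdempotentElem.eq
    rintro ⟨k, b⟩ ⟨l, b'⟩ h
    have hc : ∀ a ∈ D, a * 𝒬.p k = 𝒬.p k * a := fun a ha => hD.1 _ ha _ (𝒬.mem k).1.2
    have hmem : ∀ b : Bool, (if b then s.1 else 1 - s.1) ∈ D := fun b => by
      cases b
      exacts [sub_mem (one_mem _) hs.1.2, hs.1.2]
    by_cases hkl : k = l
    · subst hkl
      have hb : b ≠ b' := fun e => h (by rw [e])
      have : (if b then s.1 else 1 - s.1) * (if b' then s.1 else 1 - s.1) = 0 := by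
        cases b <;> cases b' <;> simp_all [sub_mul, mul_sub]
      rw [hc _ (hmem b), mul_assoc, ← mul_assoc _ _ (𝒬.p k), this, zero_mul, mul_zero]
    · rw [mul_assoc, ← mul_assoc (𝒬.p k), ← hc _ (hmem b'), mul_assoc _ (𝒬.p k),
        𝒬.p_mul k l hkl, mul_zero, mul_zero]
  q_mul := by
    have hi := hs.2.1.1.isIdempotentElem.eq
    rintro ⟨k, b⟩ ⟨l, b'⟩ h
    have hc : ∀ a ∈ D, a * 𝒬.q k = 𝒬.q k * a := fun a ha => hD.1 _ ha _ (𝒬.mem k).2.1.2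
    have hmem : ∀ b : Bool, (if b then s.2 else 1 - s.2) ∈ D := fun b => by
      cases b
      exacts [sub_mem (one_mem _) hs.2.1.2, hs.2.1.2]
    by_cases hkl : k = l
    · subst hkl
      have hb : b ≠ b' := fun e => h (by rw [e])
      have : (if b then s.2 else 1 - s.2) * (if b' then s.2 else 1 - s.2) = 0 := by
        cases b <;> cases b' <;> simp_all [sub_mul, mul_sub]
      rw [hc _ (hmem b), mul_assoc, ← mul_assoc _ _ (𝒬.q k), this, zero_mul, mul_zero]
    · rw [mul_assoc, ← mul_assoc (𝒬.q k), ← hc _ (hmem b'), mul_assoc _ (𝒬.q k),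
        𝒬.q_mul k l hkl, mul_zero, mul_zero]

theorem exists_part (hD : IsMasa D) (F : Finset (pairs D M)) :
    ∃ 𝒬 : Part D M, ∀ s ∈ F, 𝒬.Compat s := by
  classical
  induction F using Finset.induction_on with
  | empty =>
    exact ⟨⟨Unit, inferInstance, fun _ => 1, fun _ => 1, fun _ => pairs_one, by simp, by simp,
      by simp, by simp⟩, by simp⟩
  | insert s F _ ih =>
    obtain ⟨𝒬, h⟩ := ih
    refine ⟨𝒬.refine hD s.2, fun r hr k => ?_⟩
    rcases Finset.mem_insert.1 hr with rfl | hr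
    · have h1 := r.2.1.1.isIdempotentElem.eq
      have h2 := r.2.2.1.1.isIdempotentElem.eq
      rcases k with ⟨k, _ | _⟩
      · right
        simp [Part.refine, ← mul_assoc, mul_sub, h1, h2]
      · left
        simp [Part.refine, ← mul_assoc, h1, h2]
    · have hc : ∀ b : Bool, (r.1.1 * (if b then s.1.1 else 1 - s.1.1)
          = (if b then s.1.1 else 1 - s.1.1) * r.1.1) ∧ (r.1.2 * (if b then s.1.2 else 1 - s.1.2)
          = (if b then s.1.2 else 1 - s.1.2) * r.1.2) := fun b => by
        have h1 := hD.1 _ r.2.1.2 _ s.2.1.2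
        have h2 := hD.1 _ r.2.2.1.2 _ s.2.2.1.2
        cases b <;> simp [mul_sub, sub_mul, h1, h2]
      have e1 : r.1.1 * (𝒬.refine hD s.2).p k
          = (if k.2 then s.1.1 else 1 - s.1.1) * (r.1.1 * 𝒬.p k.1) := by
        rw [← mul_assoc, ← (hc k.2).1, mul_assoc]; rfl
      have e2 : r.1.2 * (𝒬.refine hD s.2).q k
          = (if k.2 then s.1.2 else 1 - s.1.2) * (r.1.2 * 𝒬.q k.1) := by
        rw [← mul_assoc, ← (hc k.2).2, mul_assoc]; rfl
      rw [e1, e2]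
      rcases h r hr k.1 with ⟨h1, h2⟩ | ⟨h1, h2⟩
      · left; rw [h1, h2]; exact ⟨rfl, rfl⟩
      · right; rw [h1, h2]; exact ⟨mul_zero _, mul_zero _⟩

/-- A partition compatible with finitely many prescribed pairs. -/
def part (hD : IsMasa D) (F : Finset (pairs D M)) : Part D M := (exists_part hD F).choose

theorem part_compat (hD : IsMasa D) {F : Finset (pairs D M)} {s : pairs D M} (hs : s ∈ F) :
    (part hD F).Compat s := (exists_part hD F).choose_spec s hs

variable (D M) in
/-- An ultrafilter of finite sets of pairs, finer than the order filter. -/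
def partFilter : Ultrafilter (Finset (pairs D M)) := Ultrafilter.of atTop

theorem eventually_partFilter (s : pairs D M) :
    ∀ᶠ F in (partFilter D M : Filter (Finset (pairs D M))), s ∈ F := by
  refine Ultrafilter.of_le atTop ?_
  filter_upwards [eventually_ge_atTop {s}] with F hF using hF (Finset.mem_singleton_self s)

theorem card_separating {ι : Type*} [Fintype ι] [DecidableEq ι] {k l : ι} (h : k ≠ l) :
    (Finset.univ.filter fun S : Finset ι => k ∈ S ∧ l ∉ S).card * 4 = 2 ^ Fintype.card ι := by
  have e : (Finset.univ.filter fun S : Finset ι => k ∈ S ∧ l ∉ S)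
      = Finset.Icc {k} (Finset.univ.erase l) := by
    ext S
    simp [Finset.subset_erase]
  have hc : ({k, l} : Finset ι).card ≤ Fintype.card ι := Finset.card_le_univ _
  rw [Finset.card_pair h] at hc
  rw [e, Finset.card_Icc_finset (by simpa using h), Finset.card_erase_of_mem (Finset.mem_univ _),
    Finset.card_singleton, Finset.card_univ]
  obtain ⟨n, hn⟩ := Nat.exists_eq_add_of_le hc
  rw [hn, show 2 + n - 1 - 1 = n by omega, pow_add]
  ring

variable {G : Type*} [NormedAddCommGroup G] [InnerProductSpace ℂ G] [CompleteSpace G]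
  (π : B H →⋆ₐ[ℂ] B G)

/-- The block diagonal part of an operator with respect to a partition. -/
def Part.pinch (𝒬 : Part D M) : B G →ₗ[ℂ] B G :=
  ∑ k, sandwich (π (𝒬.q k)) (π (𝒬.p k))

theorem Part.pinch_apply (𝒬 : Part D M) (T : B G) :
    𝒬.pinch π T = ∑ k, π (𝒬.q k) * T * π (𝒬.p k) := by
  simp only [Part.pinch, LinearMap.sum_apply]
  rfl

theorem isStarProjection_sum {ι : Type*} {p : ι → B H} (hp : ∀ k, IsStarProjection (p k))
    (h : ∀ k l, k ≠ l → p k * p l = 0) (S : Finset ι) : IsStarProjection (∑ k ∈ S, p k) := by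
  classical
  refine ⟨?_, ?_⟩
  · rw [IsIdempotentElem, Finset.sum_mul_sum]
    refine Finset.sum_congr rfl fun k hk => ?_
    rw [Finset.sum_eq_single_of_mem k hk fun l _ hl => h k l hl.symm]
    exact (hp k).isIdempotentElem
  · rw [IsSelfAdjoint, star_sum]
    exact Finset.sum_congr rfl fun k _ => (hp k).isSelfAdjoint

theorem sum_mul_sum_compl {R ι : Type*} [NonUnitalNonAssocSemiring R] [Fintype ι] [DecidableEq ι]
    {p : ι → R}
    (h : ∀ k l, k ≠ l → p k * p l = 0) (S : Finset ι) :
    (∑ k ∈ S, p k) * ∑ l ∈ Sᶜ, p l = 0 := by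
  rw [Finset.sum_mul_sum]
  refine Finset.sum_eq_zero fun k hk => Finset.sum_eq_zero fun l hl => h k l ?_
  rintro rfl
  exact Finset.mem_compl.1 hl hk

open Classical in
/-- The off-diagonal part is an average of corners. -/
theorem Part.sub_pinch (𝒬 : Part D M) (T : B G) :
    (2 ^ Fintype.card 𝒬.ι : ℂ) • (T - 𝒬.pinch π T) = (4 : ℂ) • ∑ S : Finset 𝒬.ι,
      π (∑ k ∈ S, 𝒬.q k) * T * π (∑ l ∈ Sᶜ, 𝒬.p l) := by
  have hT : T = ∑ k, ∑ l, π (𝒬.q k) * T * π (𝒬.p l) := by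
    simp only [← Finset.mul_sum, ← Finset.sum_mul, ← map_sum, 𝒬.sum_p, 𝒬.sum_q, map_one, one_mul,
      mul_one]
  have h1 : T - 𝒬.pinch π T
      = ∑ k, ∑ l, if k = l then 0 else π (𝒬.q k) * T * π (𝒬.p l) := by
    rw [𝒬.pinch_apply]
    conv_lhs => enter [1]; rw [hT]
    rw [← Finset.sum_sub_distrib]
    refine Finset.sum_congr rfl fun k _ => ?_
    rw [sub_eq_iff_eq_add, ← Finset.sum_erase_add _ _ (Finset.mem_univ k),
      ← Finset.sum_erase_add _ _ (Finset.mem_univ k), if_pos rfl, add_zero]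
    congr 1
    refine Finset.sum_congr rfl fun l hl => ?_
    rw [if_neg (Finset.ne_of_mem_erase hl).symm]
  have h2 : ∑ S : Finset 𝒬.ι, π (∑ k ∈ S, 𝒬.q k) * T * π (∑ l ∈ Sᶜ, 𝒬.p l)
      = ∑ k, ∑ l, ((Finset.univ.filter fun S : Finset 𝒬.ι => k ∈ S ∧ l ∉ S).card : ℂ) •
        (π (𝒬.q k) * T * π (𝒬.p l)) := by
    have : ∀ S : Finset 𝒬.ι, π (∑ k ∈ S, 𝒬.q k) * T * π (∑ l ∈ Sᶜ, 𝒬.p l)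
        = ∑ k, ∑ l, if k ∈ S ∧ l ∉ S then π (𝒬.q k) * T * π (𝒬.p l) else 0 := by
      intro S
      simp only [map_sum, Finset.sum_mul, Finset.mul_sum, ite_and, ← Finset.mem_compl]
      rw [Finset.sum_comm]
      simp only [Finset.sum_ite_irrel, Finset.sum_const_zero, Finset.sum_ite_mem, Finset.univ_inter]
    simp only [this]
    rw [Finset.sum_comm]
    refine Finset.sum_congr rfl fun k _ => ?_
    rw [Finset.sum_comm]
    refine Finset.sum_congr rfl fun l _ => ?_
    rw [← Finset.sum_filter, Finset.sum_const, Nat.cast_smul_eq_nsmul]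
  rw [h1, h2, Finset.smul_sum, Finset.smul_sum]
  refine Finset.sum_congr rfl fun k _ => ?_
  rw [Finset.smul_sum, Finset.smul_sum]
  refine Finset.sum_congr rfl fun l _ => ?_
  split_ifs with h
  · subst h; simp
  · rw [smul_smul]
    congr 1
    have := card_separating h
    rw [mul_comm] at this
    exact_mod_cast this.symm

theorem Part.norm_sub_pinch_le (𝒬 : Part D M) {X : Type*} [NormedAddCommGroup X] [NormedSpace ℂ X]
    (f : B G →ₗ[ℂ] X) (T : B G) {c : ℝ}
    (h : ∀ a ∈ D, ∀ b ∈ D, ‖a‖ ≤ 1 → ‖b‖ ≤ 1 → (∀ m ∈ M, a * m * b = 0) →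
      ‖f (π a * T * π b)‖ ≤ c) : ‖f (T - 𝒬.pinch π T)‖ ≤ 4 * c := by
  classical
  have h1 := congrArg (fun R => ‖f R‖) (𝒬.sub_pinch π T)
  simp only [map_smul, norm_smul, norm_pow, Complex.norm_ofNat, map_sum f] at h1
  have h2 : ‖∑ S : Finset 𝒬.ι, f (π (∑ k ∈ S, 𝒬.q k) * T * π (∑ l ∈ Sᶜ, 𝒬.p l))‖
      ≤ 2 ^ Fintype.card 𝒬.ι * c := by
    refine (norm_sum_le_of_le _ fun S _ => h _ (sum_mem fun k _ => (𝒬.mem k).2.1.2) _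
      (sum_mem fun k _ => (𝒬.mem k).1.2)
      (isStarProjection_sum (fun k => (𝒬.mem k).2.1.1) 𝒬.q_mul S).norm_le
      (isStarProjection_sum (fun k => (𝒬.mem k).1.1) 𝒬.p_mul _).norm_le fun m hm => ?_).trans ?_
    · have : (∑ k ∈ S, 𝒬.q k) * m = m * ∑ k ∈ S, 𝒬.p k := by
        rw [Finset.sum_mul, Finset.mul_sum]
        exact Finset.sum_congr rfl fun k _ => (𝒬.mem k).2.2 m hm
      rw [this, mul_assoc, sum_mul_sum_compl 𝒬.p_mul, mul_zero]
    · simp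
  have h3 : (0 : ℝ) < 2 ^ Fintype.card 𝒬.ι := by positivity
  refine le_of_mul_le_mul_left (a := (2 : ℝ) ^ Fintype.card 𝒬.ι) ?_ h3
  rw [h1]
  linarith

theorem norm_amp_le (a : B H) : ‖π a‖ ≤ ‖a‖ := NonUnitalStarAlgHom.norm_apply_le π a

theorem norm_conj_le {a b : B H} (ha : ‖a‖ ≤ 1) (hb : ‖b‖ ≤ 1) (T : B G) :
    ‖π a * T * π b‖ ≤ ‖T‖ := by
  calc ‖π a * T * π b‖ ≤ ‖π a‖ * ‖T‖ * ‖π b‖ :=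
        (norm_mul_le _ _).trans (mul_le_mul_of_nonneg_right (norm_mul_le _ _) (norm_nonneg _))
    _ ≤ 1 * ‖T‖ * 1 := by
        gcongr
        · exact (norm_amp_le π a).trans ha
        · exact (norm_amp_le π b).trans hb
    _ = _ := by ring

theorem Part.norm_pinch_le (𝒬 : Part D M) (T : B G) : ‖𝒬.pinch π T‖ ≤ 5 * ‖T‖ := by
  have h := 𝒬.norm_sub_pinch_le π LinearMap.id T fun a _ b _ ha hb _ => norm_conj_le π ha hb T
  rw [LinearMap.id_apply] at h
  have : 𝒬.pinch π T = T - (T - 𝒬.pinch π T) := by abel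
  rw [this]
  exact (norm_sub_le _ _).trans (by linarith)

variable {π} in
theorem Part.pinch_mul_left (hD : IsMasa D) (𝒬 : Part D M) {a : B H} (ha : a ∈ D) (T : B G) :
    𝒬.pinch π (π a * T) = π a * 𝒬.pinch π T := by
  simp only [𝒬.pinch_apply, Finset.mul_sum]
  refine Finset.sum_congr rfl fun k _ => ?_
  simp only [← mul_assoc, ← map_mul, hD.1 _ ha _ (𝒬.mem k).2.1.2]

variable {π} in
theorem Part.pinch_mul_right (hD : IsMasa D) (𝒬 : Part D M) {a : B H} (ha : a ∈ D) (T : B G) :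
    𝒬.pinch π (T * π a) = 𝒬.pinch π T * π a := by
  simp only [𝒬.pinch_apply, Finset.sum_mul]
  refine Finset.sum_congr rfl fun k _ => ?_
  simp only [mul_assoc, ← map_mul, hD.1 _ ha _ (𝒬.mem k).1.2]

variable {π} in
theorem Part.pinch_intertwine (hD : IsMasa D) (𝒬 : Part D M) {s : B H × B H}
    (hs : s ∈ pairs D M) (h : 𝒬.Compat s) (T : B G) :
    π s.2 * 𝒬.pinch π T = 𝒬.pinch π T * π s.1 := by
  simp only [𝒬.pinch_apply, Finset.sum_mul, Finset.mul_sum]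
  refine Finset.sum_congr rfl fun k _ => ?_
  rw [mul_assoc _ (π _) (π _), ← mul_assoc, ← mul_assoc, ← map_mul, ← map_mul,
    ← hD.1 _ hs.1.2 _ (𝒬.mem k).1.2]
  rcases h k with ⟨h1, h2⟩ | ⟨h1, h2⟩ <;> rw [h1, h2]
  simp

variable {π} in
theorem Part.pinch_eq_self (𝒬 : Part D M) {T : B G}
    (hT : ∀ s ∈ pairs D M, π s.2 * T = T * π s.1) : 𝒬.pinch π T = T := by
  have : ∀ k, π (𝒬.q k) * T * π (𝒬.p k) = T * π (𝒬.p k) := fun k => by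
    rw [hT _ (𝒬.mem k), mul_assoc, ← map_mul, (𝒬.mem k).1.1.isIdempotentElem.eq]
  simp only [𝒬.pinch_apply, this, ← Finset.mul_sum, ← map_sum, 𝒬.sum_p, map_one, mul_one]

end Part

section Pinch

variable {H : Type*} [NormedAddCommGroup H] [InnerProductSpace ℂ H] [CompleteSpace H]
  {D : StarSubalgebra ℂ (B H)} {M : Submodule ℂ (B H)}
  {G : Type*} [NormedAddCommGroup G] [InnerProductSpace ℂ G] [CompleteSpace G]
  {π : B H →⋆ₐ[ℂ] B G}

theorem eq_of_tendsto_inner {G ι : Type*} [NormedAddCommGroup G] [InnerProductSpace ℂ G]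
    {𝓕 : Filter ι} [𝓕.NeBot] {f : ι → B G} {S T : B G}
    (hS : ∀ x y, Tendsto (fun i => ⟪y, f i x⟫_ℂ) 𝓕 (𝓝 ⟪y, S x⟫_ℂ))
    (hT : ∀ x y, Tendsto (fun i => ⟪y, f i x⟫_ℂ) 𝓕 (𝓝 ⟪y, T x⟫_ℂ)) : S = T :=
  ContinuousLinearMap.ext fun x => ext_inner_left ℂ fun y =>
    tendsto_nhds_unique (hS x y) (hT x y)

variable (M π) in
theorem exists_pinchLim (hD : IsMasa D) (T : B G) : ∃ A : B G, ‖A‖ ≤ 5 * ‖T‖ ∧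
    ∀ x y, Tendsto (fun F => ⟪y, (part (M := M) hD F).pinch π T x⟫_ℂ) (partFilter D M)
      (𝓝 ⟪y, A x⟫_ℂ) :=
  exists_weak_limit _ fun F => (part hD F).norm_pinch_le π T

variable (M π) in
/-- A limit of block diagonal parts of `T` along finer and finer partitions. -/
def pinchLim (hD : IsMasa D) (T : B G) : B G := (exists_pinchLim M π hD T).choose

variable (hD : IsMasa D)

theorem norm_pinchLim_le (T : B G) : ‖pinchLim M π hD T‖ ≤ 5 * ‖T‖ :=
  (exists_pinchLim M π hD T).choose_spec.1

theorem tendsto_pinchLim (T : B G) (x y : G) :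
    Tendsto (fun F => ⟪y, (part (M := M) hD F).pinch π T x⟫_ℂ) (partFilter D M)
      (𝓝 ⟪y, pinchLim M π hD T x⟫_ℂ) :=
  (exists_pinchLim M π hD T).choose_spec.2 x y

theorem pinchLim_sub (S T : B G) :
    pinchLim M π hD (S - T) = pinchLim M π hD S - pinchLim M π hD T := by
  refine eq_of_tendsto_inner (tendsto_pinchLim hD (S - T)) fun x y => ?_
  simpa [inner_sub_right] using (tendsto_pinchLim hD S x y).sub (tendsto_pinchLim hD T x y)

theorem pinchLim_eq_self {T : B G} (hT : ∀ s ∈ pairs D M, π s.2 * T = T * π s.1) :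
    pinchLim M π hD T = T := by
  refine eq_of_tendsto_inner (tendsto_pinchLim hD T) fun x y => ?_
  simp only [Part.pinch_eq_self _ hT]
  exact tendsto_const_nhds

theorem pinchLim_intertwine (T : B G) {s : B H × B H} (hs : s ∈ pairs D M) :
    π s.2 * pinchLim M π hD T = pinchLim M π hD T * π s.1 := by
  refine ContinuousLinearMap.ext fun x => ext_inner_left ℂ fun y => ?_
  have h1 := tendsto_pinchLim (M := M) (π := π) hD T x (star (π s.2) y)
  have h2 := tendsto_pinchLim (M := M) (π := π) hD T (π s.1 x) y
  simp only [ContinuousLinearMap.star_eq_adjoint, ContinuousLinearMap.adjoint_inner_left] at h1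
  refine tendsto_nhds_unique h1 (h2.congr' ?_)
  filter_upwards [eventually_partFilter ⟨s, hs⟩] with F hF
  have := Part.pinch_intertwine (π := π) hD (part hD F) hs (part_compat hD hF) T
  exact congrArg (fun R : B G => ⟪y, R x⟫_ℂ) this.symm

theorem pinchLim_mul_left {a : B H} (ha : a ∈ D) (T : B G) :
    pinchLim M π hD (π a * T) = π a * pinchLim M π hD T := by
  refine eq_of_tendsto_inner (tendsto_pinchLim hD _) fun x y => ?_
  have h1 := tendsto_pinchLim (M := M) (π := π) hD T x (star (π a) y)
  simp only [ContinuousLinearMap.star_eq_adjoint, ContinuousLinearMap.adjoint_inner_left] at h1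
  simp only [Part.pinch_mul_left hD _ ha]
  exact h1

theorem pinchLim_mul_right {a : B H} (ha : a ∈ D) (T : B G) :
    pinchLim M π hD (T * π a) = pinchLim M π hD T * π a := by
  refine eq_of_tendsto_inner (tendsto_pinchLim hD _) fun x y => ?_
  simp only [Part.pinch_mul_right hD _ ha]
  exact tendsto_pinchLim (M := M) hD T (π a x) y

theorem pinchLim_preserves {N : Submodule ℂ (B H)} {T : B G}
    (hT : ∀ s ∈ pairs D N, π s.2 * T = T * π s.1) :
    ∀ s ∈ pairs D N, π s.2 * pinchLim M π hD T = pinchLim M π hD T * π s.1 := fun s hs => by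
  rw [← pinchLim_mul_left hD hs.2.1.2, hT s hs, pinchLim_mul_right hD hs.1.2]

theorem pinchLim_mem {X : Submodule ℂ (B G)} (hX : wsc X = X)
    (hbim : ∀ a ∈ D, ∀ b ∈ D, ∀ T ∈ X, π a * T * π b ∈ X) {T : B G} (hT : T ∈ X) :
    pinchLim M π hD T ∈ X := by
  rw [← hX]
  refine mem_wsc_of_tendsto (fun F => (part hD F).norm_pinch_le π T) (tendsto_pinchLim hD T)
    fun F => le_wsc ?_
  rw [Part.pinch_apply]
  exact sum_mem fun k _ => hbim _ ((part hD F).mem k).2.1.2 _ ((part hD F).mem k).1.2 T hT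

/-- The corners of `T` which kill all the `M i`, `i ∈ I`, are bounded by `c` at `(x, y)`. -/
def CornerBound {ι : Type*} (D : StarSubalgebra ℂ (B H)) (M : ι → Submodule ℂ (B H))
    (π : B H →⋆ₐ[ℂ] B G) (I : Finset ι) (T : B G) (x y : G) (c : ℝ) : Prop :=
  ∀ a ∈ D, ∀ b ∈ D, ‖a‖ ≤ 1 → ‖b‖ ≤ 1 → (∀ i ∈ I, ∀ m ∈ M i, a * m * b = 0) →
    ‖⟪y, (π a * T * π b) x⟫_ℂ‖ ≤ c

variable {ι : Type*} [DecidableEq ι] {M : ι → Submodule ℂ (B H)}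

theorem norm_sub_pinchLim_le {I : Finset ι} {i : ι} {T : B G} {x y : G} {c : ℝ}
    (h : CornerBound D M π (insert i I) T x y c) {a b : B H} (ha : a ∈ D) (hb : b ∈ D)
    (ha1 : ‖a‖ ≤ 1) (hb1 : ‖b‖ ≤ 1) (hab : ∀ j ∈ I, ∀ m ∈ M j, a * m * b = 0) :
    ‖⟪y, (π a * (T - pinchLim (M i) π hD T) * π b) x⟫_ℂ‖ ≤ 4 * c := by
  have hF : ∀ F, ‖⟪y, (π a * (T - (part (M := M i) hD F).pinch π T) * π b) x⟫_ℂ‖ ≤ 4 * c := by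
    intro F
    refine (part (M := M i) hD F).norm_sub_pinch_le π
      (vectorFunctional x y ∘ₗ sandwich (π a) (π b)) T fun a' ha' b' hb' ha1' hb1' h0 => ?_
    have := h (a * a') (mul_mem ha ha') (b' * b) (mul_mem hb' hb)
      ((norm_mul_le _ _).trans (mul_le_one₀ ha1 (norm_nonneg _) ha1'))
      ((norm_mul_le _ _).trans (mul_le_one₀ hb1' (norm_nonneg _) hb1)) fun j hj m hm => ?_
    · simpa using this
    · rcases Finset.mem_insert.1 hj with rfl | hj
      · calc a * a' * m * (b' * b) = a * (a' * m * b') * b := by simp only [mul_assoc]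
          _ = 0 := by rw [h0 m hm, mul_zero, zero_mul]
      · have e1 := hD.1 _ ha _ ha'
        have e2 := hD.1 _ hb' _ hb
        calc a * a' * m * (b' * b) = a' * (a * m * b) * b' := by
              rw [e1, e2]; simp only [mul_assoc]
          _ = 0 := by rw [hab j hj m hm, mul_zero, zero_mul]
  have h1 := tendsto_pinchLim (M := M i) (π := π) hD T (π b x) (star (π a) y)
  simp only [ContinuousLinearMap.star_eq_adjoint, ContinuousLinearMap.adjoint_inner_left] at h1
  have h2 := ((tendsto_const_nhds (x := ⟪y, π a (T (π b x))⟫_ℂ)).sub h1).norm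
  have h3 := le_of_tendsto h2 (Eventually.of_forall fun F => by
    simpa [inner_sub_right] using hF F : ∀ᶠ F in _, _ ≤ 4 * c)
  simpa [inner_sub_right] using h3

theorem CornerBound.sub_pinchLim {I : Finset ι} {i : ι} {T : B G} {x y : G} {c : ℝ}
    (h : CornerBound D M π (insert i I) T x y c) :
    CornerBound D M π I (T - pinchLim (M i) π hD T) x y (4 * c) :=
  fun _ ha _ hb ha1 hb1 hab => norm_sub_pinchLim_le hD h ha hb ha1 hb1 hab

theorem CornerBound.pinchLim {I : Finset ι} (i : ι) {T : B G} {x y : G} {c : ℝ}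
    (h : CornerBound D M π I T x y c) :
    CornerBound D M π I (pinchLim (M i) π hD T) x y (5 * c) := by
  intro a ha b hb ha1 hb1 hab
  have h' : CornerBound D M π (insert i I) T x y c := fun a ha b hb ha1 hb1 hab =>
    h a ha b hb ha1 hb1 fun j hj => hab j (Finset.mem_insert_of_mem hj)
  have h1 := norm_sub_pinchLim_le hD h' ha hb ha1 hb1 hab
  have h2 := h a ha b hb ha1 hb1 hab
  have e : ⟪y, (π a * SchurHyper.pinchLim (M i) π hD T * π b) x⟫_ℂ = ⟪y, (π a * T * π b) x⟫_ℂ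
      - ⟪y, (π a * (T - SchurHyper.pinchLim (M i) π hD T) * π b) x⟫_ℂ := by
    simp
  rw [e]
  exact (norm_sub_le _ _).trans (by linarith)

variable (π M) in
/-- Every operator is a sum of pieces, the piece for `E` intertwining all pairs of `M i`, `i ∈ E`,
and being controlled by the corners which kill all `M i`, `i ∉ E`. -/
theorem exists_decomposition (hD : IsMasa D) (A : Finset ι) (T : B G) : ∃ f : Finset ι → B G,
    ∑ E ∈ A.powerset, f E = T ∧
    (∀ E ⊆ A, ∀ i ∈ E, ∀ s ∈ pairs D (M i), π s.2 * f E = f E * π s.1) ∧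
    ∀ E ⊆ A, ∀ J x y c, 0 ≤ c → CornerBound D M π (J ∪ (A \ E)) T x y c →
      CornerBound D M π J (f E) x y (5 ^ A.card * c) := by
  induction A using Finset.induction_on with
  | empty =>
    refine ⟨fun _ => T, by simp, fun E hE i hi => ?_, fun E hE J x y c _ h => ?_⟩
    · rw [Finset.subset_empty.1 hE] at hi; simp at hi
    · simpa using h
  | insert i A hi ih =>
    obtain ⟨g, hg, hint, hN⟩ := ih
    refine ⟨fun E => if i ∈ E then pinchLim (M i) π hD (g (E.erase i))
      else g E - pinchLim (M i) π hD (g E), ?_, ?_, ?_⟩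
    · rw [Finset.sum_powerset_insert hi, ← hg, ← Finset.sum_add_distrib]
      refine Finset.sum_congr rfl fun E hE => ?_
      have hiE : i ∉ E := fun h => hi (Finset.mem_powerset.1 hE h)
      rw [if_neg hiE, if_pos (Finset.mem_insert_self _ _), Finset.erase_insert hiE]
      abel
    · intro E hE j hj s hs
      by_cases hiE : i ∈ E
      · simp only [if_pos hiE]
        by_cases hji : j = i
        · subst hji; exact pinchLim_intertwine hD _ hs
        · exact pinchLim_preserves hD (hint (E.erase i) (Finset.subset_insert_iff.1 hE) j
            (Finset.mem_erase.2 ⟨hji, hj⟩)) s hs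
      · simp only [if_neg hiE]
        have h1 := hint E ((Finset.subset_insert_iff_of_notMem hiE).1 hE) j hj
        rw [mul_sub, sub_mul, h1 s hs, pinchLim_preserves hD h1 s hs]
    · intro E hE J x y c hc h
      rw [Finset.card_insert_of_notMem hi, pow_succ]
      by_cases hiE : i ∈ E
      · simp only [if_pos hiE]
        have e : insert i A \ E = A \ E.erase i := by
          ext j
          simp only [Finset.mem_sdiff, Finset.mem_insert, Finset.mem_erase]
          grind
        rw [e] at h
        have := (hN (E.erase i) (Finset.subset_insert_iff.1 hE) J x y c hc h).pinchLim hD i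
        rwa [show (5 : ℝ) ^ A.card * 5 * c = 5 * (5 ^ A.card * c) by ring]
      · simp only [if_neg hiE]
        have e : J ∪ (insert i A \ E) = insert i J ∪ (A \ E) := by
          ext j
          simp only [Finset.mem_union, Finset.mem_sdiff, Finset.mem_insert]
          grind
        rw [e] at h
        have h1 := (hN E ((Finset.subset_insert_iff_of_notMem hiE).1 hE) _ x y c hc h).sub_pinchLim
          hD
        intro a ha b hb ha1 hb1 hab
        have h0 : 0 ≤ (5 : ℝ) ^ A.card * c := by positivity
        linarith [h1 a ha b hb ha1 hb1 hab]

end Pinch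

section Block

variable {G : Type*} [NormedAddCommGroup G] [InnerProductSpace ℂ G] [CompleteSpace G]

theorem inner_starProjection {P : B G} (hP : IsStarProjection P) (x y : G) :
    ⟪y, P x⟫_ℂ = ⟪P y, P x⟫_ℂ := by
  have h1 : ⟪P y, P x⟫_ℂ = ⟪y, (star P * P) x⟫_ℂ := by
    rw [ContinuousLinearMap.star_eq_adjoint]
    exact (ContinuousLinearMap.adjoint_inner_right P y (P x)).symm
  rw [h1, hP.isSelfAdjoint.star_eq, hP.isIdempotentElem.eq]

theorem inner_starProjection_left {P : B G} (hP : IsStarProjection P) (x y : G) :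
    ⟪P y, x⟫_ℂ = ⟪y, P x⟫_ℂ := by
  have h := ContinuousLinearMap.adjoint_inner_left P x y
  rwa [← ContinuousLinearMap.star_eq_adjoint, hP.isSelfAdjoint.star_eq] at h

variable {ι : Type*} [Fintype ι]

theorem sum_norm_sq_starProjection {P : ι → B G} (hP : ∀ k, IsStarProjection (P k))
    (h1 : ∑ k, P k = 1) (x : G) : ∑ k, ‖P k x‖ ^ 2 = ‖x‖ ^ 2 := by
  have h2 : ∑ k, ⟪P k x, P k x⟫_ℂ = ⟪x, x⟫_ℂ := by
    simp only [← inner_starProjection (hP _), ← inner_sum]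
    rw [← sum_apply, h1, one_apply_eq_self]
  simp only [inner_self_eq_norm_sq_to_K] at h2
  exact_mod_cast h2

theorem sum_norm_mul_norm_starProjection_le {P Q : ι → B G} (hP : ∀ k, IsStarProjection (P k))
    (hQ : ∀ k, IsStarProjection (Q k)) (hP1 : ∑ k, P k = 1) (hQ1 : ∑ k, Q k = 1) (x y : G) :
    ∑ k, ‖Q k y‖ * ‖P k x‖ ≤ ‖y‖ * ‖x‖ := by
  refine (Real.sum_mul_le_sqrt_mul_sqrt _ _ _).trans_eq ?_
  rw [sum_norm_sq_starProjection hP hP1, sum_norm_sq_starProjection hQ hQ1,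
    Real.sqrt_sq (norm_nonneg _), Real.sqrt_sq (norm_nonneg _)]

theorem norm_sum_block_le {P Q : ι → B G} (hP : ∀ k, IsStarProjection (P k))
    (hQ : ∀ k, IsStarProjection (Q k)) (hP1 : ∑ k, P k = 1) (hQ1 : ∑ k, Q k = 1) {f : ι → B G}
    {c : ℝ} (hc : 0 ≤ c) (hf : ∀ k x y, ‖⟪y, f k x⟫_ℂ‖ ≤ c * (‖Q k y‖ * ‖P k x‖)) :
    ‖∑ k, f k‖ ≤ c := by
  refine norm_le_of_inner_le hc fun x y => ?_
  rw [sum_apply, inner_sum]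
  calc _ ≤ ∑ k, c * (‖Q k y‖ * ‖P k x‖) :=
        (norm_sum_le _ _).trans (Finset.sum_le_sum fun k _ => hf k x y)
    _ ≤ c * (‖y‖ * ‖x‖) := by
        rw [← Finset.mul_sum]
        gcongr
        exact sum_norm_mul_norm_starProjection_le hP hQ hP1 hQ1 x y
    _ = _ := by ring

/-- Weak limits keep intertwining relations which hold eventually. -/
theorem intertwine_of_tendsto {ι : Type*} {𝓕 : Filter ι} [𝓕.NeBot] {f : ι → B G} {A p q : B G}
    (hf : ∀ x y, Tendsto (fun i => ⟪y, f i x⟫_ℂ) 𝓕 (𝓝 ⟪y, A x⟫_ℂ))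
    (h : ∀ᶠ i in 𝓕, q * f i = f i * p) : q * A = A * p := by
  refine ContinuousLinearMap.ext fun x => ext_inner_left ℂ fun y => ?_
  have h1 := hf x (star q y)
  simp only [ContinuousLinearMap.star_eq_adjoint, ContinuousLinearMap.adjoint_inner_left] at h1
  refine tendsto_nhds_unique h1 ((hf (p x) y).congr' ?_)
  filter_upwards [h] with i hi
  exact congrArg (fun R : B G => ⟪y, R x⟫_ℂ) hi.symm

end Block

section Theta

variable {H : Type*} [NormedAddCommGroup H] [InnerProductSpace ℂ H] [CompleteSpace H]
  {D : StarSubalgebra ℂ (B H)} {M : Submodule ℂ (B H)}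

theorem Part.isStarProjection_p (𝒬 : Part D M) (k : 𝒬.ι) : IsStarProjection (𝒬.p k) :=
  (𝒬.mem k).1.1

theorem Part.isStarProjection_q (𝒬 : Part D M) (k : 𝒬.ι) : IsStarProjection (𝒬.q k) :=
  (𝒬.mem k).2.1.1

/-- The weights of the block rank one operators `Part.theta`. -/
def Part.weight (𝒬 : Part D M) (e f : H) (k : 𝒬.ι) : ℝ := ‖𝒬.q k f‖ * ‖𝒬.p k e‖

theorem Part.weight_nonneg (𝒬 : Part D M) (e f : H) (k : 𝒬.ι) : 0 ≤ 𝒬.weight e f k := by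
  unfold Part.weight; positivity

/-- The partial isometry sending the vector `p k e` to a multiple of `q k f` for all `k`. -/
def Part.theta (𝒬 : Part D M) (e f : H) : B H :=
  ∑ k, ((𝒬.weight e f k : ℂ)⁻¹) • InnerProductSpace.rankOne ℂ (𝒬.q k f) (𝒬.p k e)

theorem Part.norm_theta_le (𝒬 : Part D M) (e f : H) : ‖𝒬.theta e f‖ ≤ 1 := by
  refine norm_sum_block_le 𝒬.isStarProjection_p 𝒬.isStarProjection_q 𝒬.sum_p 𝒬.sum_q zero_le_one
    fun k x y => ?_
  rw [smul_apply, InnerProductSpace.rankOne_apply, inner_smul_right, inner_smul_right,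
    inner_starProjection (𝒬.isStarProjection_q k),
    inner_starProjection_left (𝒬.isStarProjection_p k),
    inner_starProjection (𝒬.isStarProjection_p k), norm_mul, norm_mul, norm_inv, Complex.norm_real,
    Real.norm_of_nonneg (𝒬.weight_nonneg e f k), one_mul]
  calc (𝒬.weight e f k)⁻¹ * (‖⟪𝒬.p k e, 𝒬.p k x⟫_ℂ‖ * ‖⟪𝒬.q k y, 𝒬.q k f⟫_ℂ‖)
      ≤ (𝒬.weight e f k)⁻¹ * ((‖𝒬.p k e‖ * ‖𝒬.p k x‖) * (‖𝒬.q k y‖ * ‖𝒬.q k f‖)) := by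
        have := 𝒬.weight_nonneg e f k
        gcongr <;> exact norm_inner_le_norm _ _
    _ = ((𝒬.weight e f k)⁻¹ * 𝒬.weight e f k) * (‖𝒬.q k y‖ * ‖𝒬.p k x‖) := by
        rw [Part.weight]; ring
    _ ≤ 1 * (‖𝒬.q k y‖ * ‖𝒬.p k x‖) := by
        gcongr
        exact inv_mul_le_one
    _ = _ := one_mul _

theorem Part.theta_intertwine (𝒬 : Part D M) (e f : H) {s : B H × B H} (hs : s ∈ pairs D M)
    (h : 𝒬.Compat s) : s.2 * 𝒬.theta e f = 𝒬.theta e f * s.1 := by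
  refine ContinuousLinearMap.ext fun x => ?_
  simp only [Part.theta, Finset.mul_sum, Finset.sum_mul, sum_apply]
  refine Finset.sum_congr rfl fun k _ => ?_
  simp only [mul_apply_eq_comp, smul_apply, map_smul,
    InnerProductSpace.rankOne_apply]
  rw [← inner_starProjection_left hs.1.1]
  rcases h k with ⟨h1, h2⟩ | ⟨h1, h2⟩
  · have e1 := DFunLike.congr_fun h1 e
    have e2 := DFunLike.congr_fun h2 f
    simp only [mul_apply_eq_comp] at e1 e2
    rw [e1, e2]
  · have e1 := DFunLike.congr_fun h1 e
    have e2 := DFunLike.congr_fun h2 f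
    simp only [mul_apply_eq_comp, zero_apply] at e1 e2
    rw [e1, e2]
    simp

theorem Part.inner_theta (𝒬 : Part D M) (e f : H) :
    ⟪f, 𝒬.theta e f e⟫_ℂ = ((∑ k, 𝒬.weight e f k : ℝ) : ℂ) := by
  rw [Part.theta, sum_apply, inner_sum, Complex.ofReal_sum]
  refine Finset.sum_congr rfl fun k _ => ?_
  rw [smul_apply, InnerProductSpace.rankOne_apply, inner_smul_right, inner_smul_right,
    inner_starProjection (𝒬.isStarProjection_q k),
    inner_starProjection_left (𝒬.isStarProjection_p k),
    inner_starProjection (𝒬.isStarProjection_p k), inner_self_eq_norm_sq_to_K,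
    inner_self_eq_norm_sq_to_K]
  have : ((‖𝒬.p k e‖ : ℂ) ^ 2) * (‖𝒬.q k f‖ : ℂ) ^ 2
      = (𝒬.weight e f k : ℂ) * (𝒬.weight e f k : ℂ) := by
    simp only [Part.weight, Complex.ofReal_mul]; ring
  simp only [Complex.coe_algebraMap] at this ⊢
  rw [this, ← mul_assoc]
  exact inv_mul_mul_self _

variable (M) in
theorem exists_theta (hD : IsMasa D) (e f : H) : ∃ A : B H, ‖A‖ ≤ 1 ∧
    (∀ s ∈ pairs D M, s.2 * A = A * s.1) ∧
    Tendsto (fun F => ∑ k, (part (M := M) hD F).weight e f k) (partFilter D M)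
      (𝓝 (⟪f, A e⟫_ℂ).re) := by
  obtain ⟨A, hA, hlim⟩ := exists_weak_limit (partFilter D M)
    fun F => (part (M := M) hD F).norm_theta_le e f
  refine ⟨A, hA, fun s hs => intertwine_of_tendsto hlim ?_, ?_⟩
  · filter_upwards [eventually_partFilter ⟨s, hs⟩] with F hF
    exact (part hD F).theta_intertwine e f hs (part_compat hD hF)
  · have := (Complex.continuous_re.tendsto _).comp (hlim e f)
    refine this.congr fun F => ?_
    simp [Part.inner_theta]

end Theta

section Approx

variable {H K G : Type*} [NormedAddCommGroup H] [InnerProductSpace ℂ H] [CompleteSpace H]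
  [NormedAddCommGroup K] [InnerProductSpace ℂ K] [CompleteSpace K]
  [NormedAddCommGroup G] [InnerProductSpace ℂ G] [CompleteSpace G]
  {t : H →ₗ[ℂ] K →ₗ[ℂ] G} {τ : B H →ₗ[ℂ] B K →ₗ[ℂ] B G}
  {D : StarSubalgebra ℂ (B H)} {M : Submodule ℂ (B H)} {V : Submodule ℂ (B K)}

/-- The span of the elementary tensors `a ⊗ c` with `a ∈ M`, `c ∈ V`, as a submodule. -/
def tensorSub (τ : B H →ₗ[ℂ] B K →ₗ[ℂ] B G) (M : Submodule ℂ (B H)) (V : Submodule ℂ (B K)) :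
    Submodule ℂ (B G) :=
  Submodule.span ℂ {z | ∃ a ∈ M, ∃ c ∈ V, z = τ a c}

theorem tensor_mem_wsc [TopologicalSpace.SeparableSpace H] (ht : IsElemTensor t)
    (hτ : IsOpTensor t τ) {a : B H} (ha : a ∈ M) {c : B K} (hc : c ∈ wsc V) :
    τ a c ∈ wsc (tensorSub τ M V) :=
  map_mem_wsc (τ a) (fun _ hω => hω.comp_left ht.flip hτ.flip a)
    (fun c hc => le_wsc (Y := tensorSub τ M V) (Submodule.subset_span ⟨a, ha, c, hc, rfl⟩)) hc

/-- The normalised slices of `S` along a partition. -/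
def Part.nslice (𝒬 : Part D M) (ht : IsElemTensor t) (e f : H) (S : B G) (k : 𝒬.ι) : B K :=
  ((𝒬.weight e f k : ℂ)⁻¹) • ht.flip.slice (𝒬.q k f) (𝒬.p k e) S

theorem Part.norm_inner_slice_le (𝒬 : Part D M) (ht : IsElemTensor t) (e f : H) (S : B G)
    (k : 𝒬.ι) (x y : K) : ‖⟪y, ht.flip.slice (𝒬.q k f) (𝒬.p k e) S x⟫_ℂ‖
      ≤ 𝒬.weight e f k * (‖S‖ * ‖x‖ * ‖y‖) := by
  rw [ht.flip.inner_slice]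
  refine (norm_inner_apply_le _ _ _).trans_eq ?_
  rw [ht.flip.norm_apply, ht.flip.norm_apply, Part.weight]
  ring

theorem Part.norm_inner_nslice_le (𝒬 : Part D M) (ht : IsElemTensor t) (e f : H) (S : B G)
    (k : 𝒬.ι) (x y : K) : ‖⟪y, 𝒬.nslice ht e f S k x⟫_ℂ‖ ≤ ‖S‖ * ‖x‖ * ‖y‖ := by
  have h0 := 𝒬.weight_nonneg e f k
  rw [Part.nslice, smul_apply, inner_smul_right, norm_mul, norm_inv, Complex.norm_real,
    Real.norm_of_nonneg h0]
  calc _ ≤ (𝒬.weight e f k)⁻¹ * (𝒬.weight e f k * (‖S‖ * ‖x‖ * ‖y‖)) := by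
        gcongr
        exact 𝒬.norm_inner_slice_le ht e f S k x y
    _ = ((𝒬.weight e f k)⁻¹ * 𝒬.weight e f k) * (‖S‖ * ‖x‖ * ‖y‖) := by ring
    _ ≤ 1 * (‖S‖ * ‖x‖ * ‖y‖) := by
        gcongr
        exact inv_mul_le_one
    _ = _ := one_mul _

theorem Part.norm_nslice_le (𝒬 : Part D M) (ht : IsElemTensor t) (e f : H) (S : B G)
    (k : 𝒬.ι) : ‖𝒬.nslice ht e f S k‖ ≤ ‖S‖ :=
  norm_le_of_inner_le (norm_nonneg _) (𝒬.norm_inner_nslice_le ht e f S k)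

theorem Part.weight_mul_inner_nslice (𝒬 : Part D M) (ht : IsElemTensor t) (e f : H) (S : B G)
    (k : 𝒬.ι) (x y : K) : (𝒬.weight e f k : ℂ) * ⟪y, 𝒬.nslice ht e f S k x⟫_ℂ
      = ⟪t (𝒬.q k f) y, S (t (𝒬.p k e) x)⟫_ℂ := by
  rw [Part.nslice, smul_apply, inner_smul_right, ← mul_assoc]
  rcases eq_or_ne (𝒬.weight e f k) 0 with h | h
  · have := 𝒬.norm_inner_slice_le ht e f S k x y
    rw [h, zero_mul, norm_le_zero_iff, ht.flip.inner_slice] at this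
    rw [h]
    simpa using this.symm
  · rw [mul_inv_cancel₀ (by exact_mod_cast h), one_mul, ht.flip.inner_slice]
    rfl

/-- A block diagonal operator built from `A` and from the slices of `S`. -/
def Part.block (𝒬 : Part D M) (ht : IsElemTensor t) (τ : B H →ₗ[ℂ] B K →ₗ[ℂ] B G) (A : B H)
    (e f : H) (S : B G) : B G :=
  ∑ k, τ (A * 𝒬.p k) (𝒬.nslice ht e f S k)

theorem Part.norm_block_le (𝒬 : Part D M) (ht : IsElemTensor t) (hτ : IsOpTensor t τ) {A : B H}
    (hA1 : ‖A‖ ≤ 1) (hA : ∀ s ∈ pairs D M, s.2 * A = A * s.1) (e f : H) (S : B G) :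
    ‖𝒬.block ht τ A e f S‖ ≤ ‖S‖ := by
  have key : ∀ a : 𝒬.ι → B H, (∀ k, IsStarProjection (a k)) →
      ∀ k, IsStarProjection (hτ.amp ht (a k)) := fun a ha k => (ha k).map _
  refine norm_sum_block_le (key _ 𝒬.isStarProjection_p) (key _ 𝒬.isStarProjection_q)
    (by rw [← map_sum, 𝒬.sum_p, map_one]) (by rw [← map_sum, 𝒬.sum_q, map_one]) (norm_nonneg _)
    fun k x y => ?_
  have e1 : τ (A * 𝒬.p k) (𝒬.nslice ht e f S k)
      = hτ.amp ht (𝒬.q k) * τ A (𝒬.nslice ht e f S k) * hτ.amp ht (𝒬.p k) := by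
    rw [hτ.amp_apply, hτ.amp_apply, hτ.mul ht, hτ.mul ht, one_mul, mul_one, hA _ (𝒬.mem k),
      mul_assoc, (𝒬.isStarProjection_p k).isIdempotentElem.eq]
  rw [e1, mul_apply_eq_comp, mul_apply_eq_comp,
    ← inner_starProjection_left (key _ 𝒬.isStarProjection_q k)]
  refine (norm_inner_apply_le _ _ _).trans ?_
  gcongr
  calc _ ≤ ‖A‖ * ‖𝒬.nslice ht e f S k‖ := hτ.norm_le ht _ _
    _ ≤ 1 * ‖S‖ := by gcongr; exact 𝒬.norm_nslice_le ht e f S k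
    _ = _ := one_mul _

theorem Part.block_intertwine (𝒬 : Part D M) (hD : IsMasa D) (ht : IsElemTensor t)
    (hτ : IsOpTensor t τ) {A : B H} (hA : ∀ s ∈ pairs D M, s.2 * A = A * s.1) (e f : H) (S : B G)
    {s : B H × B H} (hs : s ∈ pairs D M) :
    hτ.amp ht s.2 * 𝒬.block ht τ A e f S = 𝒬.block ht τ A e f S * hτ.amp ht s.1 := by
  simp only [Part.block, Finset.mul_sum, Finset.sum_mul]
  refine Finset.sum_congr rfl fun k _ => ?_
  rw [hτ.amp_apply, hτ.amp_apply, hτ.mul ht, hτ.mul ht, one_mul, mul_one, ← mul_assoc, hA s hs,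
    mul_assoc, mul_assoc, hD.1 _ hs.1.2 _ (𝒬.mem k).1.2]

/-- `|c - z|` is small as soon as `c - re z` is, for `|z| ≤ c`. -/
theorem norm_ofReal_sub_le {c : ℝ} {z : ℂ} (h : ‖z‖ ≤ c) :
    ‖(c : ℂ) - z‖ ≤ √(2 * c) * √(c - z.re) := by
  have hre : z.re ≤ c := (Complex.re_le_norm z).trans h
  have hc : 0 ≤ c := (norm_nonneg _).trans h
  rw [← Real.sqrt_mul (by positivity)]
  refine Real.le_sqrt_of_sq_le ?_
  have h1 := Complex.sq_norm z
  have h2 := Complex.sq_norm ((c : ℂ) - z)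
  rw [Complex.normSq_apply] at h1 h2
  have h3 : ‖z‖ ^ 2 ≤ c ^ 2 := by gcongr
  simp at h2
  rw [h2]
  nlinarith

theorem Part.norm_inner_sub_block_le (𝒬 : Part D M) (hD : IsMasa D) (ht : IsElemTensor t)
    (hτ : IsOpTensor t τ) {A : B H} (hA1 : ‖A‖ ≤ 1) (hA : ∀ s ∈ pairs D M, s.2 * A = A * s.1)
    (e f : H) {S : B G} (hS : ∀ s ∈ pairs D M, hτ.amp ht s.2 * S = S * hτ.amp ht s.1)
    {s : B H × B H} (hs : s ∈ pairs D M) (hc : 𝒬.Compat s) (x y : K) :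
    ‖⟪t f y, S (t (s.1 e) x)⟫_ℂ - ⟪t f y, 𝒬.block ht τ A e f S (t (s.1 e) x)⟫_ℂ‖ ≤
      (‖S‖ * ‖x‖ * ‖y‖) * (√(2 * ∑ k, 𝒬.weight e f k) *
        √(∑ k, 𝒬.weight e f k - (⟪f, A e⟫_ℂ).re)) := by
  set z : 𝒬.ι → ℂ := fun k => ⟪f, A (𝒬.p k e)⟫_ℂ with hz
  have hzc : ∀ k, ‖z k‖ ≤ 𝒬.weight e f k := fun k => by
    have e1 : z k = ⟪𝒬.q k f, A (𝒬.p k e)⟫_ℂ := by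
      have e2 := DFunLike.congr_fun (hA _ (𝒬.mem k)) (𝒬.p k e)
      have e3 := DFunLike.congr_fun (𝒬.isStarProjection_p k).isIdempotentElem.eq e
      simp only [mul_apply_eq_comp] at e2 e3
      rw [inner_starProjection_left (𝒬.isStarProjection_q k), e2, e3]
    rw [e1, Part.weight]
    calc _ ≤ ‖A‖ * (‖𝒬.q k f‖ * ‖𝒬.p k e‖) := norm_inner_apply_le _ _ _
      _ ≤ 1 * (‖𝒬.q k f‖ * ‖𝒬.p k e‖) := by gcongr
      _ = _ := one_mul _
  have hzs : ∑ k, z k = ⟪f, A e⟫_ℂ := by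
    simp only [hz, ← inner_sum, ← map_sum]
    rw [← sum_apply, 𝒬.sum_p, one_apply_eq_self]
  have hdiff : ⟪t f y, S (t (s.1 e) x)⟫_ℂ - ⟪t f y, 𝒬.block ht τ A e f S (t (s.1 e) x)⟫_ℂ
      = ∑ k, (⟪t (𝒬.q k f) y, S (t (𝒬.p k (s.1 e)) x)⟫_ℂ
          - ⟪f, A (𝒬.p k (s.1 e))⟫_ℂ * ⟪y, 𝒬.nslice ht e f S k x⟫_ℂ) := by
    rw [Finset.sum_sub_distrib]
    congr 1
    · have e1 : ∀ k, ⟪t (𝒬.q k f) y, S (t (𝒬.p k (s.1 e)) x)⟫_ℂ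
          = ⟪t f y, S (t (𝒬.p k (s.1 e)) x)⟫_ℂ := fun k => by
        have e2 := DFunLike.congr_fun (hS _ (𝒬.mem k)) (t (𝒬.p k (s.1 e)) x)
        have e3 := DFunLike.congr_fun (𝒬.isStarProjection_p k).isIdempotentElem.eq (s.1 e)
        simp only [mul_apply_eq_comp, hτ.amp_tensor ht] at e2 e3
        rw [← hτ.amp_tensor ht (𝒬.q k), inner_starProjection_left
          ((𝒬.isStarProjection_q k).map (hτ.amp ht)), e2, e3]
      simp only [e1, ← inner_sum, ← map_sum, ← LinearMap.sum_apply]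
      rw [← sum_apply, 𝒬.sum_p, one_apply_eq_self]
    · rw [Part.block, sum_apply, inner_sum]
      refine Finset.sum_congr rfl fun k _ => ?_
      rw [hτ, ht.1]
      rfl
  rw [hdiff]
  have hk : ∀ k, ‖⟪t (𝒬.q k f) y, S (t (𝒬.p k (s.1 e)) x)⟫_ℂ
          - ⟪f, A (𝒬.p k (s.1 e))⟫_ℂ * ⟪y, 𝒬.nslice ht e f S k x⟫_ℂ‖
      ≤ (‖S‖ * ‖x‖ * ‖y‖) * (√(2 * 𝒬.weight e f k) * √(𝒬.weight e f k - (z k).re)) := by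
    intro k
    have e1 : 𝒬.p k (s.1 e) = s.1 (𝒬.p k e) :=
      DFunLike.congr_fun (hD.1 _ (𝒬.mem k).1.2 _ hs.1.2) e
    rw [e1]
    rcases hc k with ⟨h1, -⟩ | ⟨h1, -⟩
    · have e2 : s.1 (𝒬.p k e) = 𝒬.p k e := DFunLike.congr_fun h1 e
      rw [e2, ← 𝒬.weight_mul_inner_nslice, ← sub_mul, norm_mul, mul_comm]
      gcongr
      · exact 𝒬.norm_inner_nslice_le ht e f S k x y
      · exact norm_ofReal_sub_le (hzc k)
    · have e2 : s.1 (𝒬.p k e) = 0 := DFunLike.congr_fun h1 e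
      rw [e2]
      simp only [map_zero, LinearMap.zero_apply, inner_zero_right, zero_mul, sub_zero, norm_zero]
      positivity
  refine (norm_sum_le _ _).trans ((Finset.sum_le_sum fun k _ => hk k).trans ?_)
  rw [← Finset.mul_sum]
  gcongr
  refine (Real.sum_sqrt_mul_sqrt_le _ (fun k => ?_) fun k => ?_).trans_eq ?_
  · have := 𝒬.weight_nonneg e f k
    positivity
  · have := (Complex.re_le_norm _).trans (hzc k)
    linarith
  · rw [← Finset.mul_sum, Finset.sum_sub_distrib, ← hzs, Complex.re_sum]

theorem exists_approx [TopologicalSpace.SeparableSpace H] (hD : IsMasa D) (hbim : IsBimodule D M)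
    (hter : IsTernary M) (hcl : wsc M = M) (ht : IsElemTensor t) (hτ : IsOpTensor t τ) {S : B G}
    (hS : ∀ s ∈ pairs D M, hτ.amp ht s.2 * S = S * hτ.amp ht s.1)
    (hV : ∀ h h', ht.flip.slice h h' S ∈ wsc V) (e f : H) :
    ∃ A ∈ wsc (tensorSub τ M V), (∀ s ∈ pairs D M, hτ.amp ht s.2 * A = A * hτ.amp ht s.1) ∧
      ∀ s ∈ pairs D M, ∀ x y, ⟪t f y, A (t (s.1 e) x)⟫_ℂ = ⟪t f y, S (t (s.1 e) x)⟫_ℂ := by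
  obtain ⟨θ, hθ1, hθ, hlim⟩ := exists_theta M hD e f
  have hθM : θ ∈ M := mem_of_pairs hD hbim hter hcl hθ
  have hbd := fun F => (part (M := M) hD F).norm_block_le ht hτ hθ1 hθ e f S
  obtain ⟨A, -, hA⟩ := exists_weak_limit (partFilter D M) hbd
  refine ⟨A, mem_wsc_of_tendsto hbd hA fun F => ?_, fun s hs => intertwine_of_tendsto hA
    (Eventually.of_forall fun F => (part (M := M) hD F).block_intertwine hD ht hτ hθ e f S hs),
    fun s hs x y => ?_⟩
  · refine sum_mem fun k _ => tensor_mem_wsc ht hτ ?_ ((wsc V).smul_mem _ (hV _ _))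
    simpa using hbim 1 (one_mem _) _ ((part (M := M) hD F).mem k).1.2 θ hθM
  · refine tendsto_nhds_unique (hA (t (s.1 e) x) (t f y)) ?_
    refine tendsto_iff_norm_sub_tendsto_zero.2 ?_
    have h0 : Tendsto (fun F => (‖S‖ * ‖x‖ * ‖y‖) *
        (√(2 * ∑ k, (part (M := M) hD F).weight e f k) *
          √(∑ k, (part (M := M) hD F).weight e f k - (⟪f, θ e⟫_ℂ).re))) (partFilter D M)
        (𝓝 0) := by
      have := ((hlim.const_mul 2).sqrt.mul (hlim.sub_const (⟪f, θ e⟫_ℂ).re).sqrt).const_mul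
        (‖S‖ * ‖x‖ * ‖y‖)
      simpa using this
    refine squeeze_zero' (Eventually.of_forall fun _ => norm_nonneg _) ?_ h0
    filter_upwards [eventually_partFilter ⟨s, hs⟩] with F hF
    rw [norm_sub_rev]
    exact (part (M := M) hD F).norm_inner_sub_block_le hD ht hτ hθ1 hθ e f hS hs
      (part_compat hD hF) x y

end Approx

section Cyclic

variable {H : Type*} [NormedAddCommGroup H] [InnerProductSpace ℂ H]

/-- Strong convergence to the identity can be checked on a total set. -/
theorem tendsto_apply_of_dense {f : ℕ → B H} (hf : ∀ n, ‖f n‖ ≤ 1) {X : Set H}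
    (hX : Dense (Submodule.span ℂ X : Set H)) (h : ∀ x ∈ X, Tendsto (fun n => f n x) atTop (𝓝 x))
    (x : H) : Tendsto (fun n => f n x) atTop (𝓝 x) := by
  have hspan : ∀ x ∈ Submodule.span ℂ X, Tendsto (fun n => f n x) atTop (𝓝 x) := by
    intro x hx
    induction hx using Submodule.span_induction with
    | mem x hx => exact h x hx
    | zero => simp
    | add x y _ _ hx hy => simpa using hx.add hy
    | smul c x _ hx => simpa using hx.const_smul c
  rw [Metric.tendsto_nhds]
  intro ε hε
  obtain ⟨y, hy, hxy⟩ := Metric.mem_closure_iff.1 (hX x) (ε / 3) (by positivity)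
  filter_upwards [Metric.tendsto_nhds.1 (hspan y hy) (ε / 3) (by positivity)] with n hn
  have h1 : dist (f n x) (f n y) ≤ dist x y := by
    rw [dist_eq_norm, dist_eq_norm, ← map_sub]
    exact ((f n).le_opNorm _).trans (mul_le_of_le_one_left (norm_nonneg _) (hf n))
  have h2 := dist_triangle4 (f n x) (f n y) y x
  rw [dist_comm y x] at h2
  linarith

variable [CompleteSpace H]

theorem norm_starProjection_le {P : B H} (hP : IsStarProjection P) : ‖P‖ ≤ 1 :=
  ContinuousLinearMap.opNorm_le_bound _ zero_le_one fun x => by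
    have h1 : ‖P x‖ ^ 2 ≤ ‖x‖ * ‖P x‖ := by
      have := norm_inner_le_norm (𝕜 := ℂ) x (P x)
      rw [inner_starProjection hP, inner_self_eq_norm_sq_to_K] at this
      simpa using this
    rcases (norm_nonneg (P x)).eq_or_lt with h | h
    · rw [← h]; positivity
    · rw [one_mul]
      nlinarith

theorem closureProj_eq_zero {X : Submodule ℂ H} {v : H} (h : ∀ x ∈ X, ⟪x, v⟫_ℂ = 0) :
    closureProj X v = 0 := by
  refine ext_inner_left ℂ fun y => ?_
  rw [← inner_starProjection_left isStarProjection_closureProj, inner_zero_right]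
  have hcl : IsClosed {x : H | ⟪x, v⟫_ℂ = 0} := isClosed_eq (by fun_prop) continuous_const
  exact closure_minimal (s := (X : Set H)) h hcl (closureProj_mem y)

/-- The projection onto the closed cyclic subspace generated by `e`. -/
def cyc (𝒞 : Set (B H)) (e : H) : B H := closureProj (Submodule.span ℂ ((fun p => p e) '' 𝒞))

theorem isStarProjection_cyc (𝒞 : Set (B H)) (e : H) : IsStarProjection (cyc 𝒞 e) :=
  isStarProjection_closureProj

variable {𝒞 : Set (B H)}

theorem cyc_apply_self (h1 : (1 : B H) ∈ 𝒞) (e : H) : cyc 𝒞 e e = e :=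
  closureProj_eq_self (Submodule.subset_span ⟨1, h1, rfl⟩)

theorem mul_cyc_congr {S T : B H} {e : H} (h : ∀ p ∈ 𝒞, S (p e) = T (p e)) :
    S * cyc 𝒞 e = T * cyc 𝒞 e := by
  refine mul_closureProj_congr fun x hx => ?_
  induction hx using Submodule.span_induction with
  | mem x hx => obtain ⟨p, hp, rfl⟩ := hx; exact h p hp
  | zero => simp
  | add x y _ _ hx hy => simp [hx, hy]
  | smul c x _ hx => simp [hx]

theorem commute_cyc (hmul : ∀ p ∈ 𝒞, ∀ q ∈ 𝒞, p * q ∈ 𝒞) (hstar : ∀ p ∈ 𝒞, star p = p) {p : B H}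
    (hp : p ∈ 𝒞) (e : H) : p * cyc 𝒞 e = cyc 𝒞 e * p := by
  have key : ∀ x ∈ Submodule.span ℂ ((fun p => p e) '' 𝒞),
      p x ∈ Submodule.span ℂ ((fun p => p e) '' 𝒞) := by
    intro x hx
    induction hx using Submodule.span_induction with
    | mem x hx =>
      obtain ⟨q, hq, rfl⟩ := hx
      exact Submodule.subset_span ⟨p * q, hmul p hp q hq, rfl⟩
    | zero => simp
    | add x y _ _ hx hy => rw [map_add]; exact add_mem hx hy
    | smul c x _ hx => rw [map_smul]; exact Submodule.smul_mem _ c hx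
  exact mul_closureProj_eq key (by rw [hstar p hp]; exact key)

/-- Finite sums of cyclic projections increasing to the identity. -/
theorem exists_cyc_seq [TopologicalSpace.SeparableSpace H] (h1 : (1 : B H) ∈ 𝒞)
    (hmul : ∀ p ∈ 𝒞, ∀ q ∈ 𝒞, p * q ∈ 𝒞) (hstar : ∀ p ∈ 𝒞, star p = p) :
    ∃ (P : ℕ → B H) (g : ℕ → H), (∀ n, P n = ∑ i ∈ Finset.range n, cyc 𝒞 (g i)) ∧
      (∀ n, IsStarProjection (P n)) ∧ ∀ x, Tendsto (fun n => P n x) atTop (𝓝 x) := by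
  set e := TopologicalSpace.denseSeq H
  let P : ℕ → B H := fun n => Nat.rec 0 (fun n Q => Q + cyc 𝒞 ((1 - Q) (e n))) n
  have hP : ∀ n, P (n + 1) = P n + cyc 𝒞 ((1 - P n) (e n)) := fun n => rfl
  have hproj : ∀ n, IsStarProjection (P n) ∧ ∀ p ∈ 𝒞, p * P n = P n * p := by
    intro n
    induction n with
    | zero => exact ⟨.zero _, fun p _ => (mul_zero p).trans (zero_mul p).symm⟩
    | succ n ih =>
      obtain ⟨ih1, ih2⟩ := ih
      have hR := isStarProjection_cyc 𝒞 ((1 - P n) (e n))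
      have h0 : P n * cyc 𝒞 ((1 - P n) (e n)) = 0 := by
        rw [← zero_mul (cyc 𝒞 ((1 - P n) (e n)))]
        refine mul_cyc_congr fun p hp => ?_
        have h2 : P n * (p * (1 - P n)) = 0 := by
          rw [← mul_assoc, ← ih2 p hp, mul_assoc, mul_sub, mul_one, ih1.isIdempotentElem.eq,
            sub_self, mul_zero]
        exact DFunLike.congr_fun h2 (e n)
      have h0' : cyc 𝒞 ((1 - P n) (e n)) * P n = 0 := by
        have := congrArg star h0
        rwa [star_mul, ih1.isSelfAdjoint.star_eq, hR.isSelfAdjoint.star_eq, star_zero] at this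
      rw [hP]
      refine ⟨⟨?_, ih1.isSelfAdjoint.add hR.isSelfAdjoint⟩, fun p hp => ?_⟩
      · rw [IsIdempotentElem, add_mul, mul_add, mul_add, h0, h0', ih1.isIdempotentElem.eq,
          hR.isIdempotentElem.eq, add_zero, zero_add]
      · rw [mul_add, add_mul, ih2 p hp, commute_cyc hmul hstar hp]
  have hfix : ∀ n, ∀ i < n, P n (e i) = e i := by
    intro n
    induction n with
    | zero => simp
    | succ n ih =>
      have hpn : ∀ v, P n v = v → cyc 𝒞 ((1 - P n) (e n)) v = 0 := by
        intro v hv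
        refine closureProj_eq_zero fun x hx => ?_
        rw [← hv, ← inner_starProjection_left (hproj n).1]
        suffices P n x = 0 by rw [this, inner_zero_left]
        induction hx using Submodule.span_induction with
        | mem x hx =>
          obtain ⟨p, hp, rfl⟩ := hx
          have h2 : P n * (p * (1 - P n)) = 0 := by
            rw [← mul_assoc, ← (hproj n).2 p hp, mul_assoc, mul_sub, mul_one,
              (hproj n).1.isIdempotentElem.eq, sub_self, mul_zero]
          exact DFunLike.congr_fun h2 (e n)
        | zero => simp
        | add x y _ _ hx hy => simp [hx, hy]
        | smul c x _ hx => simp [hx]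
      intro i hi
      rw [hP, add_apply]
      rcases (Nat.lt_succ_iff.1 hi).lt_or_eq with h | rfl
      · rw [hpn _ (ih i h), ih i h, add_zero]
      · have h4 : cyc 𝒞 ((1 - P i) (e i)) (P i (e i)) = 0 :=
          hpn _ (DFunLike.congr_fun (hproj i).1.isIdempotentElem.eq (e i))
        have h5 : cyc 𝒞 ((1 - P i) (e i)) (e i) = (1 - P i) (e i) := by
          have h6 := cyc_apply_self h1 ((1 - P i) (e i))
          have h7 : cyc 𝒞 ((1 - P i) (e i)) ((1 - P i) (e i))
              = cyc 𝒞 ((1 - P i) (e i)) (e i) - cyc 𝒞 ((1 - P i) (e i)) (P i (e i)) := by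
            rw [← map_sub, sub_apply, one_apply_eq_self]
          rw [h7, h4, sub_zero] at h6
          exact h6
        rw [h5]
        simp
  refine ⟨P, fun n => (1 - P n) (e n), fun n => ?_, fun n => (hproj n).1,
    tendsto_apply_of_dense (fun n => norm_starProjection_le (hproj n).1) (X := Set.range e)
      ((TopologicalSpace.denseRange_denseSeq H).mono Submodule.subset_span) ?_⟩
  · induction n with
    | zero => rfl
    | succ n ih => rw [Finset.sum_range_succ, ← ih, hP]
  · rintro _ ⟨i, rfl⟩
    refine tendsto_const_nhds.congr' ?_
    filter_upwards [eventually_gt_atTop i] with n hn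
    exact (hfix n i hn).symm

/-- Compressions to projections increasing to the identity converge weakly. -/
theorem mem_wsc_of_compress {Y : Submodule ℂ (B H)} {P Q : ℕ → B H}
    (hP : ∀ n, IsStarProjection (P n))
    (hQ : ∀ n, IsStarProjection (Q n)) (hP1 : ∀ x, Tendsto (fun n => P n x) atTop (𝓝 x))
    (hQ1 : ∀ x, Tendsto (fun n => Q n x) atTop (𝓝 x)) {S : B H}
    (h : ∀ n, Q n * S * P n ∈ wsc Y) : S ∈ wsc Y := by
  refine mem_wsc_of_tendsto (𝓕 := atTop) (C := 1 * ‖S‖ * 1) (fun n => ?_) (fun x y => ?_) h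
  · refine (norm_mul_le _ _).trans ?_
    gcongr
    · refine (norm_mul_le _ _).trans ?_
      gcongr
      exact norm_starProjection_le (hQ n)
    · exact norm_starProjection_le (hP n)
  · have h1 := (hQ1 y).inner (𝕜 := ℂ) ((S.continuous.tendsto x).comp (hP1 x))
    refine h1.congr fun n => ?_
    rw [inner_starProjection_left (hQ n)]
    rfl

end Cyclic

section Fubini

variable {H K G : Type*} [NormedAddCommGroup H] [InnerProductSpace ℂ H] [CompleteSpace H]
  [NormedAddCommGroup K] [InnerProductSpace ℂ K] [CompleteSpace K]
  [NormedAddCommGroup G] [InnerProductSpace ℂ G] [CompleteSpace G]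
  {t : H →ₗ[ℂ] K →ₗ[ℂ] G} {τ : B H →ₗ[ℂ] B K →ₗ[ℂ] B G}
  {D : StarSubalgebra ℂ (B H)} {M : Submodule ℂ (B H)} {V : Submodule ℂ (B K)}

theorem cyc_mul_mul_cyc_eq_zero {𝒞 𝒞' : Set (B H)} {e f : H} {R : B H}
    (h : ∀ p ∈ 𝒞, ∀ q ∈ 𝒞', ⟪q f, R (p e)⟫_ℂ = 0) : cyc 𝒞' f * R * cyc 𝒞 e = 0 := by
  rw [← zero_mul (cyc 𝒞 e)]
  refine mul_cyc_congr fun p hp => ?_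
  refine closureProj_eq_zero fun x hx => ?_
  induction hx using Submodule.span_induction with
  | mem x hx => obtain ⟨q, hq, rfl⟩ := hx; exact h p hp q hq
  | zero => simp
  | add x y _ _ hx hy => exact (inner_add_left _ _ _).trans (by rw [hx, hy, add_zero])
  | smul c x _ hx => exact (inner_smul_left _ _ _).trans (by rw [hx, mul_zero])

theorem pairs_fst_mul (hD : IsMasa D) :
    ∀ p ∈ Prod.fst '' pairs D M, ∀ q ∈ Prod.fst '' pairs D M, p * q ∈ Prod.fst '' pairs D M := by
  rintro _ ⟨s, hs, rfl⟩ _ ⟨s', hs', rfl⟩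
  exact ⟨_, pairs_mul hD hs hs', rfl⟩

theorem pairs_snd_mul (hD : IsMasa D) :
    ∀ p ∈ Prod.snd '' pairs D M, ∀ q ∈ Prod.snd '' pairs D M, p * q ∈ Prod.snd '' pairs D M := by
  rintro _ ⟨s, hs, rfl⟩ _ ⟨s', hs', rfl⟩
  exact ⟨_, pairs_mul hD hs hs', rfl⟩

theorem pairs_fst_star : ∀ p ∈ Prod.fst '' pairs D M, star p = p := by
  rintro _ ⟨s, hs, rfl⟩
  exact hs.1.1.isSelfAdjoint.star_eq

theorem pairs_snd_star : ∀ p ∈ Prod.snd '' pairs D M, star p = p := by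
  rintro _ ⟨s, hs, rfl⟩
  exact hs.2.1.1.isSelfAdjoint.star_eq

theorem cyc_mul_mul_cyc_mem (hD : IsMasa D) (hbim : IsBimodule D M) (hter : IsTernary M)
    (hcl : wsc M = M) (e f : H) {m : B H} (hm : m ∈ M) :
    cyc (Prod.snd '' pairs D M) f * m * cyc (Prod.fst '' pairs D M) e ∈ M := by
  refine mem_of_pairs hD hbim hter hcl fun s hs => ?_
  rw [← mul_assoc, ← mul_assoc, commute_cyc (pairs_snd_mul hD) pairs_snd_star ⟨s, hs, rfl⟩,
    mul_assoc _ s.2, hs.2.2 m hm, mul_assoc, mul_assoc, mul_assoc,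
    commute_cyc (pairs_fst_mul hD) pairs_fst_star ⟨s, hs, rfl⟩]
  simp only [mul_assoc]

theorem corner_mem [TopologicalSpace.SeparableSpace H] (hD : IsMasa D) (hbim : IsBimodule D M)
    (hter : IsTernary M) (hcl : wsc M = M) (ht : IsElemTensor t) (hτ : IsOpTensor t τ) {S : B G}
    (hS : ∀ s ∈ pairs D M, hτ.amp ht s.2 * S = S * hτ.amp ht s.1)
    (hV : ∀ h h', ht.flip.slice h h' S ∈ wsc V) (e f : H) :
    hτ.amp ht (cyc (Prod.snd '' pairs D M) f) * S * hτ.amp ht (cyc (Prod.fst '' pairs D M) e)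
      ∈ wsc (tensorSub τ M V) := by
  set Q := cyc (Prod.snd '' pairs D M) f with hQ
  set P := cyc (Prod.fst '' pairs D M) e with hP
  obtain ⟨A, hAmem, hA, hAS⟩ := exists_approx hD hbim hter hcl ht hτ hS hV e f
  have h1 : hτ.amp ht Q * S * hτ.amp ht P = hτ.amp ht Q * A * hτ.amp ht P := by
    refine sub_eq_zero.1 (ht.ext_slice fun c c' => ?_)
    rw [← sub_mul, ← mul_sub, mul_assoc, ht.slice_amp_mul, ht.slice_mul_amp, map_zero, ← mul_assoc]
    refine cyc_mul_mul_cyc_eq_zero ?_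
    rintro _ ⟨s, hs, rfl⟩ _ ⟨s', hs', rfl⟩
    have e1 : ∀ R : B G, (∀ s ∈ pairs D M, hτ.amp ht s.2 * R = R * hτ.amp ht s.1) →
        ⟪t (s'.2 f) c, R (t (s.1 e) c')⟫_ℂ = ⟪t f c, R (t ((s'.1 * s.1) e) c')⟫_ℂ := by
      intro R hR
      rw [← hτ.amp_tensor ht s'.2, inner_starProjection_left (hs'.2.1.1.map (hτ.amp ht))]
      have := DFunLike.congr_fun (hR s' hs') (t (s.1 e) c')
      simp only [mul_apply_eq_comp, hτ.amp_tensor ht] at this ⊢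
      rw [this]
    rw [map_sub, sub_apply, inner_sub_right, ht.inner_slice, ht.inner_slice, e1 S hS, e1 A hA,
      hAS _ (pairs_mul hD hs' hs), sub_self]
  rw [h1]
  refine map_mem_wsc (sandwich (hτ.amp ht Q) (hτ.amp ht P)) (fun _ hω => hω.comp_sandwich _ _)
    (fun R hR => ?_) hAmem
  refine le_wsc ?_
  induction hR using Submodule.span_induction with
  | mem R hR =>
    obtain ⟨a, ha, c, hc, rfl⟩ := hR
    refine Submodule.subset_span ⟨Q * a * P, cyc_mul_mul_cyc_mem hD hbim hter hcl e f ha, c, hc, ?_⟩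
    have : τ (Q * a * P) c = hτ.amp ht Q * (τ a c * hτ.amp ht P) := by
      rw [hτ.amp_apply, hτ.amp_apply, hτ.mul ht, hτ.mul ht, one_mul, mul_one, mul_assoc]
    exact this.symm
  | zero => rw [map_zero]; exact zero_mem _
  | add x y _ _ hx hy => rw [map_add]; exact add_mem hx hy
  | smul c x _ hx => rw [map_smul]; exact Submodule.smul_mem _ c hx

/-- An operator with slices in `V` which intertwines the pairs of `M` belongs to `M ⊗ V`. -/
theorem mem_of_slices [TopologicalSpace.SeparableSpace H] (hD : IsMasa D) (hbim : IsBimodule D M)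
    (hter : IsTernary M) (hcl : wsc M = M) (ht : IsElemTensor t) (hτ : IsOpTensor t τ) {S : B G}
    (hS : ∀ s ∈ pairs D M, hτ.amp ht s.2 * S = S * hτ.amp ht s.1)
    (hV : ∀ h h', ht.flip.slice h h' S ∈ wsc V) : S ∈ wsc (tensorSub τ M V) := by
  obtain ⟨P, g, hP, hPp, hPt⟩ := exists_cyc_seq (𝒞 := Prod.fst '' pairs D M) ⟨_, pairs_one, rfl⟩
    (pairs_fst_mul hD) pairs_fst_star
  obtain ⟨Q, g', hQ, hQp, hQt⟩ := exists_cyc_seq (𝒞 := Prod.snd '' pairs D M) ⟨_, pairs_one, rfl⟩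
    (pairs_snd_mul hD) pairs_snd_star
  have key : ∀ P : ℕ → B H, (∀ n, IsStarProjection (P n)) →
      (∀ x, Tendsto (fun n => P n x) atTop (𝓝 x)) →
      ∀ x, Tendsto (fun n => hτ.amp ht (P n) x) atTop (𝓝 x) := by
    intro P hP hPt
    refine tendsto_apply_of_dense (fun n => norm_starProjection_le ((hP n).map _)) ht.2 ?_
    rintro _ ⟨x, y, rfl⟩
    simp only [hτ.amp_tensor ht]
    exact ((ht.ins y).continuous.tendsto x).comp (hPt x)
  refine mem_wsc_of_compress (fun n => (hPp n).map (hτ.amp ht)) (fun n => (hQp n).map (hτ.amp ht))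
    (key P hPp hPt) (key Q hQp hQt) fun n => ?_
  rw [hP, hQ, map_sum, map_sum, Finset.sum_mul, Finset.sum_mul]
  refine sum_mem fun i _ => ?_
  rw [Finset.mul_sum]
  exact sum_mem fun j _ => corner_mem hD hbim hter hcl ht hτ hS hV _ _

end Fubini

section SliceTop

variable {A C G : Type*} [NormedAddCommGroup A] [InnerProductSpace ℂ A] [CompleteSpace A]
  [NormedAddCommGroup C] [InnerProductSpace ℂ C] [CompleteSpace C]
  [NormedAddCommGroup G] [InnerProductSpace ℂ G] [CompleteSpace G]
  {t : A →ₗ[ℂ] C →ₗ[ℂ] G} {τ : B A →ₗ[ℂ] B C →ₗ[ℂ] B G} {Y : Submodule ℂ (B A)}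

theorem slice_mem_wsc {C : Type*} [NormedAddCommGroup C] [InnerProductSpace ℂ C]
    {t : A →ₗ[ℂ] C →ₗ[ℂ] G} {τ : B A →ₗ[ℂ] B C →ₗ[ℂ] B G}
    (ht : IsElemTensor t) (hτ : IsOpTensor t τ) {V : Submodule ℂ (B C)} {S : B G}
    (hS : S ∈ wsc (tensorSub τ Y V)) (c c' : C) : ht.slice c c' S ∈ wsc Y := by
  refine map_mem_wsc (ht.slice c c') (fun _ hω => hω.comp_sandwich _ _) (fun R hR => ?_) hS
  refine le_wsc ?_
  induction hR using Submodule.span_induction with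
  | mem R hR =>
    obtain ⟨a, ha, u, -, rfl⟩ := hR
    rw [ht.slice_tensor hτ]
    exact Submodule.smul_mem _ _ ha
  | zero => rw [map_zero]; exact zero_mem _
  | add x y _ _ hx hy => rw [map_add]; exact add_mem hx hy
  | smul c x _ hx => rw [map_smul]; exact Submodule.smul_mem _ c hx

theorem isSelfAdjoint_rankOne (e : C) : IsSelfAdjoint (InnerProductSpace.rankOne ℂ e e : B C) :=
  InnerProductSpace.adjoint_rankOne e e

theorem amp_flip_rankOne (ht : IsElemTensor t) (hτ : IsOpTensor t τ) (e f : C) (S : B G) :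
    hτ.flip.amp ht.flip (InnerProductSpace.rankOne ℂ f f) * S *
      hτ.flip.amp ht.flip (InnerProductSpace.rankOne ℂ e e) =
      τ (ht.slice f e S) (InnerProductSpace.rankOne ℂ f e) := by
  refine ht.ext_inner fun a c a' c' => ?_
  have hsa : IsSelfAdjoint (hτ.flip.amp ht.flip (InnerProductSpace.rankOne ℂ f f)) :=
    IsSelfAdjoint.map (isSelfAdjoint_rankOne f) _
  have h1 : ∀ (g : C) a c, hτ.flip.amp ht.flip (InnerProductSpace.rankOne ℂ g g) (t a c)
      = ⟪g, c⟫_ℂ • t a g := fun g a c => by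
    have := hτ.flip.amp_tensor ht.flip (InnerProductSpace.rankOne ℂ g g) c a
    simpa using this
  rw [mul_apply_eq_comp, mul_apply_eq_comp, ← ContinuousLinearMap.adjoint_inner_left,
    ← ContinuousLinearMap.star_eq_adjoint, hsa.star_eq, h1, h1, hτ]
  simp only [map_smul, InnerProductSpace.rankOne_apply, inner_smul_left, inner_smul_right, ht.1,
    ht.inner_slice, inner_conj_symm]
  ring

theorem cyc_one (e : C) : ∃ r : ℂ, cyc {1} e = r • InnerProductSpace.rankOne ℂ e e := by
  by_cases he : e = 0
  · refine ⟨0, ?_⟩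
    ext x
    rw [zero_smul]
    refine closureProj_eq_zero fun y hy => ?_
    have : (fun p : B C => p e) '' {1} = {0} := by simp [he]
    rw [this, Submodule.span_zero_singleton, Submodule.mem_bot] at hy
    rw [hy, inner_zero_left]
  have hne : (‖e‖ : ℂ) ^ 2 ≠ 0 := by simpa using he
  refine ⟨((‖e‖ : ℂ) ^ 2)⁻¹, ?_⟩
  set R : B C := ((‖e‖ : ℂ) ^ 2)⁻¹ • InnerProductSpace.rankOne ℂ e e with hR
  have h1 : R * cyc {1} e = 1 * cyc {1} e := by
    refine mul_cyc_congr fun p hp => ?_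
    rw [Set.mem_singleton_iff.1 hp]
    simp only [hR, smul_apply, InnerProductSpace.rankOne_apply, one_apply_eq_self,
      inner_self_eq_norm_sq_to_K, Complex.coe_algebraMap, smul_smul]
    erw [inv_mul_cancel₀ hne, one_smul]
  have h2 : cyc {1} e * R = R := by
    ext x
    simp only [hR, mul_apply_eq_comp, smul_apply, InnerProductSpace.rankOne_apply, map_smul]
    rw [cyc_apply_self (Set.mem_singleton 1)]
  have h3 : star R = R := by
    rw [hR, star_smul, (isSelfAdjoint_rankOne e).star_eq]
    congr 1
    simp
  have h4 := congrArg star h1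
  rw [one_mul, star_mul, (isStarProjection_cyc _ _).isSelfAdjoint.star_eq, h3, h2] at h4
  exact h4.symm

/-- Membership in the weak* closed span of `Y ⊗ B(C)` is detected by slices. -/
theorem mem_wsc_tensorSub_top [TopologicalSpace.SeparableSpace C] (ht : IsElemTensor t)
    (hτ : IsOpTensor t τ) {S : B G} :
    S ∈ wsc (tensorSub τ Y ⊤) ↔ ∀ c c', ht.slice c c' S ∈ wsc Y := by
  refine ⟨fun hS c c' => slice_mem_wsc ht hτ hS c c', fun h => ?_⟩
  obtain ⟨P, g, hP, hPp, hPt⟩ := exists_cyc_seq (𝒞 := ({1} : Set (B C))) rfl (by simp) (by simp)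
  have key : ∀ x, Tendsto (fun n => hτ.flip.amp ht.flip (P n) x) atTop (𝓝 x) := by
    refine tendsto_apply_of_dense (fun n => norm_starProjection_le ((hPp n).map _)) ht.flip.2 ?_
    rintro _ ⟨x, y, rfl⟩
    simp only [hτ.flip.amp_tensor ht.flip]
    exact ((ht.flip.ins y).continuous.tendsto x).comp (hPt x)
  refine mem_wsc_of_compress (fun n => (hPp n).map (hτ.flip.amp ht.flip))
    (fun n => (hPp n).map (hτ.flip.amp ht.flip)) key key fun n => ?_
  rw [hP, map_sum, Finset.sum_mul, Finset.sum_mul]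
  refine sum_mem fun i _ => ?_
  rw [Finset.mul_sum]
  refine sum_mem fun j _ => ?_
  obtain ⟨r, hr⟩ := cyc_one (g i)
  obtain ⟨s, hs⟩ := cyc_one (g j)
  rw [hr, hs, map_smul, map_smul, smul_mul_assoc, smul_mul_assoc, mul_smul_comm,
    amp_flip_rankOne ht hτ]
  refine Submodule.smul_mem _ _ (Submodule.smul_mem _ _ ?_)
  refine map_mem_wsc (τ.flip (InnerProductSpace.rankOne ℂ (g i) (g j)))
    (fun ω hω => hω.comp_left ht hτ _) (fun a ha => ?_) (h (g i) (g j))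
  exact le_wsc (Submodule.subset_span ⟨a, ha, _, trivial, rfl⟩)

end SliceTop

section Lift

variable {H K J C G : Type*} [NormedAddCommGroup H] [InnerProductSpace ℂ H] [CompleteSpace H]
  [NormedAddCommGroup K] [InnerProductSpace ℂ K] [CompleteSpace K]
  [NormedAddCommGroup J] [InnerProductSpace ℂ J] [CompleteSpace J]
  [NormedAddCommGroup C] [InnerProductSpace ℂ C] [CompleteSpace C]
  [NormedAddCommGroup G] [InnerProductSpace ℂ G] [CompleteSpace G]
  {t : H →ₗ[ℂ] K →ₗ[ℂ] J} {τ : B H →ₗ[ℂ] B K →ₗ[ℂ] B J}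
  {t' : J →ₗ[ℂ] C →ₗ[ℂ] G} {τ' : B J →ₗ[ℂ] B C →ₗ[ℂ] B G}

/-- The operators on `(H ⊗ K) ⊗ C` all of whose slices along `H` and `C` lie in the weak* closed
span of `V`. -/
def sliceSub (ht : IsElemTensor t) (ht' : IsElemTensor t') (V : Submodule ℂ (B K)) :
    Submodule ℂ (B G) where
  carrier := {S | ∀ h h' l l', ht.flip.slice h h' (ht'.slice l l' S) ∈ wsc V}
  add_mem' hS hT h h' l l' := by
    rw [map_add, map_add]
    exact add_mem (hS h h' l l') (hT h h' l l')
  zero_mem' h h' l l' := by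
    rw [map_zero, map_zero]
    exact zero_mem _
  smul_mem' c S hS h h' l l' := by
    rw [map_smul, map_smul]
    exact Submodule.smul_mem _ _ (hS h h' l l')

theorem wsc_sliceSub (ht : IsElemTensor t) (ht' : IsElemTensor t') (V : Submodule ℂ (B K)) :
    wsc (sliceSub ht ht' V) = sliceSub ht ht' V := by
  refine le_antisymm (fun S hS h h' l l' => ?_) le_wsc
  exact map_mem_wsc (Y := sliceSub ht ht' V) (Z := V) (ht.flip.slice h h' ∘ₗ ht'.slice l l')
    (fun _ hω => (hω.comp_sandwich _ _).comp_sandwich _ _) (fun R hR => hR h h' l l') hS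

theorem slice_flip_amp (ht : IsElemTensor t) (hτ : IsOpTensor t τ) (h h' : H) (a b : B H)
    (S : B J) : ht.flip.slice h h' (hτ.amp ht a * S * hτ.amp ht b) =
      ht.flip.slice (star a h) (b h') S := by
  ext x
  refine ext_inner_left ℂ fun y => ?_
  have h1 : ⟪t h y, hτ.amp ht a (S (t (b h') x))⟫_ℂ = ⟪t (star a h) y, S (t (b h') x)⟫_ℂ := by
    rw [← ContinuousLinearMap.adjoint_inner_left, ← ContinuousLinearMap.star_eq_adjoint, ← map_star,
      hτ.amp_tensor ht]
  rw [ht.flip.inner_slice, ht.flip.inner_slice]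
  simpa only [LinearMap.flip_apply, mul_apply_eq_comp, hτ.amp_tensor ht] using h1

/-- The representation `a ↦ (a ⊗ 1) ⊗ 1`. -/
def amp₂ (ht : IsElemTensor t) (hτ : IsOpTensor t τ) (ht' : IsElemTensor t')
    (hτ' : IsOpTensor t' τ') : B H →⋆ₐ[ℂ] B G :=
  (hτ'.amp ht').comp (hτ.amp ht)

theorem amp₂_apply (ht : IsElemTensor t) (hτ : IsOpTensor t τ) (ht' : IsElemTensor t')
    (hτ' : IsOpTensor t' τ') (a : B H) : amp₂ ht hτ ht' hτ' a = hτ'.amp ht' (hτ.amp ht a) := rfl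

theorem sliceSub_bimodule (ht : IsElemTensor t) (hτ : IsOpTensor t τ) (ht' : IsElemTensor t')
    (hτ' : IsOpTensor t' τ') {V : Submodule ℂ (B K)} (a b : B H) {S : B G}
    (hS : S ∈ sliceSub ht ht' V) :
    amp₂ ht hτ ht' hτ' a * S * amp₂ ht hτ ht' hτ' b ∈ sliceSub ht ht' V := by
  intro h h' l l'
  rw [amp₂_apply, amp₂_apply, ht'.slice_mul_amp hτ', ht'.slice_amp_mul hτ', slice_flip_amp ht hτ]
  exact hS _ _ _ _

variable {ι : Type*} {D : StarSubalgebra ℂ (B H)}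

/-- The span of the `M i ⊗ U i`. -/
def sumSpan (τ : B H →ₗ[ℂ] B K →ₗ[ℂ] B J) (M : ι → Submodule ℂ (B H))
    (U : ι → Submodule ℂ (B K)) : Submodule ℂ (B J) :=
  Submodule.span ℂ {z : B J | ∃ i, ∃ a ∈ (M i : Set (B H)), ∃ c ∈ U i, z = τ a c}

theorem mem_of_intertwine [TopologicalSpace.SeparableSpace H] [TopologicalSpace.SeparableSpace C]
    {M : ι → Submodule ℂ (B H)} {U : ι → Submodule ℂ (B K)}
    (hD : IsMasa D) (hbim : ∀ i, IsBimodule D (M i)) (hter : ∀ i, IsTernary (M i))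
    (hcl : ∀ i, wsc (M i) = M i) (ht : IsElemTensor t) (hτ : IsOpTensor t τ)
    (ht' : IsElemTensor t') (hτ' : IsOpTensor t' τ') (E : Finset ι) {S : B G}
    (hS : ∀ i ∈ E, ∀ s ∈ pairs D (M i),
      amp₂ ht hτ ht' hτ' s.2 * S = S * amp₂ ht hτ ht' hτ' s.1)
    (hX : S ∈ sliceSub ht ht' (⨆ i ∈ E, U i)) : S ∈ wsc (tensorSub τ' (sumSpan τ M U) ⊤) := by
  refine (mem_wsc_tensorSub_top ht' hτ').2 fun l l' => ?_
  set R := ht'.slice l l' S with hR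
  have hRi : ∀ i ∈ E, ∀ s ∈ pairs D (M i), hτ.amp ht s.2 * R = R * hτ.amp ht s.1 := by
    intro i hi s hs
    rw [hR, ← ht'.slice_amp_mul hτ', ← ht'.slice_mul_amp hτ']
    exact congrArg _ (hS i hi s hs)
  set N : Submodule ℂ (B H) := ⨅ i ∈ E, M i with hN
  have hNle : ∀ i ∈ E, N ≤ M i := fun i hi => iInf₂_le i hi
  have hmem : ∀ {a : B H}, (∀ i ∈ E, a ∈ M i) → a ∈ N := fun {a} h => by
    simpa only [hN, Submodule.mem_iInf] using h
  have hNbim : IsBimodule D N := fun a ha b hb T hT =>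
    hmem fun i hi => hbim i a ha b hb T (hNle i hi hT)
  have hNter : IsTernary N := fun a ha b hb c hc =>
    hmem fun i hi => hter i a (hNle i hi ha) b (hNle i hi hb) c (hNle i hi hc)
  have hNcl : wsc N = N := by
    refine le_antisymm (fun a ha => hmem fun i hi => ?_) le_wsc
    rw [← hcl i]
    exact wsc_mono (hNle i hi) ha
  have hRN : ∀ s ∈ pairs D N, hτ.amp ht s.2 * R = R * hτ.amp ht s.1 := by
    intro s hs
    refine ht.ext_slice fun k k' => ?_
    have : ht.slice k k' R ∈ N := hmem fun i hi =>
      mem_of_pairs hD (hbim i) (hter i) (hcl i) fun s hs => by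
        rw [← ht.slice_amp_mul hτ, ← ht.slice_mul_amp hτ, hRi i hi s hs]
    rw [ht.slice_amp_mul hτ, ht.slice_mul_amp hτ]
    exact hs.2.2 _ this
  have h1 : R ∈ wsc (tensorSub τ N (⨆ i ∈ E, U i)) :=
    mem_of_slices hD hNbim hNter hNcl ht hτ hRN fun h h' => hX h h' l l'
  refine wsc_mono (Submodule.span_le.2 ?_) h1
  rintro _ ⟨a, ha, c, hc, rfl⟩
  have h2 : (⨆ i ∈ E, U i) ≤ (sumSpan τ M U).comap (τ a) :=
    iSup₂_le fun i hi c hc => Submodule.subset_span ⟨i, a, hNle i hi ha, c, hc, rfl⟩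
  exact h2 hc

end Lift

section HyperBound

variable {G G' : Type*} [NormedAddCommGroup G] [InnerProductSpace ℂ G]
  [NormedAddCommGroup G'] [InnerProductSpace ℂ G']

/-- `T` is bounded by `c` on the rank one operators annihilating `X`. -/
def BoundOn (X : Submodule ℂ (B G)) (T : B G) (c : ℝ) : Prop :=
  ∀ x y, (∀ S ∈ X, ⟪y, S x⟫_ℂ = 0) → ‖⟪y, T x⟫_ℂ‖ ≤ c * ‖x‖ * ‖y‖

/-- The hyperreflexivity of `X`, tested against rank one annihilators. -/
def HyperBound (X : Submodule ℂ (B G)) : Prop :=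
  ∃ k > 0, ∀ (T : B G) (c : ℝ), 0 ≤ c → BoundOn X T c → ∀ ε > 0, ∃ S ∈ X, ‖T - S‖ ≤ k * c + ε

theorem iInf_norm_le (X : Submodule ℂ (B G)) (T : B G) (x : G) (S : B G) (hS : S ∈ X) :
    ⨅ R : (X : Set (B G)), ‖T x - R.1 x‖ ≤ ‖T x - S x‖ :=
  ciInf_le (f := fun R : (X : Set (B G)) => ‖T x - R.1 x‖)
    ⟨0, by rintro _ ⟨R, rfl⟩; exact norm_nonneg _⟩ ⟨S, hS⟩

theorem iInf_norm_le_arveson (X : Submodule ℂ (B G)) (T : B G) (x : G) (hx : ‖x‖ = 1) :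
    ⨅ R : (X : Set (B G)), ‖T x - R.1 x‖ ≤ arveson T X := by
  refine le_ciSup (f := fun ξ : {ξ : G // ‖ξ‖ = 1} => ⨅ R : (X : Set (B G)), ‖T ξ.1 - R.1 ξ.1‖)
    ⟨‖T‖, ?_⟩ ⟨x, hx⟩
  rintro _ ⟨ξ, rfl⟩
  refine (iInf_norm_le X T ξ.1 0 (zero_mem _)).trans ?_
  simpa [ξ.2] using T.le_opNorm ξ.1

theorem boundOn_arveson (X : Submodule ℂ (B G)) (T : B G) : BoundOn X T (arveson T X) := by
  intro x y h
  rcases eq_or_ne x 0 with rfl | hx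
  · simp
  rcases eq_or_ne y 0 with rfl | hy
  · simp
  have hx' : 0 < ‖x‖ := norm_pos_iff.2 hx
  have hy' : 0 < ‖y‖ := norm_pos_iff.2 hy
  have hu : ‖((‖x‖⁻¹ : ℝ) : ℂ) • x‖ = 1 := by
    rw [norm_smul, Complex.norm_real, norm_inv, norm_norm, inv_mul_cancel₀ hx'.ne']
  have h1 : ‖⟪y, T x⟫_ℂ‖ / (‖x‖ * ‖y‖) ≤ arveson T X := by
    refine le_trans (le_ciInf fun R => ?_) (iInf_norm_le_arveson X T _ hu)
    rw [map_smul, map_smul, ← smul_sub, norm_smul, Complex.norm_real, norm_inv, norm_norm,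
      div_le_iff₀ (by positivity)]
    have h2 : ⟪y, T x⟫_ℂ = ⟪y, T x - R.1 x⟫_ℂ := by rw [inner_sub_right, h R.1 R.2, sub_zero]
    rw [h2]
    refine (norm_inner_le_norm _ _).trans (le_of_eq ?_)
    field_simp
  rw [div_le_iff₀ (by positivity)] at h1
  linarith

theorem arveson_nonneg (X : Submodule ℂ (B G)) (T : B G) : 0 ≤ arveson T X :=
  Real.iSup_nonneg fun _ => Real.iInf_nonneg fun _ => norm_nonneg _

theorem arveson_le [CompleteSpace G] {X : Submodule ℂ (B G)} {T : B G} {c : ℝ} (hc : 0 ≤ c)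
    (h : BoundOn X T c) : arveson T X ≤ c := by
  refine Real.iSup_le (fun ξ => le_of_forall_pos_le_add fun ε hε => ?_) hc
  set L : Submodule ℂ G := X.map (ContinuousLinearMap.apply ℂ G ξ.1).toLinearMap with hL
  set p := closureProj L (T ξ.1) with hp
  have hp' : p ∈ closure (L : Set G) := closureProj_mem _
  have h1 : ‖T ξ.1 - p‖ ≤ c := by
    have ho : ∀ z ∈ L, ⟪T ξ.1 - p, z⟫_ℂ = 0 := by
      intro z hz
      rw [inner_sub_left, hp, inner_starProjection_left isStarProjection_closureProj,
        closureProj_eq_self hz, sub_self]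
    have h0 : ⟪T ξ.1 - p, p⟫_ℂ = 0 := by
      rw [inner_sub_left, hp, inner_starProjection isStarProjection_closureProj, sub_self]
    have h2 := h ξ.1 (T ξ.1 - p) fun S hS => ho _ ⟨S, hS, rfl⟩
    have h3 : ⟪T ξ.1 - p, T ξ.1⟫_ℂ = ⟪T ξ.1 - p, T ξ.1 - p⟫_ℂ := by
      rw [inner_sub_right _ _ p, h0, sub_zero]
    rw [h3, inner_self_eq_norm_sq_to_K, ξ.2, mul_one] at h2
    simp only [Complex.coe_algebraMap, norm_pow, Complex.norm_real, norm_norm] at h2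
    rcases (norm_nonneg (T ξ.1 - p)).eq_or_lt with h4 | h4
    · rw [← h4]; exact hc
    · nlinarith
  obtain ⟨_, ⟨S, hS, rfl⟩, hd⟩ := Metric.mem_closure_iff.1 hp' ε hε
  refine (iInf_norm_le X T ξ.1 S hS).trans ?_
  rw [dist_eq_norm] at hd
  calc ‖T ξ.1 - S ξ.1‖ ≤ ‖T ξ.1 - p‖ + ‖p - S ξ.1‖ := norm_sub_le_norm_sub_add_norm_sub _ _ _
    _ ≤ c + ε := add_le_add h1 hd.le

theorem hyperreflexive_iff [CompleteSpace G] {X : Submodule ℂ (B G)} :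
    Hyperreflexive (X : Set (B G)) ↔ HyperBound X := by
  constructor
  · rintro ⟨k, hk, h⟩
    refine ⟨k, hk, fun T c hc hT ε hε => ?_⟩
    have h1 : Metric.infDist T (X : Set (B G)) < k * c + ε :=
      ((h T).trans (mul_le_mul_of_nonneg_left (arveson_le hc hT) hk.le)).trans_lt (by linarith)
    obtain ⟨S, hS, hd⟩ := (Metric.infDist_lt_iff ⟨0, zero_mem X⟩).1 h1
    exact ⟨S, hS, by rw [← dist_eq_norm]; exact hd.le⟩
  · rintro ⟨k, hk, h⟩
    refine ⟨k, hk, fun T => le_of_forall_pos_le_add fun ε hε => ?_⟩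
    obtain ⟨S, hS, hd⟩ := h T _ (arveson_nonneg X T) (boundOn_arveson X T) ε hε
    rw [← dist_eq_norm] at hd
    exact (Metric.infDist_le_dist_of_mem hS).trans hd

/-- Transport of `HyperBound` along a unitary. -/
theorem HyperBound.of_unitary {X : Submodule ℂ (B G)} {X' : Submodule ℂ (B G')} (V : G ≃ₗᵢ[ℂ] G')
    (hX : ∀ S : B G, S ∈ X ↔
      (V : G →L[ℂ] G') ∘L S ∘L (V.symm : G' →L[ℂ] G) ∈ X') (h : HyperBound X') :
    HyperBound X := by
  obtain ⟨k, hk, h⟩ := h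
  refine ⟨k, hk, fun T c hc hT ε hε => ?_⟩
  have hT' : BoundOn X' ((V : G →L[ℂ] G') ∘L T ∘L (V.symm : G' →L[ℂ] G)) c := by
    intro x y hxy
    have := hT (V.symm x) (V.symm y) fun S hS => by
      rw [← hxy _ ((hX S).1 hS)]
      simp [V.symm.inner_map_eq_flip]
    simpa [V.symm.inner_map_eq_flip] using this
  obtain ⟨S', hS', hd⟩ := h _ c hc hT' ε hε
  have e : (V : G →L[ℂ] G') ∘L ((V.symm : G' →L[ℂ] G) ∘L S' ∘L (V : G →L[ℂ] G')) ∘L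
      (V.symm : G' →L[ℂ] G) = S' := by ext; simp
  refine ⟨(V.symm : G' →L[ℂ] G) ∘L S' ∘L (V : G →L[ℂ] G'), (hX _).2 (by rwa [e]), ?_⟩
  refine ContinuousLinearMap.opNorm_le_bound _ (by positivity) fun x => ?_
  have := (((V : G →L[ℂ] G') ∘L T ∘L (V.symm : G' →L[ℂ] G)) - S').le_of_opNorm_le hd (V x)
  rw [V.norm_map] at this
  refine le_trans (le_of_eq ?_) this
  rw [← V.norm_map]
  simp

end HyperBound

section Basis

variable {A C G : Type*} [NormedAddCommGroup A] [InnerProductSpace ℂ A] [CompleteSpace A]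
  [NormedAddCommGroup C] [InnerProductSpace ℂ C]
  [NormedAddCommGroup G] [InnerProductSpace ℂ G] [CompleteSpace G]
  {t : A →ₗ[ℂ] C →ₗ[ℂ] G} {Y : Submodule ℂ (B A)}

theorem isClosed_wsc {E : Type*} [NormedAddCommGroup E] [InnerProductSpace ℂ E]
    (Y : Submodule ℂ (B E)) : IsClosed (wsc Y : Set (B E)) := by
  refine isSeqClosed_iff_isClosed.1 fun f a hf ha => ?_
  obtain ⟨k, hk⟩ := ha.norm.bddAbove_range
  refine mem_wsc_of_tendsto (𝓕 := atTop) (C := k) (fun n => hk ⟨n, rfl⟩) (fun x y => ?_) hf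
  have : Continuous fun S : B E => ⟪y, S x⟫_ℂ := by fun_prop
  exact (this.tendsto a).comp ha

theorem IsElemTensor.norm_slice_le (ht : IsElemTensor t) (c c' : C) (S : B G) :
    ‖ht.slice c c' S‖ ≤ ‖S‖ * ‖c‖ * ‖c'‖ := by
  refine norm_le_of_inner_le (by positivity) fun x y => ?_
  rw [ht.inner_slice]
  refine (norm_inner_apply_le _ _ _).trans (le_of_eq ?_)
  rw [ht.norm_apply, ht.norm_apply]
  ring

theorem mem_of_basis {ι E : Type*} [NormedAddCommGroup E] [InnerProductSpace ℂ E]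
    {Y : Submodule ℂ (B E)} (b : HilbertBasis ι ℂ C) (f : C →+ B E) {k : ℝ}
    (hf : ∀ c, ‖f c‖ ≤ k * ‖c‖) (hsmul : ∀ (r : ℂ) c, ∃ s : ℂ, f (r • c) = s • f c)
    (h : ∀ i, f (b i) ∈ wsc Y) (c : C) : f c ∈ wsc Y := by
  have hc : c ∈ (Submodule.span ℂ (Set.range b)).topologicalClosure := by
    rw [b.dense_span]; trivial
  have hcont : Continuous f := AddMonoidHomClass.continuous_of_bound f k hf
  refine closure_minimal (s := (Submodule.span ℂ (Set.range b) : Set C)) (fun c hc => ?_)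
    ((isClosed_wsc Y).preimage hcont) hc
  change f c ∈ wsc Y
  induction hc using Submodule.span_induction with
  | mem x hx => obtain ⟨i, rfl⟩ := hx; exact h i
  | zero => rw [map_zero]; exact zero_mem _
  | add x y _ _ hx hy => rw [map_add]; exact add_mem hx hy
  | smul r x _ hx =>
    obtain ⟨s, hs⟩ := hsmul r x
    rw [hs]
    exact Submodule.smul_mem _ _ hx

theorem slice_mem_iff_basis {ι : Type*} (ht : IsElemTensor t) (b : HilbertBasis ι ℂ C) {S : B G} :
    (∀ c c', ht.slice c c' S ∈ wsc Y) ↔ ∀ i j, ht.slice (b i) (b j) S ∈ wsc Y := by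
  refine ⟨fun h i j => h _ _, fun h => ?_⟩
  have ext2 : ∀ {R R' : B A}, (∀ a a', ⟪a', R a⟫_ℂ = ⟪a', R' a⟫_ℂ) → R = R' := fun {R R'} h =>
    ContinuousLinearMap.ext fun a => ext_inner_left ℂ fun a' => h a a'
  have hadd : ∀ c c₁ c₂, ht.slice c (c₁ + c₂) S = ht.slice c c₁ S + ht.slice c c₂ S := by
    refine fun c c₁ c₂ => ext2 fun a a' => ?_
    simp only [add_apply, inner_add_right, ht.inner_slice, map_add]
  have hadd' : ∀ c c₁ c₂, ht.slice (c₁ + c₂) c S = ht.slice c₁ c S + ht.slice c₂ c S := by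
    refine fun c c₁ c₂ => ext2 fun a a' => ?_
    simp only [add_apply, inner_add_right, inner_add_left, ht.inner_slice, map_add]
  have h1 : ∀ i c', ht.slice (b i) c' S ∈ wsc Y := fun i =>
    mem_of_basis b (AddMonoidHom.mk' (fun c => ht.slice (b i) c S) (hadd (b i)))
      (fun c => ht.norm_slice_le (b i) c S)
      (fun r c => ⟨r, ext2 fun a a' => by
        simp only [AddMonoidHom.mk'_apply, smul_apply, inner_smul_right, ht.inner_slice,
          map_smul]⟩) (h i)
  exact fun c c' => mem_of_basis b (AddMonoidHom.mk' (fun c => ht.slice c c' S) (hadd' c'))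
      (k := ‖S‖ * ‖c'‖) (fun c => (ht.norm_slice_le c c' S).trans (le_of_eq (by ring)))
      (fun r c => ⟨starRingEnd ℂ r, ext2 fun a a' => by
        simp only [AddMonoidHom.mk'_apply, smul_apply, inner_smul_right, inner_smul_left,
          ht.inner_slice, map_smul]⟩) (fun i => h1 i c') c

end Basis

section Reassociate

variable {H K J G : Type*} [NormedAddCommGroup H] [InnerProductSpace ℂ H] [CompleteSpace H]
  [NormedAddCommGroup K] [InnerProductSpace ℂ K] [CompleteSpace K]
  [NormedAddCommGroup J] [InnerProductSpace ℂ J] [CompleteSpace J]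
  [NormedAddCommGroup G] [InnerProductSpace ℂ G] [CompleteSpace G]
  {t : H →ₗ[ℂ] K →ₗ[ℂ] J} {τ : B H →ₗ[ℂ] B K →ₗ[ℂ] B J}
  {t' : J →ₗ[ℂ] ell2 →ₗ[ℂ] G}

theorem mem_sliceSub_iff [TopologicalSpace.SeparableSpace H] (ht : IsElemTensor t)
    (hτ : IsOpTensor t τ) (ht' : IsElemTensor t') {ρ : Type*} (g : HilbertBasis ρ ℂ H)
    {V : Submodule ℂ (B K)} {S : B G} : S ∈ sliceSub ht ht' V ↔ ∀ p q : ρ × ℕ,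
      ht.flip.slice (g p.1) (g q.1) (ht'.slice (stdBasis p.2) (stdBasis q.2) S) ∈ wsc V := by
  refine ⟨fun h p q => h _ _ _ _, fun h => ?_⟩
  have h1 : ∀ l l', ht'.slice l l' S ∈ wsc (tensorSub τ.flip V ⊤) := by
    refine (slice_mem_iff_basis ht' stdBasis).2 fun n n' => ?_
    rw [mem_wsc_tensorSub_top ht.flip hτ.flip, slice_mem_iff_basis ht.flip g]
    exact fun r r' => h (r, n) (r', n')
  exact fun k k' l l' => (mem_wsc_tensorSub_top ht.flip hτ.flip).1 (h1 l l') k k'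

/-- `(H ⊗ K) ⊗ ℓ²` is a copy of `K ⊗ ℓ²` if `H` is separable and nonzero. -/
theorem exists_reassociate (ht : IsElemTensor t) (ht' : IsElemTensor t') {ρ : Type*}
    (g : HilbertBasis ρ ℂ H) (σ : ℕ ≃ ρ × ℕ) : ∃ t₁ : K →ₗ[ℂ] ell2 →ₗ[ℂ] G, IsElemTensor t₁ ∧
      ∀ k n, t₁ k (stdBasis n) = t' (t (g (σ n).1) k) (stdBasis (σ n).2) := by
  classical
  let j : ℕ → K →ₗᵢ[ℂ] G := fun n =>
    (ht'.insIsometry (stdBasis.orthonormal.1 (σ n).2)).comp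
      (ht.flip.insIsometry (g.orthonormal.1 (σ n).1))
  have hj : ∀ n k, j n k = t' (t (g (σ n).1) k) (stdBasis (σ n).2) := fun n k => rfl
  have hsum : IsHilbertSum ℂ (fun _ : ℕ => K) j := by
    refine IsHilbertSum.mk (fun m n hmn k k' => ?_) (le_of_eq ?_)
    · rw [hj, hj, ht'.1, ht.1]
      by_cases h1 : (σ m).1 = (σ n).1
      · have h2 : (σ m).2 ≠ (σ n).2 := fun h2 => hmn (σ.injective (Prod.ext h1 h2))
        rw [stdBasis.orthonormal.2 h2, mul_zero]
      · rw [g.orthonormal.2 h1, zero_mul, zero_mul]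
    · refine (Submodule.topologicalClosure_eq_top_iff.2 ?_).symm
      refine (Submodule.eq_bot_iff _).2 fun v hv => ?_
      rw [Submodule.mem_orthogonal] at hv
      have h1 : ∀ r n k, ⟪t' (t (g r) k) (stdBasis n), v⟫_ℂ = 0 := fun r n k => by
        obtain ⟨m, hm⟩ := σ.surjective (r, n)
        have := hv (j m k) (Submodule.mem_iSup_of_mem m ⟨k, rfl⟩)
        rwa [hj, hm] at this
      refine (ht'.decomp stdBasis).injective ?_
      rw [map_zero]
      ext1
      funext n
      refine (ht.flip.decomp g).injective ?_
      rw [lp.coeFn_zero, Pi.zero_apply, map_zero]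
      ext1
      funext r
      refine ext_inner_left ℂ fun k => ?_
      rw [ht.flip.inner_decomp_apply, ht'.inner_decomp_apply, lp.coeFn_zero, Pi.zero_apply,
        inner_zero_right]
      exact h1 r n k
  refine ⟨_, isElemTensor_stdTensor.trans hsum.linearIsometryEquiv.symm, fun k n => ?_⟩
  rw [← hj, ← hsum.linearIsometryEquiv_symm_apply_single]
  refine congrArg hsum.linearIsometryEquiv.symm ?_
  ext m
  have hb : (stdBasis n : ell2) = lp.single 2 n (1 : ℂ) := (stdBasis.repr_self n)
  rw [stdTensor_apply, hb]
  by_cases h : m = n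
  · subst h; simp
  · simp [h]

end Reassociate

section Transport

universe w

theorem wStarClosure_tensorSpan {A C G : Type*} [NormedAddCommGroup A] [InnerProductSpace ℂ A]
    [NormedAddCommGroup C] [InnerProductSpace ℂ C]
    [NormedAddCommGroup G] [InnerProductSpace ℂ G]
    (τ : B A →ₗ[ℂ] B C →ₗ[ℂ] B G) (Y : Submodule ℂ (B A)) :
    wStarClosure G (tensorSpan τ (wStarClosure A (Y : Set (B A))) Set.univ) =
      (wsc (tensorSub τ (wsc Y) ⊤) : Set (B G)) := by
  rw [coe_wsc, ← coe_wsc (Y := Y)]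
  rfl

theorem IsElemTensor.separableSpace {A C G : Type*} [NormedAddCommGroup A] [InnerProductSpace ℂ A]
    [NormedAddCommGroup C] [InnerProductSpace ℂ C]
    [NormedAddCommGroup G] [InnerProductSpace ℂ G] {t : A →ₗ[ℂ] C →ₗ[ℂ] G} (ht : IsElemTensor t)
    [TopologicalSpace.SeparableSpace A] [TopologicalSpace.SeparableSpace C] :
    TopologicalSpace.SeparableSpace G := by
  let m := LinearMap.mkContinuous₂ t 1 fun a c => by rw [ht.norm_apply, one_mul]
  have hr : Continuous fun p : A × C => t p.1 p.2 :=
    (isBoundedBilinearMap_apply.continuous.comp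
      ((m.continuous.comp continuous_fst).prodMk continuous_snd) :)
  have h1 : {z : G | ∃ x y, z = t x y} = Set.range fun p : A × C => t p.1 p.2 := by
    ext z
    simp [eq_comm]
  have h2 := ((TopologicalSpace.isSeparable_range hr).span (R := ℂ)).closure
  rw [← h1, ht.2.closure_eq] at h2
  exact TopologicalSpace.isSeparable_univ_iff.1 h2

theorem exists_unitary_lp (G : Type*) [NormedAddCommGroup G] [InnerProductSpace ℂ G]
    [CompleteSpace G] [TopologicalSpace.SeparableSpace G] :
    ∃ s : Set ℕ, Nonempty (G ≃ₗᵢ[ℂ] lp (fun _ : ULift.{w} s => ℂ) 2) := by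
  obtain ⟨v, b, -⟩ := exists_hilbertBasis ℂ G
  have := b.countable
  obtain ⟨f, hf⟩ := exists_injective_nat v
  let e : ULift.{w} (Set.range f) ≃ v := Equiv.ulift.trans (Equiv.ofInjective f hf).symm
  refine ⟨Set.range f, ⟨(HilbertBasis.mk (b.orthonormal.comp e e.injective) ?_).repr⟩⟩
  rw [EquivLike.range_comp b e, b.dense_span]

variable {H K J G : Type*} [NormedAddCommGroup H] [InnerProductSpace ℂ H] [CompleteSpace H]
  [NormedAddCommGroup K] [InnerProductSpace ℂ K] [CompleteSpace K]
  [NormedAddCommGroup J] [InnerProductSpace ℂ J] [CompleteSpace J]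
  [NormedAddCommGroup G] [InnerProductSpace ℂ G] [CompleteSpace G]
  {t : H →ₗ[ℂ] K →ₗ[ℂ] J} {τ : B H →ₗ[ℂ] B K →ₗ[ℂ] B J}
  {t' : J →ₗ[ℂ] ell2 →ₗ[ℂ] G}

theorem hyperBound_sliceSub [TopologicalSpace.SeparableSpace H] [TopologicalSpace.SeparableSpace K]
    (ht : IsElemTensor t) (hτ : IsOpTensor t τ) (ht' : IsElemTensor t') {V : Submodule ℂ (B K)}
    (hV : CompletelyHyperreflexive.{_, w} (wStarClosure K (V : Set (B K)))) :
    HyperBound (sliceSub ht ht' V) := by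
  obtain ⟨v, g, -⟩ := exists_hilbertBasis ℂ H
  have := g.countable
  rcases isEmpty_or_nonempty v with hv | hv
  · refine ⟨1, one_pos, fun T c hc _ ε hε =>
      ⟨T, (mem_sliceSub_iff ht hτ ht' g).2 fun p => (hv.false p.1).elim, ?_⟩⟩
    rw [sub_self, norm_zero]
    positivity
  obtain ⟨σ⟩ : Nonempty (ℕ ≃ v × ℕ) :=
    (nonempty_denumerable (v × ℕ)).map fun h => (h.eqv _).symm
  obtain ⟨t₁, ht₁, ht₁b⟩ := exists_reassociate ht ht' g σ
  have := ht₁.separableSpace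
  obtain ⟨s, ⟨u⟩⟩ := exists_unitary_lp.{w} G
  have ht₂ := ht₁.trans u
  obtain ⟨τ₂, hτ₂⟩ := ht₂.exists_opTensor
  have h := hV _ _ τ₂ ht₂ hτ₂
  rw [wStarClosure_tensorSpan, hyperreflexive_iff] at h
  refine HyperBound.of_unitary u (fun S => ?_) h
  rw [mem_wsc_tensorSub_top ht₂ hτ₂, wsc_idem, slice_mem_iff_basis ht₂ stdBasis,
    mem_sliceSub_iff ht hτ ht' g]
  have key : ∀ m n, ht₂.slice (stdBasis m) (stdBasis n)
      ((u : G →L[ℂ] lp (fun _ : ULift.{w} s => ℂ) 2) ∘L S ∘L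
        (u.symm : lp (fun _ : ULift.{w} s => ℂ) 2 →L[ℂ] G)) =
      ht.flip.slice (g (σ m).1) (g (σ n).1)
        (ht'.slice (stdBasis (σ m).2) (stdBasis (σ n).2) S) := by
    intro m n
    ext x
    refine ext_inner_left ℂ fun y => ?_
    rw [ht₂.inner_slice, ht.flip.inner_slice, LinearMap.flip_apply, LinearMap.flip_apply,
      ht'.inner_slice, ← ht₁b, ← ht₁b]
    simp
  simp only [key]
  refine ⟨fun h m n => h _ _, fun h p q => ?_⟩
  have := h (σ.symm p) (σ.symm q)
  rwa [σ.apply_symm_apply, σ.apply_symm_apply] at this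

end Transport

theorem exists_intertwine_approx {H G ι : Type*} [NormedAddCommGroup H] [InnerProductSpace ℂ H]
    [CompleteSpace H] [NormedAddCommGroup G] [InnerProductSpace ℂ G] [CompleteSpace G]
    [DecidableEq ι] {D : StarSubalgebra ℂ (B H)} (hD : IsMasa D) (M : ι → Submodule ℂ (B H))
    {π : B H →⋆ₐ[ℂ] B G} {X : Submodule ℂ (B G)} (hX : wsc X = X)
    (hbim : ∀ a ∈ D, ∀ b ∈ D, ∀ T ∈ X, π a * T * π b ∈ X) (E : Finset ι) {T S : B G}
    (hT : ∀ i ∈ E, ∀ s ∈ pairs D (M i), π s.2 * T = T * π s.1) (hS : S ∈ X) :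
    ∃ S' ∈ X, (∀ i ∈ E, ∀ s ∈ pairs D (M i), π s.2 * S' = S' * π s.1) ∧
      ‖T - S'‖ ≤ 5 ^ E.card * ‖T - S‖ := by
  induction E using Finset.induction_on with
  | empty => exact ⟨S, hS, by simp, by simp⟩
  | insert i E hi ih =>
    obtain ⟨S', hS', h1, h2⟩ := ih fun j hj => hT j (Finset.mem_insert_of_mem hj)
    refine ⟨pinchLim (M i) π hD S', pinchLim_mem hD hX hbim hS', fun j hj => ?_, ?_⟩
    · rcases Finset.mem_insert.1 hj with rfl | hj
      · exact fun s hs => pinchLim_intertwine hD S' hs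
      · exact pinchLim_preserves hD (h1 j hj)
    · have h3 : T - pinchLim (M i) π hD S' = pinchLim (M i) π hD (T - S') := by
        rw [pinchLim_sub, pinchLim_eq_self hD (hT i (Finset.mem_insert_self _ _))]
      rw [h3, Finset.card_insert_of_notMem hi, pow_succ']
      exact (norm_pinchLim_le hD _).trans (by linarith)

section Main

variable {H K J C G : Type*} [NormedAddCommGroup H] [InnerProductSpace ℂ H] [CompleteSpace H]
  [NormedAddCommGroup K] [InnerProductSpace ℂ K] [CompleteSpace K]
  [NormedAddCommGroup J] [InnerProductSpace ℂ J] [CompleteSpace J]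
  [NormedAddCommGroup C] [InnerProductSpace ℂ C] [CompleteSpace C]
  [NormedAddCommGroup G] [InnerProductSpace ℂ G] [CompleteSpace G]
  {t : H →ₗ[ℂ] K →ₗ[ℂ] J} {τ : B H →ₗ[ℂ] B K →ₗ[ℂ] B J}
  {t' : J →ₗ[ℂ] C →ₗ[ℂ] G} {τ' : B J →ₗ[ℂ] B C →ₗ[ℂ] B G}
  {ι : Type*} {D : StarSubalgebra ℂ (B H)}
  {M : ι → Submodule ℂ (B H)} {U : ι → Submodule ℂ (B K)}

theorem hyperBound_sliceSub_bot (ht : IsElemTensor t) (ht' : IsElemTensor t') :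
    HyperBound (sliceSub ht ht' (⊥ : Submodule ℂ (B K))) := by
  have h0 : wsc (⊥ : Submodule ℂ (B K)) = ⊥ := by
    refine (Submodule.eq_bot_iff _).2 fun S hS => ?_
    ext x
    refine ext_inner_left ℂ fun y => ?_
    rw [zero_apply, inner_zero_right]
    exact hS _ (isNormalFunctional_vectorFunctional x y) fun R hR => by
      rw [(Submodule.mem_bot ℂ).1 hR, map_zero]
  refine ⟨1, one_pos, fun T c hc hT ε hε => ⟨0, zero_mem _, ?_⟩⟩
  rw [sub_zero, one_mul]
  refine (norm_le_of_inner_le hc fun x y => hT x y fun S hS => ?_).trans (by linarith)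
  have : S = 0 := by
    refine ht'.ext_slice fun l l' => ht.flip.ext_slice fun h h' => ?_
    have := hS h h' l l'
    rw [h0, Submodule.mem_bot] at this
    rw [this, map_zero, map_zero]
  rw [this, zero_apply, inner_zero_right]

/-- A corner which kills `M i` for all `i` outside `E` maps the weak* closed span of the
`M i ⊗ U i` into the operators with slices in the span of the `U i`, `i ∈ E`. -/
theorem corner_mem_sliceSub (ht : IsElemTensor t) (hτ : IsOpTensor t τ) (ht' : IsElemTensor t')
    (hτ' : IsOpTensor t' τ') (E : Finset ι) {a b : B H}
    (hab : ∀ i ∉ E, ∀ m ∈ M i, a * m * b = 0) {S : B G}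
    (hS : S ∈ wsc (tensorSub τ' (wsc (sumSpan τ M U)) ⊤)) :
    amp₂ ht hτ ht' hτ' a * S * amp₂ ht hτ ht' hτ' b ∈ sliceSub ht ht' (⨆ i ∈ E, U i) := by
  intro h h' l l'
  rw [amp₂_apply, amp₂_apply, ht'.slice_mul_amp hτ', ht'.slice_amp_mul hτ', slice_flip_amp ht hτ]
  have hR : ht'.slice l l' S ∈ wsc (sumSpan τ M U) := by
    rw [← wsc_idem]
    exact slice_mem_wsc ht' hτ' hS l l'
  refine map_mem_wsc (ht.flip.slice (star a h) (b h')) (fun _ hω => hω.comp_sandwich _ _)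
    (fun R hR => le_wsc ?_) hR
  induction hR using Submodule.span_induction with
  | mem R hR =>
    obtain ⟨i, m, hm, u, hu, rfl⟩ := hR
    have h1 : ht.flip.slice (star a h) (b h') (τ m u) = ⟪h, (a * m * b) h'⟫_ℂ • u := by
      have := ht.flip.slice_tensor hτ.flip (star a h) (b h') u m
      rw [LinearMap.flip_apply] at this
      rw [this, ContinuousLinearMap.star_eq_adjoint, ContinuousLinearMap.adjoint_inner_left]
      rfl
    rw [h1]
    by_cases hi : i ∈ E
    · exact Submodule.smul_mem _ _ (le_iSup₂ (f := fun i (_ : i ∈ E) => U i) i hi hu)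
    · rw [hab i hi m hm, zero_apply, inner_zero_right, zero_smul]
      exact zero_mem _
  | zero => rw [map_zero]; exact zero_mem _
  | add x y _ _ hx hy => rw [map_add]; exact add_mem hx hy
  | smul c x _ hx => rw [map_smul]; exact Submodule.smul_mem _ c hx

theorem cornerBound_of_boundOn [Fintype ι] [DecidableEq ι] (ht : IsElemTensor t)
    (hτ : IsOpTensor t τ) (ht' : IsElemTensor t') (hτ' : IsOpTensor t' τ') (E : Finset ι) {T : B G}
    {c : ℝ} (hc : 0 ≤ c) (hT : BoundOn (wsc (tensorSub τ' (wsc (sumSpan τ M U)) ⊤)) T c) {x y : G}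
    (hxy : ∀ S ∈ sliceSub ht ht' (⨆ i ∈ E, U i), ⟪y, S x⟫_ℂ = 0) :
    CornerBound D M (amp₂ ht hτ ht' hτ') (∅ ∪ (Finset.univ \ E)) T x y (c * ‖x‖ * ‖y‖) := by
  intro a ha b hb ha1 hb1 hab
  set π := amp₂ ht hτ ht' hτ' with hπ
  have e : ∀ S : B G, ⟪y, (π a * S * π b) x⟫_ℂ = ⟪π (star a) y, S (π b x)⟫_ℂ := by
    intro S
    rw [map_star, ContinuousLinearMap.star_eq_adjoint, ContinuousLinearMap.adjoint_inner_left]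
    rfl
  rw [e]
  have hle : ∀ (d : B H) z, ‖d‖ ≤ 1 → ‖π d z‖ ≤ ‖z‖ := fun d z hd => by
    have := (π d).le_of_opNorm_le ((norm_amp_le π d).trans hd) z
    rwa [one_mul] at this
  refine (hT _ _ fun S hS => ?_).trans ?_
  · rw [← e]
    refine hxy _ (corner_mem_sliceSub ht hτ ht' hτ' E (fun i hi m hm => hab i ?_ m hm) hS)
    simpa using hi
  · have h1 := hle b x hb1
    have h2 := hle (star a) y (by rwa [norm_star])
    gcongr

/-- The weak* closed span of the `M i ⊗ U i` is completely hyperreflexive as soon as the spaces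
of operators with slices in the sums of the `U i` are hyperreflexive. -/
theorem hyperBound_sumSpan [Fintype ι] [DecidableEq ι] [TopologicalSpace.SeparableSpace H]
    [TopologicalSpace.SeparableSpace C] (hD : IsMasa D) (hbim : ∀ i, IsBimodule D (M i))
    (hter : ∀ i, IsTernary (M i)) (hcl : ∀ i, wsc (M i) = M i) (ht : IsElemTensor t)
    (hτ : IsOpTensor t τ) (ht' : IsElemTensor t') (hτ' : IsOpTensor t' τ')
    (hX : ∀ E : Finset ι, HyperBound (sliceSub ht ht' (⨆ i ∈ E, U i))) :
    HyperBound (wsc (tensorSub τ' (wsc (sumSpan τ M U)) ⊤)) := by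
  choose k hk hXk using hX
  set N : ℝ := ∑ E : Finset ι, 5 ^ E.card with hN
  have hN0 : 0 < N := Finset.sum_pos (fun _ _ => by positivity) Finset.univ_nonempty
  refine ⟨∑ E : Finset ι, 5 ^ E.card * (k E * 5 ^ (Finset.univ : Finset ι).card),
    Finset.sum_pos (fun E _ => by have := hk E; positivity) Finset.univ_nonempty,
    fun T c hc hT ε hε => ?_⟩
  obtain ⟨f, hfT, hfi, hfc⟩ := exists_decomposition (amp₂ ht hτ ht' hτ') M hD Finset.univ T
  have hbd : ∀ E, BoundOn (sliceSub ht ht' (⨆ i ∈ E, U i)) (f E)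
      (5 ^ (Finset.univ : Finset ι).card * c) := by
    intro E x y hxy
    have := hfc E (Finset.subset_univ _) ∅ x y _ (by positivity)
      (cornerBound_of_boundOn ht hτ ht' hτ' E hc hT hxy) 1 (one_mem _) 1 (one_mem _)
      ContinuousLinearMap.norm_id_le ContinuousLinearMap.norm_id_le (by simp)
    rw [map_one, one_mul, mul_one] at this
    refine this.trans (le_of_eq (by ring))
  have happ : ∀ E, ∃ S ∈ wsc (tensorSub τ' (wsc (sumSpan τ M U)) ⊤), ‖f E - S‖ ≤
      5 ^ E.card * (k E * (5 ^ (Finset.univ : Finset ι).card * c) + ε / N) := by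
    intro E
    obtain ⟨S, hS, hd⟩ := hXk E (f E) _ (by positivity) (hbd E) (ε / N) (by positivity)
    obtain ⟨S', hS', hi, hd'⟩ := exists_intertwine_approx hD M (wsc_sliceSub ht ht' _)
      (fun a _ b _ T hT => sliceSub_bimodule ht hτ ht' hτ' a b hT) E
      (hfi E (Finset.subset_univ _)) hS
    refine ⟨S', wsc_mono (Submodule.span_mono ?_)
      (mem_of_intertwine hD hbim hter hcl ht hτ ht' hτ' E hi hS'), hd'.trans (by gcongr)⟩
    rintro _ ⟨a, ha, u, hu, rfl⟩
    exact ⟨a, le_wsc ha, u, hu, rfl⟩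
  choose S hS hd using happ
  refine ⟨∑ E, S E, sum_mem fun E _ => hS E, ?_⟩
  rw [Finset.powerset_univ] at hfT
  rw [← hfT, ← Finset.sum_sub_distrib]
  refine (norm_sum_le_of_le _ fun E _ => hd E).trans (le_of_eq ?_)
  simp only [mul_add, Finset.sum_add_distrib]
  rw [← Finset.sum_mul, ← hN, mul_div_cancel₀ _ hN0.ne', Finset.sum_mul]
  simp only [mul_assoc]

end Main

end SchurHyper

/-- if `M₁, …, Mₙ ⊆ B(H)` are ternary masa-bimodules and
`U₁, …, Uₙ ⊆ B(K)` are weak* closed subspaces such that the weak* closure of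
every sum `U_{i₁} + ⋯ + U_{iₘ}` over a nonempty index set is completely
hyperreflexive, then the weak* closed span `W` of `M₁⊗U₁ + ⋯ + Mₙ⊗Uₙ` in
`B(H⊗K)` is completely hyperreflexive. -/
theorem stmt19 {H K HK : Type*}
    [NormedAddCommGroup H] [InnerProductSpace ℂ H] [CompleteSpace H]
    [TopologicalSpace.SeparableSpace H]
    [NormedAddCommGroup K] [InnerProductSpace ℂ K] [CompleteSpace K]
    [TopologicalSpace.SeparableSpace K]
    [NormedAddCommGroup HK] [InnerProductSpace ℂ HK] [CompleteSpace HK]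
    (DH : StarSubalgebra ℂ (B H)) (hDH : IsMasa DH)
    (DK : StarSubalgebra ℂ (B K)) (hDK : IsMasa DK)
    (t : H →ₗ[ℂ] K →ₗ[ℂ] HK) (τ : B H →ₗ[ℂ] B K →ₗ[ℂ] B HK)
    (ht : IsElemTensor t) (hτ : IsOpTensor t τ)
    (n : ℕ) (M : Fin n → Submodule ℂ (B H))
    (hMbim : ∀ i, IsBimodule DH (M i))
    (hMcl : ∀ i, WStarClosed H (M i : Set (B H)))
    (hMter : ∀ i, IsTernary (M i))
    (U : Fin n → Submodule ℂ (B K)) (hU : ∀ i, WStarClosed K (U i : Set (B K)))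
    (hUE : ∀ E : Finset (Fin n), E.Nonempty →
      CompletelyHyperreflexive
        (wStarClosure K ((⨆ i ∈ E, U i : Submodule ℂ (B K)) : Set (B K)))) :
    CompletelyHyperreflexive (wStarClosure HK
      ((Submodule.span ℂ
        {z : B HK | ∃ i, ∃ a ∈ (M i : Set (B H)), ∃ c ∈ U i, z = τ a c} :
          Submodule ℂ (B HK)) : Set (B HK))) := by
  intro W _ _ _ t' τ' ht' hτ'
  change Hyperreflexive (wStarClosure W (tensorSpan τ'
    (wStarClosure HK (sumSpan τ M U : Set (B HK))) Set.univ))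
  rw [wStarClosure_tensorSpan, hyperreflexive_iff]
  refine hyperBound_sumSpan hDH hMbim hMter (fun i => wsc_eq_of_wStarClosed (hMcl i)) ht hτ ht' hτ'
    fun E => ?_
  rcases E.eq_empty_or_nonempty with rfl | hE
  · have h0 : (⨆ i ∈ (∅ : Finset (Fin n)), U i) = ⊥ := by simp
    rw [h0]
    exact hyperBound_sliceSub_bot ht ht'
  · exact hyperBound_sliceSub ht hτ ht' (hUE E hE)
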